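/- Let P be a frame polyomino. Then the Castelnuovo–Mumford regularity of K[P] equals the rook number r_P of P. -/

import Mathlib

noncomputable section

open scoped BigOperators

/-! ## Polyominoes -/

/-- Two cells of `ℤ²` (identified with their lower left corners) share an edge. -/
def cellAdj (c d : ℤ × ℤ) : Prop :=
  (c.1 = d.1 ∧ (d.2 = c.2 + 1 ∨ c.2 = d.2 + 1)) ∨
  (c.2 = d.2 ∧ (d.1 = c.1 + 1 ∨ c.1 = d.1 + 1))

/-- A polyomino: a nonempty finite collection of cells of `ℤ²` any two of which are
connected by a path of cells of the collection in which consecutive cells share an edge. -/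
structure Polyomino : Type where
  cells : Finset (ℤ × ℤ)
  nonempty : cells.Nonempty
  connected : ∀ c ∈ cells, ∀ d ∈ cells,
    Relation.ReflTransGen (fun u v => u ∈ cells ∧ v ∈ cells ∧ cellAdj u v) c d

/-- The four vertices of the cell with lower left corner `c`. -/
def cellVertices (c : ℤ × ℤ) : Finset (ℤ × ℤ) :=
  {c, (c.1 + 1, c.2), (c.1, c.2 + 1), (c.1 + 1, c.2 + 1)}

/-- The vertex set `V(P)` of a polyomino. -/
def Polyomino.vertexSet (P : Polyomino) : Finset (ℤ × ℤ) :=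
  P.cells.biUnion cellVertices

/-- The rank of `P`: the number of its cells. -/
def Polyomino.rank (P : Polyomino) : ℕ := P.cells.card

/-- The cell with lower left corner `c` is contained in the interval `[a, b]` of `ℤ²`. -/
def cellInInterval (a b c : ℤ × ℤ) : Prop :=
  a.1 ≤ c.1 ∧ c.1 + 1 ≤ b.1 ∧ a.2 ≤ c.2 ∧ c.2 + 1 ≤ b.2

/-- `[a, b]` is an inner interval of the polyomino `P`: it is a proper interval all of whose
cells belong to `P`. -/
def IsInnerInterval (P : Polyomino) (a b : ℤ × ℤ) : Prop :=
  a.1 < b.1 ∧ a.2 < b.2 ∧ ∀ c : ℤ × ℤ, cellInInterval a b c → c ∈ P.cells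

/-! ## North-east paths, parallelogram and frame polyominoes -/

/-- A north-east path: consecutive points form east or north steps. -/
def IsNEPath (L : List (ℤ × ℤ)) : Prop :=
  L ≠ [] ∧ L.Chain' (fun u v => v = (u.1 + 1, u.2) ∨ v = (u.1, u.2 + 1))

/-- The path `L` contains the east step from `(x, h)` to `(x + 1, h)`. -/
def eastStepOf (L : List (ℤ × ℤ)) (x h : ℤ) : Prop :=
  ((x, h), (x + 1, h)) ∈ L.zip L.tail

/-- The cell with lower left corner `c` lies (strictly) below the north-east path `L`. -/
def cellBelowPath (L : List (ℤ × ℤ)) (c : ℤ × ℤ) : Prop :=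
  ∃ h, eastStepOf L c.1 h ∧ c.2 < h

/-- The cell with lower left corner `c` lies (weakly) above the north-east path `L`. -/
def cellAbovePath (L : List (ℤ × ℤ)) (c : ℤ × ℤ) : Prop :=
  ∃ h, eastStepOf L c.1 h ∧ h ≤ c.2

/-- The interior points of a path (all points except the two endpoints). -/
def interiorPts (L : List (ℤ × ℤ)) : List (ℤ × ℤ) := (L.drop 1).dropLast

/-- `S1` lies above `S2`. -/
def LiesAbove (S1 S2 : List (ℤ × ℤ)) : Prop :=
  ∀ p ∈ interiorPts S1, ∀ q ∈ interiorPts S2, p.1 = q.1 → q.2 < p.2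

/-- The combinatorial data of a pair of north-east paths with the same endpoints,
the first lying above the second. -/
structure ParallelogramOn (S1 S2 : List (ℤ × ℤ)) : Prop where
  ne1 : IsNEPath S1
  ne2 : IsNEPath S2
  headEq : S1.head? = S2.head?
  lastEq : S1.getLast? = S2.getLast?
  above : LiesAbove S1 S2

/-- The cells of the region bounded above by `S1` and below by `S2`. -/
def parCells (S1 S2 : List (ℤ × ℤ)) : Set (ℤ × ℤ) :=
  {c | cellBelowPath S1 c ∧ cellAbovePath S2 c}

/-- `P` is a parallelogram polyomino. -/
def IsParallelogram (P : Polyomino) : Prop :=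
  ∃ S1 S2 : List (ℤ × ℤ), ParallelogramOn S1 S2 ∧
    (↑P.cells : Set (ℤ × ℤ)) = parCells S1 S2

/-- The data defining a frame polyomino: a rectangle `[(1,1),(m,n)]` and a parallelogram
polyomino determined by `S1, S2` with endpoints `(a0, b0)` and `(ak, bk)`. -/
structure FrameData : Type where
  m : ℤ
  n : ℤ
  S1 : List (ℤ × ℤ)
  S2 : List (ℤ × ℤ)
  a0 : ℤ
  b0 : ℤ
  ak : ℤ
  bk : ℤ
  par : ParallelogramOn S1 S2
  head1 : S1.head? = some (a0, b0)
  last1 : S1.getLast? = some (ak, bk)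
  ha0 : 1 < a0
  hak : a0 < ak
  ham : ak < m
  hb0 : 1 < b0
  hbk : b0 < bk
  hbn : bk < n

/-- The cells of the hole of a frame polyomino. -/
def FrameData.holeCells (D : FrameData) : Set (ℤ × ℤ) := parCells D.S1 D.S2

/-- The cells of the ambient rectangle `[(1,1),(m,n)]`. -/
def FrameData.rectCells (D : FrameData) : Set (ℤ × ℤ) :=
  {c | 1 ≤ c.1 ∧ c.1 + 1 ≤ D.m ∧ 1 ≤ c.2 ∧ c.2 + 1 ≤ D.n}

/-- `P` is the frame polyomino determined by the data `D`. -/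
def IsFrame (P : Polyomino) (D : FrameData) : Prop :=
  (↑P.cells : Set (ℤ × ℤ)) = D.rectCells \ D.holeCells

/-! ## The polyomino ideal -/

/-- The order on the variables: `x_(i,j) > x_(k,l)` iff `j > l`, or `j = l` and `i > k`.
`varlt u v` says that the variable `x_u` is smaller than `x_v`. -/
def varlt (u v : ℤ × ℤ) : Prop := u.2 < v.2 ∨ (u.2 = v.2 ∧ u.1 < v.1)

/-- The vertices of `P`, as a type. -/
abbrev PVertex (P : Polyomino) : Type := {v : ℤ × ℤ // v ∈ P.vertexSet}

/-- The polynomial ring `S_P = K[x_v : v ∈ V(P)]`. -/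
abbrev PolyRing (K : Type) [Field K] (P : Polyomino) : Type := MvPolynomial (PVertex P) K

/-- The set of inner 2-minors of `P`. -/
def innerMinors (K : Type) [Field K] (P : Polyomino) : Set (PolyRing K P) :=
  { f | ∃ a b c d : PVertex P,
      IsInnerInterval P a.1 b.1 ∧ c.1 = (a.1.1, b.1.2) ∧ d.1 = (b.1.1, a.1.2) ∧
      f = MvPolynomial.X a * MvPolynomial.X b - MvPolynomial.X c * MvPolynomial.X d }

/-- The polyomino ideal `I_P`. -/
def polyIdeal (K : Type) [Field K] (P : Polyomino) : Ideal (PolyRing K P) :=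
  Ideal.span (innerMinors K P)

/-- The coordinate ring `K[P] = S_P / I_P`. -/
abbrev CoordRing (K : Type) [Field K] (P : Polyomino) : Type :=
  PolyRing K P ⧸ polyIdeal K P

/-! ## Monomial orders, initial ideals and Gröbner bases -/

/-- The (degree) reverse lexicographic order on monomials induced by the
variable order `vlt`: first compare total degrees; for equal total degrees,
`m₁ < m₂` iff the smallest variable whose exponents differ has a larger exponent in `m₁`. -/
def revlexLT {α : Type} (vlt : α → α → Prop) (m₁ m₂ : α →₀ ℕ) : Prop :=
  (m₁.sum fun _ e => e) < (m₂.sum fun _ e => e) ∨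
  ((m₁.sum fun _ e => e) = (m₂.sum fun _ e => e) ∧
    ∃ v, m₂ v < m₁ v ∧ ∀ w, vlt w v → m₁ w = m₂ w)

/-- The monomial order `<` on `S_P`. -/
def pmonLT (P : Polyomino) : (PVertex P →₀ ℕ) → (PVertex P →₀ ℕ) → Prop :=
  revlexLT fun u v => varlt u.1 v.1

/-- `m` is the leading monomial of `f` with respect to the monomial order `lt`. -/
def IsLeadMon {α K : Type} [CommSemiring K] (lt : (α →₀ ℕ) → (α →₀ ℕ) → Prop)
    (f : MvPolynomial α K) (m : α →₀ ℕ) : Prop :=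
  m ∈ f.support ∧ ∀ m' ∈ f.support, m' ≠ m → lt m' m

/-- The initial ideal of `I` with respect to the monomial order `lt`: the ideal generated by
the leading monomials of the nonzero elements of `I`. -/
def initialIdeal {α K : Type} [CommSemiring K] (lt : (α →₀ ℕ) → (α →₀ ℕ) → Prop)
    (I : Ideal (MvPolynomial α K)) : Ideal (MvPolynomial α K) :=
  Ideal.span { g | ∃ f ∈ I, f ≠ 0 ∧ ∃ m, IsLeadMon lt f m ∧ g = MvPolynomial.monomial m 1 }

/-- The initial ideal `in_<(I_P)`. -/
def inIdeal (K : Type) [Field K] (P : Polyomino) : Ideal (PolyRing K P) :=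
  initialIdeal (pmonLT P) (polyIdeal K P)

/-- `G` is a Gröbner basis of `I` with respect to `lt`. -/
def IsGroebnerBasis {α K : Type} [CommSemiring K] (lt : (α →₀ ℕ) → (α →₀ ℕ) → Prop)
    (G : Set (MvPolynomial α K)) (I : Ideal (MvPolynomial α K)) : Prop :=
  G ⊆ (I : Set (MvPolynomial α K)) ∧
  initialIdeal lt I =
    Ideal.span { g | ∃ f ∈ G, ∃ m, IsLeadMon lt f m ∧ g = MvPolynomial.monomial m 1 }

/-- `G` is the reduced Gröbner basis of `I` with respect to `lt`: it is a Gröbner basis,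
each element is monic, and no monomial occurring in an element of `G` is divisible by the
leading monomial of a different element of `G`. -/
def IsReducedGroebnerBasis {α K : Type} [CommSemiring K] (lt : (α →₀ ℕ) → (α →₀ ℕ) → Prop)
    (G : Set (MvPolynomial α K)) (I : Ideal (MvPolynomial α K)) : Prop :=
  IsGroebnerBasis lt G I ∧
  (∀ f ∈ G, ∃ m, IsLeadMon lt f m ∧ MvPolynomial.coeff m f = 1) ∧
  (∀ f ∈ G, ∀ m ∈ (f : MvPolynomial α K).support, ∀ f' ∈ G, f' ≠ f →
    ∀ m', IsLeadMon lt f' m' → ¬ m' ≤ m)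

/-! ## The simplicial complex Δ(P) -/

/-- The squarefree exponent vector supported on `W ∩ V(P)`. -/
def expOf (P : Polyomino) (W : Finset (ℤ × ℤ)) : PVertex P →₀ ℕ :=
  ∑ v ∈ P.vertexSet.attach, if v.1 ∈ W then Finsupp.single v 1 else 0

/-- `W` is a face of the simplicial complex `Δ(P)` whose Stanley–Reisner ideal is
`in_<(I_P)`: `W ⊆ V(P)` and the product of the variables indexed by `W` is not in
`in_<(I_P)`. -/
def IsFace (K : Type) [Field K] (P : Polyomino) (W : Finset (ℤ × ℤ)) : Prop :=
  (↑W : Set (ℤ × ℤ)) ⊆ (↑P.vertexSet : Set (ℤ × ℤ)) ∧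
  MvPolynomial.monomial (expOf P W) (1 : K) ∉ inIdeal K P

/-- `W` is a facet (maximal face) of `Δ(P)`. -/
def IsFacet (K : Type) [Field K] (P : Polyomino) (W : Finset (ℤ × ℤ)) : Prop :=
  IsFace K P W ∧ ∀ W' : Finset (ℤ × ℤ), IsFace K P W' → W ⊆ W' → W = W'

/-- `{p, q, r}` is a step of the face `W`, with lower right corner `q`. -/
def IsStep (P : Polyomino) (W : Finset (ℤ × ℤ)) (p q r : ℤ × ℤ) : Prop :=
  p ∈ W ∧ q ∈ W ∧ r ∈ W ∧
  p.2 = q.2 ∧ q.1 = r.1 ∧ p.1 < q.1 ∧ q.2 < r.2 ∧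
  (∀ w ∈ W, w.2 = p.2 → p.1 < w.1 → w.1 < q.1 → False) ∧
  (∀ w ∈ W, w.1 = q.1 → q.2 < w.2 → w.2 < r.2 → False) ∧
  (q.1 - 1, q.2) ∈ P.cells

/-- The number of steps of a face `W`. -/
def stepCount (P : Polyomino) (W : Finset (ℤ × ℤ)) : ℕ :=
  Set.ncard { t : (ℤ × ℤ) × (ℤ × ℤ) × (ℤ × ℤ) | IsStep P W t.1 t.2.1 t.2.2 }

/-- The simplicial complex generated by a collection of subsets. -/
def genComplex (F : Set (Finset (ℤ × ℤ))) : Set (Finset (ℤ × ℤ)) :=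
  { W | ∃ G ∈ F, W ⊆ G }

/-- The lexicographic order on facets: `flexLT F G` iff, listing the elements of `F` and `G`
in decreasing order with respect to the total order on `V(P)`, at the first position where
the lists differ the element of `F` is greater.  Equivalently, the largest element of the
symmetric difference belongs to `F`. -/
def flexLT (F G : Finset (ℤ × ℤ)) : Prop :=
  ∃ v, v ∈ F ∧ v ∉ G ∧ ∀ w, varlt v w → (w ∈ F ↔ w ∈ G)

/-- The facet `F₀` of `Δ(P)`. -/
def FrameData.F0 (D : FrameData) : Finset (ℤ × ℤ) :=
  Finset.Icc ((1 : ℤ), (1 : ℤ)) (1, D.n) ∪ Finset.Icc ((1 : ℤ), D.n) (D.m, D.n) ∪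
    (D.S2.toFinset \ {(D.a0, D.b0), (D.ak, D.bk)})

/-! ## Edge intervals -/

/-- The horizontal unit edge from `(x, y)` to `(x + 1, y)` is an edge of a cell of `P`. -/
def hEdge (P : Polyomino) (x y : ℤ) : Prop :=
  (x, y) ∈ P.cells ∨ (x, y - 1) ∈ P.cells

/-- The vertical unit edge from `(x, y)` to `(x, y + 1)` is an edge of a cell of `P`. -/
def vEdge (P : Polyomino) (x y : ℤ) : Prop :=
  (x, y) ∈ P.cells ∨ (x - 1, y) ∈ P.cells

/-- `[(i, j), (k, j)]` is a maximal horizontal edge interval of `P`. -/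
def IsMaxHEdgeInterval (P : Polyomino) (i k j : ℤ) : Prop :=
  i < k ∧ (∀ l, i ≤ l → l < k → hEdge P l j) ∧ ¬ hEdge P (i - 1) j ∧ ¬ hEdge P k j

/-- `[(x, j), (x, l)]` is a maximal vertical edge interval of `P`. -/
def IsMaxVEdgeInterval (P : Polyomino) (x j l : ℤ) : Prop :=
  j < l ∧ (∀ y, j ≤ y → y < l → vEdge P x y) ∧ ¬ vEdge P x (j - 1) ∧ ¬ vEdge P x l

/-- The vertex set of the collection of cells of `P` contained in the interval `[a, b]`. -/
def boxVertexSet (P : Polyomino) (a b : ℤ × ℤ) : Set (ℤ × ℤ) :=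
  { v | ∃ c ∈ P.cells, cellInInterval a b c ∧ v ∈ cellVertices c }

/-! ## Rook configurations -/

/-- Two (distinct) cells of `P` are in attacking position: they belong to the same row or
the same column of cells of `P`. -/
def attacking (P : Polyomino) (c d : ℤ × ℤ) : Prop :=
  c ≠ d ∧
  ((c.2 = d.2 ∧ ∀ x, min c.1 d.1 ≤ x → x ≤ max c.1 d.1 → (x, c.2) ∈ P.cells) ∨
   (c.1 = d.1 ∧ ∀ y, min c.2 d.2 ≤ y → y ≤ max c.2 d.2 → (c.1, y) ∈ P.cells))

/-- `R` is a configuration of pairwise non-attacking rooks placed on cells of `P`. -/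
def IsRookConfig (P : Polyomino) (R : Finset (ℤ × ℤ)) : Prop :=
  (↑R : Set (ℤ × ℤ)) ⊆ (↑P.cells : Set (ℤ × ℤ)) ∧ ∀ c ∈ R, ∀ d ∈ R, ¬ attacking P c d

/-- Two cells are the diagonal cells of an inner interval of `P`. -/
def diagPair (P : Polyomino) (c d : ℤ × ℤ) : Prop :=
  ∃ a b : ℤ × ℤ, IsInnerInterval P a b ∧
    ((c = a ∧ d = (b.1 - 1, b.2 - 1)) ∨ (d = a ∧ c = (b.1 - 1, b.2 - 1)))

/-- Two cells are the anti-diagonal cells of an inner interval of `P`. -/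
def antiDiagPair (P : Polyomino) (c d : ℤ × ℤ) : Prop :=
  ∃ a b : ℤ × ℤ, IsInnerInterval P a b ∧
    ((c = (a.1, b.2 - 1) ∧ d = (b.1 - 1, a.2)) ∨ (d = (a.1, b.2 - 1) ∧ c = (b.1 - 1, a.2)))

/-- One switch: replace two rooks placed on the diagonal cells of an inner interval by rooks
on its anti-diagonal cells, or vice versa. -/
def switchStep (P : Polyomino) (R R' : Finset (ℤ × ℤ)) : Prop :=
  ∃ a b : ℤ × ℤ, IsInnerInterval P a b ∧
    ((a ∈ R ∧ (b.1 - 1, b.2 - 1) ∈ R ∧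
      R' = insert (a.1, b.2 - 1) (insert (b.1 - 1, a.2)
        ((R.erase a).erase (b.1 - 1, b.2 - 1)))) ∨
     ((a.1, b.2 - 1) ∈ R ∧ (b.1 - 1, a.2) ∈ R ∧
      R' = insert a (insert (b.1 - 1, b.2 - 1)
        ((R.erase (a.1, b.2 - 1)).erase (b.1 - 1, a.2)))))

/-- A canonical configuration: no two rooks are in anti-diagonal position. -/
def IsCanonical (P : Polyomino) (R : Finset (ℤ × ℤ)) : Prop :=
  ∀ c ∈ R, ∀ d ∈ R, ¬ antiDiagPair P c d

/-- The `k`-rook configurations of `P`, as a type. -/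
def RookConfigType (P : Polyomino) (k : ℕ) : Type :=
  { R : Finset (ℤ × ℤ) // IsRookConfig P R ∧ R.card = k }

/-- `r̃_k`: the number of equivalence classes of `k`-rook configurations of `P` under the
equivalence generated by switches. -/
def rtil (P : Polyomino) (k : ℕ) : ℕ :=
  Nat.card (Quot fun R S : RookConfigType P k => switchStep P R.1 S.1)

/-- The rook number of `P`: the maximum number of pairwise non-attacking rooks in `P`. -/
def rookNumber (P : Polyomino) : ℕ :=
  sSup { k | ∃ R : Finset (ℤ × ℤ), IsRookConfig P R ∧ R.card = k }

/-! ## Hilbert functions -/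

/-- The Hilbert function of the standard graded algebra `K[P]`. -/
def hilbertFunction (K : Type) [Field K] (P : Polyomino) (k : ℕ) : ℕ :=
  Module.finrank K
    (Submodule.map (Ideal.Quotient.mkₐ K (polyIdeal K P)).toLinearMap
      (MvPolynomial.homogeneousSubmodule (PVertex P) K k))

/-- The Hilbert–Poincaré series of `K[P]`, as a power series over `ℤ`. -/
def hilbertSeries (K : Type) [Field K] (P : Polyomino) : PowerSeries ℤ :=
  PowerSeries.mk fun k => (hilbertFunction K P k : ℤ)

set_option synthInstance.maxHeartbeats 1000000 in
/-- `K[P]` is Cohen–Macaulay: there exists a regular sequence, consisting of elements of the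
irrelevant maximal ideal, whose length equals the Krull dimension of `K[P]`. -/
def IsCMCoordRing (K : Type) [Field K] (P : Polyomino) : Prop :=
  ∃ rs : List (CoordRing K P),
    RingTheory.Sequence.IsRegular (CoordRing K P) rs ∧
    (∀ r ∈ rs, r ∈ Ideal.map (Ideal.Quotient.mk (polyIdeal K P))
      (Ideal.span (Set.range (MvPolynomial.X : PVertex P → PolyRing K P)))) ∧
    (rs.length : WithBot (WithTop ℕ)) = ringKrullDim (CoordRing K P)

/-! ## Maximal chains and descents (for parallelogram polyominoes) -/

/-- `C` is a maximal chain of the poset `V(P)` (with the componentwise order). -/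
def IsMaximalChainOn (P : Polyomino) (C : Finset (ℤ × ℤ)) : Prop :=
  (↑C : Set (ℤ × ℤ)) ⊆ (↑P.vertexSet : Set (ℤ × ℤ)) ∧
  IsChain (· ≤ ·) (↑C : Set (ℤ × ℤ)) ∧
  ∀ C' : Finset (ℤ × ℤ), (↑C' : Set (ℤ × ℤ)) ⊆ (↑P.vertexSet : Set (ℤ × ℤ)) →
    IsChain (· ≤ ·) (↑C' : Set (ℤ × ℤ)) → C ⊆ C' → C = C'

/-- The chain `C` has a descent at the cell of `P` with lower left corner `c`. -/
def descentAt (P : Polyomino) (C : Finset (ℤ × ℤ)) (c : ℤ × ℤ) : Prop :=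
  c ∈ P.cells ∧ c ∈ C ∧ (c.1 + 1, c.2) ∈ C ∧ (c.1 + 1, c.2 + 1) ∈ C

/-- The number of descents of the chain `C`. -/
def descentCount (P : Polyomino) (C : Finset (ℤ × ℤ)) : ℕ :=
  Set.ncard { c : ℤ × ℤ | descentAt P C c }

/-! ## Minimal graded free resolutions and Castelnuovo–Mumford regularity -/

/-- A finite minimal graded free resolution of `S_P / I` over `S_P`:
`F_d = ⊕_{i} S_P(-tw d i)` with `F_0 = S_P`, differentials given by matrices of homogeneous
polynomials of the appropriate degrees with entries in the irrelevant maximal ideal,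
exact away from homological degree `0` and with image `I` in homological degree `0`. -/
structure MinimalGradedFreeResolution (K : Type) [Field K] (P : Polyomino)
    (I : Ideal (PolyRing K P)) : Type where
  len : ℕ
  t : ℕ → ℕ
  tw : (d : ℕ) → Fin (t d) → ℤ
  mat : (d : ℕ) → Matrix (Fin (t d)) (Fin (t (d + 1))) (PolyRing K P)
  t0 : t 0 = 1
  tw0 : ∀ i, tw 0 i = 0
  finite : ∀ d, len < d → t d = 0
  graded : ∀ d i j, mat d i j = 0 ∨
    ∃ e : ℕ, (e : ℤ) = tw (d + 1) j - tw d i ∧ (mat d i j).IsHomogeneous e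
  minimal : ∀ d i j, MvPolynomial.coeff 0 (mat d i j) = 0
  aug : LinearMap.range (mat 0).mulVecLin =
    Submodule.pi Set.univ (fun _ : Fin (t 0) => I)
  isexact : ∀ d, LinearMap.range (mat (d + 1)).mulVecLin = LinearMap.ker (mat d).mulVecLin

end


set_option linter.unusedSectionVars false
set_option linter.unusedSimpArgs false
set_option linter.unusedVariables false

namespace FrameReg
open Finset

section Koszul
variable {σ : Type} [Fintype σ] [LinearOrder σ]

/-- Koszul sign. -/
def sg (v : σ) (J : Finset σ) : ℤ := (-1) ^ (J.filter (· < v)).card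

lemma sg_mul_self (v : σ) (J : Finset σ) : sg v J * sg v J = 1 := by
  unfold sg
  rw [← mul_pow]; simp

lemma sg_insert_self (v : σ) (J : Finset σ) : sg v (insert v J) = sg v J := by
  unfold sg
  rw [filter_insert]; simp

lemma sg_erase_self (v : σ) (J : Finset σ) : sg v (J.erase v) = sg v J := by
  unfold sg
  rw [filter_erase, erase_eq_of_notMem]; simp

lemma sg_insert (v w : σ) (J : Finset σ) (hw : w ∉ J) :
    sg v (insert w J) = if w < v then - sg v J else sg v J := by
  unfold sg
  rw [filter_insert]
  split_ifs with h
  · rw [card_insert_of_notMem (by simp [hw]), pow_succ]; ring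
  · rfl

lemma sg_swap {v w : σ} {J : Finset σ} (hv : v ∉ J) (hw : w ∉ J) (h : v ≠ w) :
    sg v J * sg w (insert v J) = - (sg w J * sg v (insert w J)) := by
  rw [sg_insert _ _ _ hv, sg_insert _ _ _ hw]
  rcases lt_or_gt_of_ne h with h | h
  · rw [if_pos h, if_neg (not_lt.2 h.le)]; ring
  · rw [if_pos h, if_neg (not_lt.2 h.le)]; ring

variable {K : Type} [Field K] {M : Type*} [AddCommGroup M] [Module (MvPolynomial σ K) M]

/-- The Koszul differential on chains with values in `M`. -/
noncomputable def kos : (Finset σ → M) →ₗ[MvPolynomial σ K] (Finset σ → M) where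
  toFun f J := ∑ v ∈ Jᶜ, sg v J • ((MvPolynomial.X v : MvPolynomial σ K) • f (insert v J))
  map_add' f g := by
    funext J; simp [Finset.sum_add_distrib]
  map_smul' c f := by
    funext J
    simp only [Pi.smul_apply, RingHom.id_apply, Finset.smul_sum]
    refine Finset.sum_congr rfl fun v _ => ?_
    rw [smul_comm c (sg v J), smul_comm c]

lemma kos_apply (f : Finset σ → M) (J : Finset σ) :
    kos (K := K) f J = ∑ v ∈ Jᶜ, sg v J • ((MvPolynomial.X v : MvPolynomial σ K) • f (insert v J)) := rfl

lemma kos_kos (f : Finset σ → M) : kos (K := K) (kos (K := K) f) = 0 := by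
  funext J
  rw [kos_apply]
  simp only [kos_apply, Finset.smul_sum]
  rw [Finset.sum_sigma']
  refine Finset.sum_involution (fun a _ => ⟨a.2, a.1⟩) ?_ ?_ ?_ ?_
  · rintro ⟨v, w⟩ h
    simp only [mem_sigma, mem_compl, mem_insert, not_or] at h
    obtain ⟨hv, hwv, hw⟩ := h
    simp only
    rw [smul_comm (MvPolynomial.X v : MvPolynomial σ K) (sg w _),
      smul_comm (MvPolynomial.X w : MvPolynomial σ K) (sg v _), smul_smul (sg v J), smul_smul (sg w J),
      sg_swap hv hw (Ne.symm hwv), Finset.insert_comm w v,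
      smul_comm (MvPolynomial.X v : MvPolynomial σ K) (MvPolynomial.X w : MvPolynomial σ K), neg_smul]
    simp
  · rintro ⟨v, w⟩ h _ h'
    simp only [mem_sigma, mem_compl, mem_insert, not_or] at h
    simp only [Sigma.mk.injEq] at h'
    exact h.2.1 h'.1
  · rintro ⟨v, w⟩ h
    simp only [mem_sigma, mem_compl, mem_insert, not_or] at h ⊢
    exact ⟨h.2.2, Ne.symm h.2.1, h.1⟩
  · rintro ⟨v, w⟩ h; rfl

lemma kos_single (J : Finset σ) (m : M) :
    kos (K := K) (Pi.single J m) = ∑ v ∈ J, sg v J • Pi.single (J.erase v) ((MvPolynomial.X v : MvPolynomial σ K) • m) := by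
  funext I
  rw [kos_apply, Finset.sum_apply]
  simp only [Pi.smul_apply]
  have h1 : ∀ v ∈ Iᶜ, sg v I • ((MvPolynomial.X v : MvPolynomial σ K) • (Pi.single J m : Finset σ → M) (insert v I))
      = if insert v I = J then sg v I • ((MvPolynomial.X v : MvPolynomial σ K) • m) else 0 := by
    intro v _
    rw [Pi.single_apply]; split_ifs <;> simp
  have h2 : ∀ v ∈ J, sg v J • (Pi.single (J.erase v) ((MvPolynomial.X v : MvPolynomial σ K) • m) : Finset σ → M) I
      = if J.erase v = I then sg v J • ((MvPolynomial.X v : MvPolynomial σ K) • m) else 0 := by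
    intro v _
    rw [Pi.single_apply]
    by_cases h : J.erase v = I
    · rw [if_pos h, if_pos h.symm]
    · rw [if_neg h, if_neg (Ne.symm h)]; simp
  rw [Finset.sum_congr rfl h1, Finset.sum_congr rfl h2, ← Finset.sum_filter, ← Finset.sum_filter]
  refine Finset.sum_congr ?_ ?_
  · ext v
    simp only [mem_filter, mem_compl]
    constructor
    · rintro ⟨h, rfl⟩; exact ⟨mem_insert_self _ _, erase_insert h⟩
    · rintro ⟨h, rfl⟩; exact ⟨notMem_erase _ _, insert_erase h⟩
  · intro v hv
    simp only [mem_filter, mem_compl] at hv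
    rw [← hv.2, sg_erase_self]

lemma kos_map {N : Type*} [AddCommGroup N] [Module (MvPolynomial σ K) N]
    (φ : M →ₗ[MvPolynomial σ K] N) (f : Finset σ → M) (J : Finset σ) :
    kos (K := K) (fun J => φ (f J)) J = φ (kos (K := K) f J) := by
  simp [kos_apply, map_sum]

end Koszul

section Morse
variable {K : Type} [Field K] {C : Type*} [AddCommGroup C] [Module K C] {B : Type*}

/-- span of basis elements of given type and level at least `p`. -/
def Sp (e : B → C) (K : Type) [Field K] [Module K C] (typ : B → ℕ × ℕ) (lev : B → ℕ) (q j p : ℕ) : Submodule K C :=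
  Submodule.span K (e '' {b | typ b = (q, j) ∧ p ≤ lev b})

structure MorseData (e : Module.Basis B K C) (dd h : C →ₗ[K] C) (typ : B → ℕ × ℕ) (lev : B → ℕ)
    (crit : B → Prop) : Prop where
  sq : ∀ x, dd (dd x) = 0
  H1 : ∀ b, dd (e b) ∈ Submodule.span K (e '' {b' | (typ b').1 + 1 = (typ b).1 ∧ (typ b').2 = (typ b).2 ∧ lev b ≤ lev b'})
  H2 : ∀ b, h (e b) ∈ Sp e K typ lev ((typ b).1 + 1) (typ b).2 (lev b)
  H3 : ∀ b, ¬ crit b → dd (h (e b)) + h (dd (e b)) - e b ∈ Sp e K typ lev (typ b).1 (typ b).2 (lev b + 1)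
  H4 : ∀ q j, ∃ N, ∀ b, typ b = (q, j) → lev b < N

namespace MorseData
variable {e : Module.Basis B K C} {dd h : C →ₗ[K] C} {typ : B → ℕ × ℕ} {lev : B → ℕ}
    {crit : B → Prop}

lemma Sp_mono {q j p p' : ℕ} (hp : p' ≤ p) : Sp e K typ lev q j p ≤ Sp e K typ lev q j p' := by
  apply Submodule.span_mono
  rintro _ ⟨b, ⟨h1, h2⟩, rfl⟩
  exact ⟨b, ⟨h1, hp.trans h2⟩, rfl⟩

lemma dd_mem (D : MorseData e dd h typ lev crit) {q j p : ℕ} {x : C} (hx : x ∈ Sp e K typ lev (q + 1) j p) :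
    dd x ∈ Sp e K typ lev q j p := by
  have : Sp e K typ lev (q+1) j p ≤ (Sp e K typ lev q j p).comap dd := by
    apply Submodule.span_le.2
    rintro _ ⟨b, ⟨h1, h2⟩, rfl⟩
    refine Submodule.span_mono ?_ (D.H1 b)
    rintro _ ⟨b', ⟨h3, h4, h5⟩, rfl⟩
    refine ⟨b', ⟨?_, h2.trans h5⟩, rfl⟩
    rw [h1] at h3 h4
    ext <;> simp_all
  exact this hx

lemma dd_zero (D : MorseData e dd h typ lev crit) {j p : ℕ} {x : C} (hx : x ∈ Sp e K typ lev 0 j p) :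
    dd x = 0 := by
  have : Sp e K typ lev 0 j p ≤ (⊥ : Submodule K C).comap dd := by
    apply Submodule.span_le.2
    rintro _ ⟨b, ⟨h1, h2⟩, rfl⟩
    have := (D.H1 b)
    have h0 : {b' | (typ b').1 + 1 = (typ b).1 ∧ (typ b').2 = (typ b).2 ∧ lev b ≤ lev b'} = ∅ := by
      ext b'; simp [h1]
    rw [h0] at this
    simpa using this
  simpa using this hx

lemma h_mem (D : MorseData e dd h typ lev crit) {q j p : ℕ} {x : C} (hx : x ∈ Sp e K typ lev q j p) :
    h x ∈ Sp e K typ lev (q + 1) j p := by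
  have : Sp e K typ lev q j p ≤ (Sp e K typ lev (q+1) j p).comap h := by
    apply Submodule.span_le.2
    rintro _ ⟨b, ⟨h1, h2⟩, rfl⟩
    have := D.H2 b
    rw [h1] at this
    exact Sp_mono h2 this
  exact this hx

lemma N_mem (D : MorseData e dd h typ lev crit) {q j p : ℕ} (hc : ∀ b, typ b = (q, j) → ¬ crit b)
    {x : C} (hx : x ∈ Sp e K typ lev q j p) :
    dd (h x) + h (dd x) - x ∈ Sp e K typ lev q j (p + 1) := by
  have : Sp e K typ lev q j p ≤ (Sp e K typ lev q j (p+1)).comap (dd ∘ₗ h + h ∘ₗ dd - LinearMap.id) := by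
    apply Submodule.span_le.2
    rintro _ ⟨b, ⟨h1, h2⟩, rfl⟩
    have := D.H3 b (hc b h1)
    rw [h1] at this
    exact Sp_mono (by omega) this
  exact this hx

lemma lemA (D : MorseData e dd h typ lev crit) {q j : ℕ} (hc : ∀ b, typ b = (q, j) → ¬ crit b) (p : ℕ)
    (z : C) (hz : z ∈ Sp e K typ lev q j p) (hd : dd z = 0) :
    ∃ y ∈ Sp e K typ lev (q + 1) j p, dd y = z := by
  obtain ⟨N, hN⟩ := D.H4 q j
  obtain ⟨k, hk⟩ : ∃ k, N ≤ p + k := ⟨N, by omega⟩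
  induction k generalizing p z with
  | zero =>
    have : Sp e K typ lev q j p = ⊥ := by
      unfold Sp
      have : {b | typ b = (q, j) ∧ p ≤ lev b} = ∅ := by
        ext b; simp only [Set.mem_ofPred_eq, Set.mem_empty_iff_false, iff_false]
        rintro ⟨h1, h2⟩
        have := hN b h1; omega
      rw [this]; simp
    rw [this] at hz
    have : z = 0 := by simpa using hz
    exact ⟨0, Submodule.zero_mem _, by simp [this]⟩
  | succ k ih =>
    have h1 := D.N_mem hc hz
    rw [hd, map_zero, add_zero] at h1
    obtain ⟨y, hy, hy'⟩ := ih (p+1) _ h1 (by rw [map_sub, D.sq, hd, sub_zero]) (by omega)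
    refine ⟨h z - y, Submodule.sub_mem _ (D.h_mem hz) (Sp_mono (by omega) hy), ?_⟩
    rw [map_sub, hy']; abel

lemma lemC (D : MorseData e dd h typ lev crit) {q j : ℕ} (hc : ∀ b, typ b = (q + 1, j) → ¬ crit b) (p : ℕ)
    (y : C) (hy : y ∈ Sp e K typ lev (q + 1) j 0) (hd : dd y ∈ Sp e K typ lev q j p) :
    ∃ y' ∈ Sp e K typ lev (q + 1) j p, dd y' = dd y := by
  suffices H : ∀ k ≤ p, ∃ y' ∈ Sp e K typ lev (q + 1) j k, dd y' = dd y from H p le_rfl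
  intro k
  induction k with
  | zero => intro _; exact ⟨y, hy, rfl⟩
  | succ k ih =>
    intro hk
    obtain ⟨y', h1, h2⟩ := ih (by omega)
    refine ⟨h (dd y') - (dd (h y') + h (dd y') - y'), Submodule.sub_mem _ ?_ (D.N_mem hc h1), ?_⟩
    · rw [h2]; exact D.h_mem (Sp_mono hk hd)
    · rw [map_sub, map_sub, map_add, D.sq, ← h2]; abel

lemma lemB (D : MorseData e dd h typ lev crit) {q j : ℕ} (b₀ : B) (hb : typ b₀ = (q, j))
    (hc : ∀ b, typ b = (q + 1, j) → ¬ crit b) (hc' : ∀ b, (typ b).1 + 1 = q → (typ b).2 = j → ¬ crit b)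
    (hdb : dd (e b₀) ∈ Submodule.span K (e '' {b' | (typ b').1 + 1 = q ∧ (typ b').2 = j ∧ lev b₀ < lev b'}))
    (hco : ∀ b, typ b = (q + 1, j) → lev b₀ ≤ lev b → e.repr (dd (e b)) b₀ = 0) :
    ∃ z ∈ Sp e K typ lev q j 0, dd z = 0 ∧ ∀ y ∈ Sp e K typ lev (q + 1) j 0, dd y ≠ z := by
  obtain ⟨x, hx, hx'⟩ : ∃ x ∈ Sp e K typ lev q j (lev b₀ + 1), dd x = dd (e b₀) := by
    cases q with
    | zero =>
      refine ⟨0, Submodule.zero_mem _, ?_⟩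
      have h0 : {b' | (typ b').1 + 1 = 0 ∧ (typ b').2 = j ∧ lev b₀ < lev b'} = ∅ := by ext; simp
      rw [h0] at hdb
      rw [Set.image_empty, Submodule.span_empty, Submodule.mem_bot] at hdb
      rw [hdb, map_zero]
    | succ q =>
      apply D.lemA (q := q) (j := j) (p := lev b₀ + 1) _ (dd (e b₀)) _ (D.sq _)
      · intro b hb; exact hc' b (by rw [hb]) (by rw [hb])
      · refine Submodule.span_mono ?_ hdb
        rintro _ ⟨b', ⟨h3, h4, h5⟩, rfl⟩
        refine ⟨b', ⟨?_, h5⟩, rfl⟩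
        ext
        · simpa using h3
        · exact h4
  have hmem : e b₀ - x ∈ Sp e K typ lev q j (lev b₀) :=
    Submodule.sub_mem _ (Submodule.subset_span ⟨b₀, ⟨hb, le_rfl⟩, rfl⟩) (Sp_mono (by omega) hx)
  refine ⟨e b₀ - x, Sp_mono (Nat.zero_le _) hmem, by rw [map_sub, hx', sub_self], ?_⟩
  intro y hy hyz
  obtain ⟨y', h1, h2⟩ := D.lemC hc (lev b₀) y hy (by rw [hyz]; exact hmem)
  have e1 : e.repr (dd y') b₀ = 0 := by
    have : Sp e K typ lev (q+1) j (lev b₀) ≤ LinearMap.ker ((Finsupp.lapply b₀ : (B →₀ K) →ₗ[K] K) ∘ₗ e.repr.toLinearMap ∘ₗ dd) := by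
      apply Submodule.span_le.2
      rintro _ ⟨b, ⟨h1, h2⟩, rfl⟩
      simpa using hco b h1 h2
    simpa using this h1
  have e2 : e.repr x b₀ = 0 := by
    have : Sp e K typ lev q j (lev b₀ + 1) ≤ LinearMap.ker ((Finsupp.lapply b₀ : (B →₀ K) →ₗ[K] K) ∘ₗ e.repr.toLinearMap) := by
      apply Submodule.span_le.2
      rintro _ ⟨b, ⟨h1, h2⟩, rfl⟩
      have : b ≠ b₀ := by rintro rfl; omega
      simp [this]
    simpa using this hx
  rw [h2, hyz, map_sub] at e1
  simp [e2] at e1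

end MorseData
end Morse
end FrameReg

set_option linter.unusedSectionVars false
set_option linter.unusedSimpArgs false
set_option linter.unusedVariables false

namespace FrameReg
open Finset

section Tor
variable {σ : Type} [Fintype σ] [LinearOrder σ]

/-- standard exponent vectors -/
def Std (bad : σ → σ → Prop) (u : σ →₀ ℕ) : Prop := ∀ w q, u w ≠ 0 → u q ≠ 0 → ¬ bad w q

open Classical in
/-- shadow of an exponent vector -/
noncomputable def bet (bad : σ → σ → Prop) (u : σ →₀ ℕ) : Finset σ := univ.filter (fun w => ∃ q, u q ≠ 0 ∧ bad w q)

open Classical in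
/-- the facet attached to a shadow -/
noncomputable def Fa (bad : σ → σ → Prop) (β : Finset σ) : Finset σ :=
  univ.filter (fun v => v ∉ β ∧ ∀ w, bad w v → w ∈ β)

open Classical in
/-- the restriction set -/
noncomputable def Ra (bad : σ → σ → Prop) (β : Finset σ) : Finset σ :=
  (Fa bad β).filter (fun q => ∃ w ∈ β, ∀ f ∈ Fa bad β, bad w f → f = q)

lemma mem_bet {bad : σ → σ → Prop} {u : σ →₀ ℕ} {w : σ} : w ∈ bet bad u ↔ ∃ q, u q ≠ 0 ∧ bad w q := by
  simp [bet]

lemma mem_Fa {bad : σ → σ → Prop} {β : Finset σ} {v : σ} : v ∈ Fa bad β ↔ v ∉ β ∧ ∀ w, bad w v → w ∈ β := by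
  simp [Fa]

lemma mem_Ra {bad : σ → σ → Prop} {β : Finset σ} {q : σ} :
    q ∈ Ra bad β ↔ q ∈ Fa bad β ∧ ∃ w ∈ β, ∀ f ∈ Fa bad β, bad w f → f = q := by
  simp [Ra]

lemma weight_single_one' (om : σ → ℕ) (v : σ) : Finsupp.weight om (Finsupp.single v 1) = om v := by
  simp [Finsupp.weight_single]

structure Tor (σ : Type) [Fintype σ] [LinearOrder σ] where
  bad : σ → σ → Prop
  om : σ → ℕ
  nf : (σ →₀ ℕ) → (σ →₀ ℕ)
  nf_std : ∀ u, Std bad (nf u)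
  nf_eq : ∀ u, Std bad u → nf u = u
  nf_deg : ∀ u, (nf u).degree = u.degree
  nf_wt : ∀ u, ¬ Std bad u → Finsupp.weight om u < Finsupp.weight om (nf u)
  P2 : ∀ u, Std bad u → ∀ w ∈ bet bad u, ∃ q ∈ Ra bad (bet bad u), bad w q

namespace Tor
variable (T : Tor σ)

/-- standard exponent vectors, as a type -/
abbrev ST : Type := {u : σ →₀ ℕ // Std T.bad u}

/-- multiplication by a variable -/
noncomputable def mul (u : T.ST) (v : σ) : T.ST := ⟨T.nf (u.1 + Finsupp.single v 1), T.nf_std _⟩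

lemma std_sub {u : σ →₀ ℕ} (hu : Std T.bad u) (v : σ) : Std T.bad (u - Finsupp.single v 1) := by
  intro w q h1 h2
  apply hu <;> intro h <;> simp_all

/-- division by a variable -/
noncomputable def div (u : T.ST) (v : σ) : T.ST := ⟨u.1 - Finsupp.single v 1, T.std_sub u.2 v⟩

variable {T}

lemma std_add {u : σ →₀ ℕ} (hu : Std T.bad u) {v : σ} (hv : v ∈ Fa T.bad (bet T.bad u)) :
    Std T.bad (u + Finsupp.single v 1) := by
  rw [mem_Fa] at hv
  intro w q h1 h2 hb
  have hw : u w ≠ 0 ∨ w = v := by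
    by_contra h; push Not at h; simp [h.1, Finsupp.single_apply, Ne.symm h.2] at h1
  have hq : u q ≠ 0 ∨ q = v := by
    by_contra h; push Not at h; simp [h.1, Finsupp.single_apply, Ne.symm h.2] at h2
  rcases hq with hq | rfl
  · rcases hw with hw | rfl
    · exact hu w q hw hq hb
    · exact hv.1 (mem_bet.2 ⟨q, hq, hb⟩)
  · have := hv.2 w hb
    rcases hw with hw | rfl
    · obtain ⟨q', h3, h4⟩ := mem_bet.1 this
      exact hu _ _ hw h3 h4
    · exact hv.1 this

lemma bet_add (u : σ →₀ ℕ) (v : σ) : bet T.bad u ⊆ bet T.bad (u + Finsupp.single v 1) := by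
  intro w hw
  rw [mem_bet] at hw ⊢
  obtain ⟨q, h, h'⟩ := hw
  exact ⟨q, by simp [h], h'⟩

lemma bet_add_eq {u : σ →₀ ℕ} {v : σ} (hv : v ∈ Fa T.bad (bet T.bad u)) :
    bet T.bad (u + Finsupp.single v 1) = bet T.bad u := by
  apply le_antisymm _ (bet_add u v)
  intro w hw
  obtain ⟨q, h, h'⟩ := mem_bet.1 hw
  by_cases hq : u q = 0
  · have : q = v := by
      by_contra h2; simp [hq, Finsupp.single_apply, Ne.symm h2] at h
    subst this
    exact (mem_Fa.1 hv).2 w h'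
  · exact mem_bet.2 ⟨q, hq, h'⟩

lemma supp_Fa {u : σ →₀ ℕ} (hu : Std T.bad u) {v : σ} (hv : u v ≠ 0) : v ∈ Fa T.bad (bet T.bad u) := by
  rw [mem_Fa]
  refine ⟨fun h => ?_, fun w hw => mem_bet.2 ⟨v, hv, hw⟩⟩
  obtain ⟨q, h1, h2⟩ := mem_bet.1 h
  exact hu _ _ hv h1 h2

lemma Ra_supp {u : σ →₀ ℕ} (hu : Std T.bad u) {q : σ} (hq : q ∈ Ra T.bad (bet T.bad u)) : u q ≠ 0 := by
  obtain ⟨h1, w, hw, h2⟩ := mem_Ra.1 hq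
  obtain ⟨q', h3, h4⟩ := mem_bet.1 hw
  rw [← h2 q' (supp_Fa hu h3) h4]; exact h3

/-- indicator of the restriction set -/
noncomputable def rho (T : Tor σ) (β : Finset σ) (v : σ) : ℕ := if v ∈ Ra T.bad β then 1 else 0

lemma rho_le {u : σ →₀ ℕ} (hu : Std T.bad u) (v : σ) : T.rho (bet T.bad u) v ≤ u v := by
  unfold rho
  split_ifs with h
  · have := Ra_supp hu h; omega
  · omega

lemma bet_sub_eq {u : σ →₀ ℕ} (hu : Std T.bad u) {v : σ} (hv : T.rho (bet T.bad u) v < u v) :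
    bet T.bad (u - Finsupp.single v 1) = bet T.bad u := by
  apply le_antisymm
  · intro w hw
    obtain ⟨q, h, h'⟩ := mem_bet.1 hw
    refine mem_bet.2 ⟨q, ?_, h'⟩
    intro h0; simp [h0] at h
  · intro w hw
    obtain ⟨q, hq, h⟩ := T.P2 u hu w hw
    refine mem_bet.2 ⟨q, ?_, h⟩
    have := Ra_supp hu hq
    by_cases hqv : q = v
    · subst hqv
      simp only [rho, if_pos hq] at hv
      simp; omega
    · simpa [Finsupp.single_apply, Ne.symm hqv] using this

open Classical in
/-- movable vertices -/
noncomputable def XX (T : Tor σ) (J : Finset σ) (u : T.ST) : Finset σ :=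
  (Fa T.bad (bet T.bad u.1)).filter (fun v => v ∈ J ∨ T.rho (bet T.bad u.1) v < u.1 v)

lemma mem_XX {J : Finset σ} {u : T.ST} {v : σ} : v ∈ T.XX J u ↔
    v ∈ Fa T.bad (bet T.bad u.1) ∧ (v ∈ J ∨ T.rho (bet T.bad u.1) v < u.1 v) := by
  simp [XX]

/-- the level -/
noncomputable def lev (T : Tor σ) (b : Σ _ : Finset σ, T.ST) : ℕ :=
  (Finsupp.weight T.om b.2.1 + ∑ v ∈ b.1, T.om v) * (Fintype.card σ + 1) + (bet T.bad b.2.1).card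

/-- the type -/
noncomputable def typ (T : Tor σ) (b : Σ _ : Finset σ, T.ST) : ℕ × ℕ :=
  (b.1.card, b.1.card + b.2.1.degree)

/-- critical -/
def crit (T : Tor σ) (b : Σ _ : Finset σ, T.ST) : Prop := T.XX b.1 b.2 = ∅

lemma mul_val_of_mem {u : T.ST} {v : σ} (hv : v ∈ Fa T.bad (bet T.bad u.1)) :
    (T.mul u v).1 = u.1 + Finsupp.single v 1 := T.nf_eq _ (std_add u.2 hv)

lemma XX_step {J : Finset σ} {u : T.ST} {v : σ} (hv : v ∈ Fa T.bad (bet T.bad u.1)) (hJ : v ∈ J) :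
    T.XX (J.erase v) (T.mul u v) = T.XX J u := by
  ext w
  rw [mem_XX, mem_XX, mul_val_of_mem hv, bet_add_eq hv]
  by_cases hw : w = v
  · subst hw
    have := rho_le u.2 w
    simp [hJ]; intro _; omega
  · simp [hw, Finsupp.single_apply, Ne.symm hw]

lemma bet_card (u : σ →₀ ℕ) : (bet T.bad u).card < Fintype.card σ + 1 :=
  Nat.lt_succ_of_le (Finset.card_le_univ _)

lemma lev_of_wt_lt {b b' : Σ _ : Finset σ, T.ST}
    (h : Finsupp.weight T.om b.2.1 + ∑ v ∈ b.1, T.om v < Finsupp.weight T.om b'.2.1 + ∑ v ∈ b'.1, T.om v) :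
    T.lev b < T.lev b' := by
  unfold lev
  have := bet_card (T := T) b.2.1
  nlinarith [Nat.mul_le_mul_right (Fintype.card σ + 1) (Nat.succ_le_of_lt h)]

lemma lev_step_of_not_mem {J : Finset σ} {u : T.ST} {v : σ} (hv : v ∉ Fa T.bad (bet T.bad u.1)) (hJ : v ∈ J) :
    T.lev ⟨J, u⟩ < T.lev ⟨J.erase v, T.mul u v⟩ := by
  have hs := Finset.add_sum_erase J T.om hJ
  by_cases h : Std T.bad (u.1 + Finsupp.single v 1)
  · have e : (T.mul u v).1 = u.1 + Finsupp.single v 1 := T.nf_eq _ h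
    unfold lev
    have h1 : bet T.bad u.1 ⊂ bet T.bad (u.1 + Finsupp.single v 1) := by
      refine ⟨bet_add _ _, fun hh => hv ?_⟩
      rw [mem_Fa]
      constructor
      · intro h2
        obtain ⟨q, h3, h4⟩ := mem_bet.1 h2
        exact h v q (by simp) (by simp [h3]) h4
      · intro w hw
        exact hh (mem_bet.2 ⟨v, by simp, hw⟩)
    have h2 := Finset.card_lt_card h1
    simp only [e, map_add, weight_single_one']
    have : Finsupp.weight T.om u.1 + T.om v + ∑ v ∈ J.erase v, T.om v = Finsupp.weight T.om u.1 + ∑ v ∈ J, T.om v := by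
      omega
    rw [this]; omega
  · apply lev_of_wt_lt
    have := T.nf_wt _ h
    simp only [map_add, weight_single_one'] at this
    simp only [mul]; omega

lemma lev_step_of_mem {J : Finset σ} {u : T.ST} {v : σ} (hv : v ∈ Fa T.bad (bet T.bad u.1)) (hJ : v ∈ J) :
    T.lev ⟨J.erase v, T.mul u v⟩ = T.lev ⟨J, u⟩ := by
  have hs := Finset.add_sum_erase J T.om hJ
  unfold lev
  simp only [mul_val_of_mem hv, bet_add_eq hv, map_add, weight_single_one']
  rw [← hs]; ring

lemma lev_step {J : Finset σ} {u : T.ST} {v : σ} (hJ : v ∈ J) :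
    T.lev ⟨J, u⟩ ≤ T.lev ⟨J.erase v, T.mul u v⟩ := by
  by_cases hv : v ∈ Fa T.bad (bet T.bad u.1)
  · exact (lev_step_of_mem hv hJ).ge
  · exact (lev_step_of_not_mem hv hJ).le

lemma sub_add {u : T.ST} {v : σ} (hv : u.1 v ≠ 0) : u.1 - Finsupp.single v 1 + Finsupp.single v 1 = u.1 := by
  ext w
  by_cases hw : w = v
  · subst hw; simp; omega
  · simp [Finsupp.single_apply, Ne.symm hw]

lemma typ_step {J : Finset σ} {u : T.ST} {v : σ} (hJ : v ∈ J) :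
    (T.typ ⟨J.erase v, T.mul u v⟩).1 + 1 = J.card ∧ (T.typ ⟨J.erase v, T.mul u v⟩).2 = J.card + u.1.degree := by
  have : 0 < J.card := Finset.card_pos.2 ⟨v, hJ⟩
  simp only [typ, Finset.card_erase_of_mem hJ, mul, T.nf_deg, map_add, Finsupp.degree_single]
  omega

lemma typ_insert {J : Finset σ} {u : T.ST} {v : σ} (hJ : v ∉ J) (hv : u.1 v ≠ 0) :
    T.typ ⟨insert v J, T.div u v⟩ = (J.card + 1, J.card + u.1.degree) := by
  have := congrArg Finsupp.degree (sub_add hv)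
  rw [map_add, Finsupp.degree_single] at this
  simp only [typ, Finset.card_insert_of_notMem hJ, div]
  ext <;> simp; omega

lemma lev_insert {J : Finset σ} {u : T.ST} {v : σ} (hJ : v ∉ J) (hv : T.rho (bet T.bad u.1) v < u.1 v) :
    T.lev ⟨insert v J, T.div u v⟩ = T.lev ⟨J, u⟩ := by
  have := congrArg (Finsupp.weight T.om) (sub_add (v := v) (u := u) (by omega))
  rw [map_add, weight_single_one'] at this
  unfold lev
  simp only [div, bet_sub_eq u.2 hv, Finset.sum_insert hJ]
  rw [← this]; ring

lemma wt_le (u : σ →₀ ℕ) : Finsupp.weight T.om u ≤ u.degree * ∑ v, T.om v := by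
  rw [Finsupp.weight_apply, Finsupp.degree_apply, Finsupp.sum, Finset.sum_mul]
  refine Finset.sum_le_sum fun v _ => ?_
  rw [smul_eq_mul]
  exact Nat.mul_le_mul_left _ (Finset.single_le_sum (f := T.om) (fun _ _ => Nat.zero_le _) (mem_univ v))

variable {K : Type} [Field K] {M : Type} [AddCommGroup M] [Module (MvPolynomial σ K) M] [Module K M]
  [IsScalarTower K (MvPolynomial σ K) M]

/-- the basis of chains -/
noncomputable def ee (b : Module.Basis T.ST K M) : Module.Basis (Σ _ : Finset σ, T.ST) K (Finset σ → M) :=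
  Pi.basis (fun _ => b)

lemma ee_apply (b : Module.Basis T.ST K M) (J : Finset σ) (u : T.ST) : ee b ⟨J, u⟩ = Pi.single J (b u) := by
  simp [ee]

/-- the differential over `K` -/
noncomputable def dK : (Finset σ → M) →ₗ[K] (Finset σ → M) := (kos (K := K)).restrictScalars K

lemma dK_apply (f : Finset σ → M) : dK (K := K) f = kos (K := K) f := rfl

variable {b : Module.Basis T.ST K M}

lemma dK_ee (hb : ∀ v u, (MvPolynomial.X v : MvPolynomial σ K) • b u = b (T.mul u v)) (J : Finset σ) (u : T.ST) :
    dK (K := K) (ee b ⟨J, u⟩) = ∑ v ∈ J, sg v J • ee b ⟨J.erase v, T.mul u v⟩ := by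
  rw [dK_apply, ee_apply, kos_single]
  simp only [hb, ee_apply]

open Classical in
/-- the contraction on basis elements -/
noncomputable def hB (b : Module.Basis T.ST K M) (x : Σ _ : Finset σ, T.ST) : Finset σ → M :=
  if h : (T.XX x.1 x.2).Nonempty then
    if (T.XX x.1 x.2).min' h ∈ x.1 then 0 else
      sg ((T.XX x.1 x.2).min' h) x.1 • ee b ⟨insert ((T.XX x.1 x.2).min' h) x.1, T.div x.2 ((T.XX x.1 x.2).min' h)⟩
  else 0

/-- the contraction -/
noncomputable def hh (b : Module.Basis T.ST K M) : (Finset σ → M) →ₗ[K] (Finset σ → M) :=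
  (ee b).constr K (hB b)

lemma hh_ee (x : Σ _ : Finset σ, T.ST) : hh b (ee b x) = hB b x := by
  simp [hh]

lemma hh_of_mem {J : Finset σ} {u : T.ST} {v : σ} (hv : v ∈ T.XX J u) (hm : ∀ w ∈ T.XX J u, v ≤ w) (hJ : v ∈ J) :
    hh b (ee b ⟨J, u⟩) = 0 := by
  rw [hh_ee, hB, dif_pos ⟨v, hv⟩, if_pos]
  have : (T.XX J u).min' ⟨v, hv⟩ = v := le_antisymm (Finset.min'_le _ _ hv) (Finset.le_min' _ _ _ hm)
  simpa [this]

lemma hh_of_not_mem {J : Finset σ} {u : T.ST} {v : σ} (hv : v ∈ T.XX J u) (hm : ∀ w ∈ T.XX J u, v ≤ w) (hJ : v ∉ J) :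
    hh b (ee b ⟨J, u⟩) = sg v J • ee b ⟨insert v J, T.div u v⟩ := by
  have : (T.XX J u).min' ⟨v, hv⟩ = v := le_antisymm (Finset.min'_le _ _ hv) (Finset.le_min' _ _ _ hm)
  rw [hh_ee, hB, dif_pos ⟨v, hv⟩]
  simp only [this]
  rw [if_neg hJ]

lemma zsmul_mem_K {C : Type*} [AddCommGroup C] [Module K C] (W : Submodule K C) (n : ℤ) {x : C} (hx : x ∈ W) :
    n • x ∈ W := W.toAddSubgroup.zsmul_mem hx n

lemma mul_div {u : T.ST} {v : σ} (hv : u.1 v ≠ 0) : T.mul (T.div u v) v = u := by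
  apply Subtype.ext
  simp only [mul, div, sub_add hv]
  exact T.nf_eq _ u.2

lemma H2 (x : Σ _ : Finset σ, T.ST) :
    hh b (ee b x) ∈ Sp (ee b) K T.typ T.lev ((T.typ x).1 + 1) (T.typ x).2 (T.lev x) := by
  obtain ⟨J, u⟩ := x
  by_cases hX : (T.XX J u).Nonempty
  · have hv := Finset.min'_mem _ hX
    have hm : ∀ w ∈ T.XX J u, (T.XX J u).min' hX ≤ w := fun w hw => Finset.min'_le _ _ hw
    generalize (T.XX J u).min' hX = v at *
    by_cases hJ : v ∈ J
    · rw [hh_of_mem hv hm hJ]; exact Submodule.zero_mem _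
    · rw [hh_of_not_mem hv hm hJ]
      have h1 : T.rho (bet T.bad u.1) v < u.1 v := by
        have := (mem_XX.1 hv).2; tauto
      apply zsmul_mem_K
      refine Submodule.subset_span ⟨_, ⟨?_, ?_⟩, rfl⟩
      · rw [typ_insert hJ (by omega)]; rfl
      · rw [lev_insert hJ h1]
  · rw [hh_ee, hB, dif_neg hX]; exact Submodule.zero_mem _

theorem morse (hb : ∀ v u, (MvPolynomial.X v : MvPolynomial σ K) • b u = b (T.mul u v)) :
    MorseData (ee b) (dK (K := K)) (hh b) T.typ T.lev T.crit where
  sq x := by rw [dK_apply, dK_apply, kos_kos]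
  H1 x := by
    obtain ⟨J, u⟩ := x
    rw [dK_ee hb]
    refine Submodule.sum_mem _ fun v hv => zsmul_mem_K _ _ (Submodule.subset_span ⟨_, ⟨?_, ?_, ?_⟩, rfl⟩)
    · exact (typ_step hv).1
    · exact (typ_step hv).2
    · exact lev_step hv
  H2 := H2
  H4 q j := by
    refine ⟨(j * ∑ v, T.om v + ∑ v, T.om v) * (Fintype.card σ + 1) + (Fintype.card σ + 1), ?_⟩
    rintro ⟨J, u⟩ h
    unfold lev
    have h1 := bet_card (T := T) u.1
    have h2 : ∑ v ∈ J, T.om v ≤ ∑ v, T.om v := Finset.sum_le_sum_of_subset (subset_univ _)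
    have h3 := wt_le (T := T) u.1
    have h4 : u.1.degree ≤ j := by
      have := congrArg Prod.snd h
      simp only [typ] at this; omega
    have h5 : u.1.degree * ∑ v, T.om v ≤ j * ∑ v, T.om v := Nat.mul_le_mul_right _ h4
    have h6 : Finsupp.weight T.om u.1 + ∑ v ∈ J, T.om v ≤ j * ∑ v, T.om v + ∑ v, T.om v := by omega
    have h7 := Nat.mul_le_mul_right (Fintype.card σ + 1) h6
    simp only; omega
  H3 x hc := by
    obtain ⟨J, u⟩ := x
    have hX : (T.XX J u).Nonempty := Finset.nonempty_iff_ne_empty.2 hc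
    have hv := Finset.min'_mem _ hX
    have hm : ∀ w ∈ T.XX J u, (T.XX J u).min' hX ≤ w := fun w hw => Finset.min'_le _ _ hw
    generalize (T.XX J u).min' hX = v at *
    -- high terms of h ∂
    have high : ∀ w ∈ J, w ∉ Fa T.bad (bet T.bad u.1) →
        hh b (ee b ⟨J.erase w, T.mul u w⟩) ∈ Sp (ee b) K T.typ T.lev J.card (J.card + u.1.degree) (T.lev ⟨J, u⟩ + 1) := by
      intro w hw hF
      have h1 := H2 (b := b) ⟨J.erase w, T.mul u w⟩
      rw [(typ_step hw).1, (typ_step hw).2] at h1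
      exact MorseData.Sp_mono (lev_step_of_not_mem hF hw) h1
    change _ ∈ Sp (ee b) K T.typ T.lev J.card (J.card + u.1.degree) (T.lev ⟨J, u⟩ + 1)
    rw [dK_ee hb, map_sum]
    simp only [map_zsmul]
    by_cases hJ : v ∈ J
    · rw [hh_of_mem hv hm hJ, map_zero, zero_add, ← Finset.add_sum_erase _ _ hJ]
      have hvF := (mem_XX.1 hv).1
      have e1 : hh b (ee b ⟨J.erase v, T.mul u v⟩) = sg v J • ee b ⟨J, u⟩ := by
        rw [hh_of_not_mem (v := v) (by rwa [XX_step hvF hJ]) (by rwa [XX_step hvF hJ]) (notMem_erase _ _),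
          sg_erase_self, insert_erase hJ]
        congr 3
        apply Subtype.ext
        simp only [div, mul_val_of_mem hvF]
        simp
      rw [e1, smul_smul, sg_mul_self, one_smul, add_sub_cancel_left]
      refine Submodule.sum_mem _ fun w hw => zsmul_mem_K _ _ ?_
      rw [mem_erase] at hw
      by_cases hF : w ∈ Fa T.bad (bet T.bad u.1)
      · rw [hh_of_mem (v := v) (by rwa [XX_step hF hw.2]) (by rwa [XX_step hF hw.2])
          (mem_erase.2 ⟨Ne.symm hw.1, hJ⟩)]
        exact Submodule.zero_mem _
      · exact high w hw.2 hF
    · have h1 : T.rho (bet T.bad u.1) v < u.1 v := by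
        have := (mem_XX.1 hv).2; tauto
      have h1' : u.1 v ≠ 0 := by omega
      have hbe : bet T.bad (T.div u v).1 = bet T.bad u.1 := bet_sub_eq u.2 h1
      rw [hh_of_not_mem hv hm hJ, map_zsmul, dK_ee hb, Finset.sum_insert hJ, sg_insert_self, erase_insert hJ,
        mul_div h1', smul_add, smul_smul, sg_mul_self, one_smul, add_assoc, add_sub_cancel_left, Finset.smul_sum,
        ← Finset.sum_add_distrib]
      refine Submodule.sum_mem _ fun w hw => ?_
      have hwv : w ≠ v := fun h => hJ (h ▸ hw)
      by_cases hF : w ∈ Fa T.bad (bet T.bad u.1)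
      · rw [hh_of_not_mem (v := v) (by rwa [XX_step hF hw]) (by rwa [XX_step hF hw])
          (fun h => hJ (mem_of_mem_erase h)), smul_smul, smul_smul]
        have e1 : (⟨(insert v J).erase w, T.mul (T.div u v) w⟩ : Σ _ : Finset σ, T.ST) =
            ⟨insert v (J.erase w), T.div (T.mul u w) v⟩ := by
          congr 1
          · rw [erase_insert_of_ne (Ne.symm hwv)]
          · apply Subtype.ext
            rw [mul_val_of_mem (by rwa [hbe])]
            simp only [div, mul_val_of_mem hF]
            ext x
            have : u.1 v ≠ 0 := h1'
            by_cases hx : x = v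
            · subst hx
              simp [Finsupp.single_apply, hwv]
            · simp [Finsupp.single_apply, Ne.symm hx]
        rw [e1, ← add_smul]
        have e2 : sg v J * sg w (insert v J) + sg w J * sg v (J.erase w) = 0 := by
          obtain ⟨I, hI, rfl⟩ : ∃ I, w ∉ I ∧ J = insert w I := ⟨J.erase w, notMem_erase _ _, (insert_erase hw).symm⟩
          have hvI : v ∉ I := fun h => hJ (mem_insert_of_mem h)
          have h3 := sg_swap hvI hI (Ne.symm hwv)
          have h4 := sg_mul_self w I
          rw [erase_insert hI, sg_insert_self, Finset.insert_comm, sg_insert_self]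
          have h5 := sg_swap hI hvI hwv
          rw [sg_insert _ _ _ hI, sg_insert _ _ _ hvI] at *
          rcases lt_or_gt_of_ne hwv with h | h
          · simp only [if_pos h, if_neg (not_lt.2 h.le)] at *; ring
          · simp only [if_pos h, if_neg (not_lt.2 h.le)] at *; ring
        rw [e2, zero_smul]
        exact Submodule.zero_mem _
      · refine Submodule.add_mem _ (zsmul_mem_K _ _ (zsmul_mem_K _ _ ?_)) (zsmul_mem_K _ _ (high w hw hF))
        have hw' : w ∈ insert v J := mem_insert_of_mem hw
        refine Submodule.subset_span ⟨_, ⟨?_, ?_⟩, rfl⟩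
        · have h2 := typ_step (T := T) (J := insert v J) (u := T.div u v) (v := w) hw'
          have h3 := typ_insert (T := T) (J := J) (u := u) (v := v) hJ h1'
          have h4 := congrArg Prod.snd h3
          simp only [typ] at h4
          rw [card_insert_of_notMem hJ] at h2 h4
          apply Prod.ext
          · simpa using h2.1
          · rw [h2.2, h4]
        · have h2 := lev_step_of_not_mem (T := T) (J := insert v J) (u := T.div u v) (v := w) (by rwa [hbe]) hw'
          rw [lev_insert hJ h1] at h2
          exact h2

end Tor
end Tor
end FrameReg

set_option linter.unusedSectionVars false
set_option linter.unusedSimpArgs false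
set_option linter.unusedVariables false

namespace FrameReg
open Finset MvPolynomial

section
variable {σ : Type} [Fintype σ] [LinearOrder σ] {K : Type} [Field K]

/-- homogeneous polynomials of integer degree `k` -/
def hz (σ K : Type) [Field K] (k : ℤ) : Submodule K (MvPolynomial σ K) where
  carrier := {p | ∀ u, coeff u p ≠ 0 → (u.degree : ℤ) = k}
  add_mem' := by
    intro p q hp hq u hu
    rw [coeff_add] at hu
    by_cases h : coeff u p = 0
    · exact hq u (by intro h'; simp [h, h'] at hu)
    · exact hp u h
  zero_mem' := by intro u hu; simp at hu
  smul_mem' := by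
    intro c p hp u hu
    rw [coeff_smul] at hu
    exact hp u (by intro h'; simp [h'] at hu)

lemma mem_hz {k : ℤ} {p : MvPolynomial σ K} : p ∈ hz σ K k ↔ ∀ u, coeff u p ≠ 0 → (u.degree : ℤ) = k := Iff.rfl

lemma monomial_mem_hz {k : ℤ} (u : σ →₀ ℕ) (c : K) (h : (u.degree : ℤ) = k) : monomial u c ∈ hz σ K k := by
  classical
  intro w hw
  rw [coeff_monomial] at hw
  split_ifs at hw with h'
  · rw [← h']; exact h
  · exact absurd rfl hw

lemma hz_mul {k l : ℤ} {p q : MvPolynomial σ K} (hp : p ∈ hz σ K k) (hq : q ∈ hz σ K l) : p * q ∈ hz σ K (k + l) := by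
  classical
  intro u hu
  rw [coeff_mul] at hu
  obtain ⟨x, hx, hx'⟩ := Finset.exists_ne_zero_of_sum_ne_zero hu
  rw [HasAntidiagonal.mem_antidiagonal] at hx
  have h1 := hp x.1 (left_ne_zero_of_mul hx')
  have h2 := hq x.2 (right_ne_zero_of_mul hx')
  rw [← hx, map_add]; push_cast; omega

lemma X_mem_hz (v : σ) : (X v : MvPolynomial σ K) ∈ hz σ K 1 := monomial_mem_hz _ _ (by simp)

/-- chains of type `(q,j)` in a free module with twists -/
def tyV {t : ℕ} (σ K : Type) [Field K] (tw : Fin t → ℤ) (q : ℕ) (j : ℤ) : Submodule K (Finset σ → Fin t → MvPolynomial σ K) where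
  carrier := {f | ∀ J, (J.card ≠ q → f J = 0) ∧ ∀ i, f J i ∈ hz σ K (j - q - tw i)}
  add_mem' := by
    intro f g hf hg J
    refine ⟨fun h => ?_, fun i => Submodule.add_mem _ ((hf J).2 i) ((hg J).2 i)⟩
    rw [Pi.add_apply, (hf J).1 h, (hg J).1 h, add_zero]
  zero_mem' := by
    intro J
    exact ⟨fun _ => rfl, fun i => Submodule.zero_mem _⟩
  smul_mem' := by
    intro c f hf J
    refine ⟨fun h => ?_, fun i => Submodule.smul_mem _ _ ((hf J).2 i)⟩
    rw [Pi.smul_apply, (hf J).1 h, smul_zero]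

lemma mem_tyV {t : ℕ} {tw : Fin t → ℤ} {q : ℕ} {j : ℤ} {f : Finset σ → Fin t → MvPolynomial σ K} :
    f ∈ tyV σ K tw q j ↔ ∀ J, (J.card ≠ q → f J = 0) ∧ ∀ i, f J i ∈ hz σ K (j - q - tw i) := Iff.rfl

/-- chains of type `(q,j)` in the ring -/
def tyS (σ K : Type) [Field K] (q : ℕ) (j : ℤ) : Submodule K (Finset σ → MvPolynomial σ K) where
  carrier := {f | ∀ J, (J.card ≠ q → f J = 0) ∧ f J ∈ hz σ K (j - q)}
  add_mem' := by
    intro f g hf hg J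
    refine ⟨fun h => ?_, Submodule.add_mem _ ((hf J).2) ((hg J).2)⟩
    rw [Pi.add_apply, (hf J).1 h, (hg J).1 h, add_zero]
  zero_mem' := by
    intro J
    exact ⟨fun _ => rfl, Submodule.zero_mem _⟩
  smul_mem' := by
    intro c f hf J
    refine ⟨fun h => ?_, Submodule.smul_mem _ _ ((hf J).2)⟩
    rw [Pi.smul_apply, (hf J).1 h, smul_zero]

lemma mem_tyS {q : ℕ} {j : ℤ} {f : Finset σ → MvPolynomial σ K} :
    f ∈ tyS σ K q j ↔ ∀ J, (J.card ≠ q → f J = 0) ∧ f J ∈ hz σ K (j - q) := Iff.rfl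

lemma tyV_comp {t : ℕ} {tw : Fin t → ℤ} {q : ℕ} {j : ℤ} {f : Finset σ → Fin t → MvPolynomial σ K}
    (hf : f ∈ tyV σ K tw q j) (i : Fin t) : (fun J => f J i) ∈ tyS σ K q (j - tw i) := by
  intro J
  refine ⟨fun h => by simp only [(hf J).1 h]; rfl, ?_⟩
  have := (hf J).2 i
  rwa [show j - tw i - (q : ℤ) = j - q - tw i by ring]

lemma tyV_of_comp {t : ℕ} {tw : Fin t → ℤ} {q : ℕ} {j : ℤ} {f : Finset σ → Fin t → MvPolynomial σ K}
    (hf : ∀ i, (fun J => f J i) ∈ tyS σ K q (j - tw i)) : f ∈ tyV σ K tw q j := by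
  intro J
  refine ⟨fun h => funext fun i => (hf i J).1 h, fun i => ?_⟩
  have := (hf i J).2
  rwa [show j - tw i - (q : ℤ) = j - q - tw i by ring] at this

lemma kos_comp {t : ℕ} (f : Finset σ → Fin t → MvPolynomial σ K) (i : Fin t) (J : Finset σ) :
    kos (K := K) f J i = kos (K := K) (fun J => f J i) J := by
  simp only [kos_apply, Finset.sum_apply, Pi.smul_apply]

lemma kos_tyS {q : ℕ} {j : ℤ} {f : Finset σ → MvPolynomial σ K} (hf : f ∈ tyS σ K (q + 1) j) :
    kos (K := K) f ∈ tyS σ K q j := by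
  intro J
  rw [kos_apply]
  constructor
  · intro h
    refine Finset.sum_eq_zero fun v hv => ?_
    rw [(hf _).1, smul_zero, smul_zero]
    rw [card_insert_of_notMem (by simpa using hv)]; omega
  · refine Submodule.sum_mem _ fun v hv => Tor.zsmul_mem_K _ _ ?_
    have := hz_mul (X_mem_hz v) (hf (insert v J)).2
    rw [smul_eq_mul]
    rw [show j - (q:ℤ) = 1 + (j - ((q + 1 : ℕ) : ℤ)) by push_cast; ring]
    exact this

lemma kos_tyV {t : ℕ} {tw : Fin t → ℤ} {q : ℕ} {j : ℤ} {f : Finset σ → Fin t → MvPolynomial σ K}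
    (hf : f ∈ tyV σ K tw (q + 1) j) : kos (K := K) f ∈ tyV σ K tw q j := by
  apply tyV_of_comp
  intro i
  simp only [kos_comp]
  exact kos_tyS (tyV_comp hf i)

lemma kos_zero_of_ty0 {q : ℕ} {j : ℤ} {f : Finset σ → MvPolynomial σ K} (hf : f ∈ tyS σ K 0 j) : kos (K := K) f = 0 := by
  funext J
  rw [kos_apply]
  refine Finset.sum_eq_zero fun v hv => ?_
  rw [(hf _).1, smul_zero, smul_zero]
  rw [card_insert_of_notMem (by simpa using hv)]; omega

lemma tyS_neg {q : ℕ} {j : ℤ} {f : Finset σ → MvPolynomial σ K} (hf : f ∈ tyS σ K q j) (h : j < q) : f = 0 := by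
  funext J
  ext u
  by_contra h'
  have := (hf J).2 u (by simpa using h')
  omega

namespace Tor
variable {T : Tor σ} {M : Type} [AddCommGroup M] [Module (MvPolynomial σ K) M] [Module K M]
  [IsScalarTower K (MvPolynomial σ K) M] {b : Module.Basis T.ST K M} {φ : MvPolynomial σ K →ₗ[MvPolynomial σ K] M}

lemma hb_of (hφ : ∀ u, φ (monomial u 1) = b ⟨T.nf u, T.nf_std u⟩) (v : σ) (u : T.ST) :
    (MvPolynomial.X v : MvPolynomial σ K) • b u = b (T.mul u v) := by
  have h1 : b u = φ (monomial u.1 1) := by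
    rw [hφ]; congr 1; exact Subtype.ext (T.nf_eq _ u.2).symm
  rw [h1, ← map_smul, smul_eq_mul, X, monomial_mul, mul_one, hφ, add_comm]; rfl

lemma phi_mono (hφ : ∀ u, φ (monomial u 1) = b ⟨T.nf u, T.nf_std u⟩) (u : σ →₀ ℕ) (c : K) :
    φ (monomial u c) = c • b ⟨T.nf u, T.nf_std u⟩ := by
  rw [← hφ, ← mul_one c, ← smul_eq_mul, ← smul_monomial, smul_eq_mul, mul_one]
  rw [← algebraMap_smul (MvPolynomial σ K) c (monomial u (1 : K)), map_smul, algebraMap_smul]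

lemma phi_tyS (hφ : ∀ u, φ (monomial u 1) = b ⟨T.nf u, T.nf_std u⟩) {q j : ℕ} {f : Finset σ → MvPolynomial σ K}
    (hf : f ∈ tyS σ K q j) : (fun J => φ (f J)) ∈ Sp (ee b) K T.typ T.lev q j 0 := by
  have h1 : (fun J => φ (f J)) = ∑ J, Pi.single (M := fun _ => M) J (φ (f J)) := by
    funext I; simp [Finset.sum_apply, Pi.single_apply]
  rw [h1]
  refine Submodule.sum_mem _ fun J _ => ?_
  by_cases hJ : J.card = q
  swap
  · rw [(hf J).1 hJ]; simp
  have h2 : (Pi.single J (φ (f J)) : Finset σ → M) = ∑ u ∈ (f J).support, (coeff u (f J)) • ee b ⟨J, ⟨T.nf u, T.nf_std u⟩⟩ := by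
    conv_lhs => rw [(f J).as_sum]
    rw [map_sum]
    simp only [phi_mono hφ, ee_apply]
    funext I
    by_cases h : I = J
    · subst h; simp
    · simp [Pi.single_apply, h]
  rw [h2]
  refine Submodule.sum_mem _ fun u hu => Submodule.smul_mem _ _ (Submodule.subset_span ⟨_, ⟨?_, Nat.zero_le _⟩, rfl⟩)
  have := (hf J).2 u (by simpa using hu)
  simp only [typ, T.nf_deg]
  ext
  · exact hJ
  · simp only; omega

lemma lift_tyS (hφ : ∀ u, φ (monomial u 1) = b ⟨T.nf u, T.nf_std u⟩) {q j : ℕ} {g : Finset σ → M}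
    (hg : g ∈ Sp (ee b) K T.typ T.lev q j 0) : ∃ f ∈ tyS σ K q j, ∀ J, φ (f J) = g J := by
  induction hg using Submodule.span_induction with
  | mem x hx =>
    obtain ⟨⟨J, u⟩, ⟨h1, -⟩, rfl⟩ := hx
    refine ⟨Pi.single J (monomial u.1 1), ?_, ?_⟩
    · intro I
      simp only [typ, Prod.mk.injEq] at h1
      by_cases h : I = J
      · subst h
        refine ⟨fun h => absurd h1.1 h, ?_⟩
        rw [Pi.single_eq_same]
        apply monomial_mem_hz
        omega
      · rw [Pi.single_eq_of_ne h]
        exact ⟨fun _ => rfl, Submodule.zero_mem _⟩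
    · intro I
      rw [ee_apply]
      by_cases h : I = J
      · subst h
        rw [Pi.single_eq_same, Pi.single_eq_same, hφ]
        congr 1; exact Subtype.ext (T.nf_eq _ u.2)
      · rw [Pi.single_eq_of_ne h, Pi.single_eq_of_ne h, map_zero]
  | zero => exact ⟨0, Submodule.zero_mem _, fun J => by simp⟩
  | add x y _ _ hx hy =>
    obtain ⟨f, h1, h2⟩ := hx
    obtain ⟨f', h1', h2'⟩ := hy
    exact ⟨f + f', Submodule.add_mem _ h1 h1', fun J => by simp [h2, h2']⟩
  | smul c x _ hx =>
    obtain ⟨f, h1, h2⟩ := hx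
    refine ⟨c • f, Submodule.smul_mem _ _ h1, fun J => ?_⟩
    rw [Pi.smul_apply, Pi.smul_apply, ← h2, ← algebraMap_smul (MvPolynomial σ K) c (f J), map_smul, algebraMap_smul]

theorem exact0 (hφ : ∀ u, φ (monomial u 1) = b ⟨T.nf u, T.nf_std u⟩) {q j : ℕ}
    (hc : ∀ x, T.typ x = (q, j) → ¬ T.crit x) {f : Finset σ → MvPolynomial σ K}
    (hf : f ∈ tyS σ K q j) (hk : ∀ J, φ (kos (K := K) f J) = 0) :
    ∃ g ∈ tyS σ K (q + 1) j, ∀ J, φ (f J - kos (K := K) g J) = 0 := by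
  have D := morse (hb_of hφ)
  obtain ⟨y, hy, hy'⟩ := D.lemA hc 0 _ (phi_tyS hφ hf) (by
    rw [dK_apply]; funext J; rw [kos_map, hk]; rfl)
  obtain ⟨g, hg, hg'⟩ := lift_tyS hφ hy
  refine ⟨g, hg, fun J => ?_⟩
  rw [map_sub, ← kos_map]
  have : (fun J => φ (g J)) = y := funext hg'
  rw [this, ← dK_apply, hy', sub_self]

lemma crit_prop {x : Σ _ : Finset σ, T.ST} (hx : T.crit x) :
    Disjoint x.1 (Fa T.bad (bet T.bad x.2.1)) ∧ x.2.1.degree = (Ra T.bad (bet T.bad x.2.1)).card := by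
  have h : ∀ v, v ∉ T.XX x.1 x.2 := by
    intro v; rw [show T.XX x.1 x.2 = ∅ from hx]; simp
  constructor
  · rw [Finset.disjoint_left]
    intro v h1 h2
    exact h v (mem_XX.2 ⟨h2, Or.inl h1⟩)
  · have h1 : ∀ v, x.2.1 v = if v ∈ Ra T.bad (bet T.bad x.2.1) then 1 else 0 := by
      intro v
      by_cases hv : v ∈ Fa T.bad (bet T.bad x.2.1)
      · have h2 := h v
        rw [mem_XX] at h2
        push Not at h2
        have h3 := (h2 hv).2
        exact le_antisymm h3 (rho_le x.2.2 v)
      · rw [if_neg (fun h' => hv (mem_Ra.1 h').1)]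
        by_contra h'
        exact hv (supp_Fa x.2.2 h')
    rw [Finsupp.degree_eq_sum]
    simp [h1]

theorem crit_typ {c : ℕ} (hp : ∀ u, Std T.bad u → (Fa T.bad (bet T.bad u)).card + c = Fintype.card σ)
    {x : Σ _ : Finset σ, T.ST} (hx : T.crit x) :
    (T.typ x).1 ≤ c ∧ (T.typ x).2 = (T.typ x).1 + (Ra T.bad (bet T.bad x.2.1)).card := by
  obtain ⟨h1, h2⟩ := crit_prop hx
  have h3 := hp _ x.2.2
  have h4 := Finset.card_union_of_disjoint h1
  have h5 := Finset.card_le_univ (x.1 ∪ Fa T.bad (bet T.bad x.2.1))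
  simp only [typ]
  exact ⟨by omega, by omega⟩

theorem nonexact (hφ : ∀ u, φ (monomial u 1) = b ⟨T.nf u, T.nf_std u⟩) {c r : ℕ}
    (hp : ∀ u, Std T.bad u → (Fa T.bad (bet T.bad u)).card + c = Fintype.card σ)
    (hr : ∀ u, Std T.bad u → (Ra T.bad (bet T.bad u)).card ≤ r)
    (u₀ : σ →₀ ℕ) (hu₀ : Std T.bad u₀) (hr₀ : (Ra T.bad (bet T.bad u₀)).card = r) :
    ∃ f ∈ tyS σ K c (r + c : ℕ), (∀ J, φ (kos (K := K) f J) = 0) ∧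
      ∀ g ∈ tyS σ K (c + 1) (r + c : ℕ), ¬ ∀ J, φ (f J - kos (K := K) g J) = 0 := by
  classical
  have D := morse (hb_of hφ)
  have hsur : ∀ z ∈ Sp (ee b) K T.typ T.lev c (r + c) 0, True := fun _ _ => trivial
  set β := bet T.bad u₀ with hβ
  let u₁ : σ →₀ ℕ := Finsupp.equivFunOnFinite.symm (T.rho β)
  have hu₁v : ∀ v, u₁ v = T.rho β v := fun v => rfl
  have hle : ∀ v, u₁ v ≤ u₀ v := fun v => by rw [hu₁v]; exact rho_le hu₀ v
  have hstd : Std T.bad u₁ := fun w q h1 h2 => hu₀ w q (by have := hle w; omega) (by have := hle q; omega)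
  have hbet : bet T.bad u₁ = β := by
    ext w
    constructor
    · intro h
      obtain ⟨q, h1, h2⟩ := mem_bet.1 h
      exact mem_bet.2 ⟨q, by have := hle q; omega, h2⟩
    · intro h
      obtain ⟨q, h1, h2⟩ := T.P2 u₀ hu₀ w h
      refine mem_bet.2 ⟨q, ?_, h2⟩
      rw [hu₁v, rho, if_pos h1]; exact one_ne_zero
  let b₀ : Σ _ : Finset σ, T.ST := ⟨(Fa T.bad β)ᶜ, ⟨u₁, hstd⟩⟩
  have hcrit : T.crit b₀ := by
    unfold crit
    rw [Finset.eq_empty_iff_forall_notMem]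
    intro v hv
    obtain ⟨h1, h2⟩ := mem_XX.1 hv
    simp only [b₀, hbet] at h1 h2
    rcases h2 with h2 | h2
    · simp [h1] at h2
    · rw [hu₁v] at h2; omega
  have htyp : T.typ b₀ = (c, r + c) := by
    have h1 := (crit_prop hcrit).2
    simp only [b₀, hbet, hr₀] at h1
    have h2 := hp u₀ hu₀
    have h3 : ((Fa T.bad β)ᶜ).card = c := by rw [card_compl, ← h2, ← hβ]; omega
    simp only [typ, b₀, h3, h1]
    ext <;> simp; omega
  have key := D.lemB (q := c) (j := r + c) b₀ htyp ?_ ?_ ?_ ?_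
  · obtain ⟨z, hz, hz0, hz1⟩ := key
    obtain ⟨f, hf, hf'⟩ := lift_tyS hφ hz
    have hfz : (fun J => φ (f J)) = z := funext hf'
    refine ⟨f, hf, fun J => ?_, fun g hg hh => ?_⟩
    · rw [← kos_map, hfz, ← dK_apply, hz0]; rfl
    · apply hz1 _ (phi_tyS hφ hg)
      funext J
      have := hh J
      rw [map_sub, sub_eq_zero] at this
      rw [dK_apply, kos_map, ← this, hf']
  · intro x hx hxc
    have := (crit_typ hp hxc).1
    rw [hx] at this; simp at this
  · intro x hx1 hx2 hxc
    have h1 := (crit_typ hp hxc).2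
    have h2 := hr _ x.2.2
    omega
  · rw [dK_ee (hb_of hφ)]
    refine Submodule.sum_mem _ fun v hv => zsmul_mem_K _ _ (Submodule.subset_span ⟨_, ⟨?_, ?_, ?_⟩, rfl⟩)
    · have := (typ_step (T := T) (u := ⟨u₁, hstd⟩) hv).1
      rw [this]; exact congrArg Prod.fst htyp
    · have := (typ_step (T := T) (u := ⟨u₁, hstd⟩) hv).2
      rw [this]; exact congrArg Prod.snd htyp
    · apply lev_step_of_not_mem _ hv
      simpa [hbet] using hv
  · rintro ⟨J, u⟩ hx hl
    rw [dK_ee (hb_of hφ), map_sum, Finsupp.finsetSum_apply]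
    refine Finset.sum_eq_zero fun v hv => ?_
    rw [map_zsmul, Finsupp.smul_apply, Module.Basis.repr_self, Finsupp.single_apply, if_neg, smul_zero]
    intro heq
    have hl' := lev_step (T := T) (u := u) hv
    by_cases hF : v ∈ Fa T.bad (bet T.bad u.1)
    · have h1 := mul_val_of_mem hF
      have h2 : (T.mul u v) = ⟨u₁, hstd⟩ := by
        have := congrArg Sigma.snd heq; exact this
      rw [h2] at h1
      simp only at h1
      have h3 := bet_add_eq hF
      rw [← h1, hbet] at h3
      have h4 := rho_le u.2 v
      rw [← h3, ← hu₁v, h1] at h4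
      simp at h4
    · have h1 := lev_step_of_not_mem hF hv
      rw [heq] at h1; omega

end Tor
end
end FrameReg

set_option linter.unusedSectionVars false
set_option linter.unusedSimpArgs false
set_option linter.unusedVariables false

namespace FrameReg
open Finset MvPolynomial

section
variable {σ : Type} [Fintype σ] [LinearOrder σ] {K : Type} [Field K]

/-- the trivial toric datum (no relations) -/
noncomputable def T0 (σ : Type) [Fintype σ] [LinearOrder σ] : Tor σ where
  bad _ _ := False
  om _ := 0
  nf u := u
  nf_std u := fun _ _ _ _ h => h
  nf_eq u _ := rfl
  nf_deg u := rfl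
  nf_wt u h := absurd (fun _ _ _ _ h => h) h
  P2 u hu w hw := by
    obtain ⟨q, h, h'⟩ := mem_bet.1 hw
    exact h'.elim

theorem free_exact {q : ℕ} {j : ℤ} {f : Finset σ → MvPolynomial σ K} (hf : f ∈ tyS σ K q j)
    (hk : kos (K := K) f = 0) (h0 : q = 0 → coeff 0 (f ∅) = 0) :
    ∃ g ∈ tyS σ K (q + 1) j, kos (K := K) g = f := by
  by_cases hj : j < q
  · exact ⟨0, Submodule.zero_mem _, by rw [tyS_neg hf hj, map_zero]⟩
  lift j to ℕ using (by omega)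
  by_cases hqj : q = 0 ∧ j = 0
  · obtain ⟨rfl, rfl⟩ := hqj
    refine ⟨0, Submodule.zero_mem _, ?_⟩
    rw [map_zero]
    symm
    funext J
    by_cases hJ : J.card = 0
    · rw [Finset.card_eq_zero] at hJ
      subst hJ
      ext u
      by_contra h'
      have := (hf ∅).2 u (by simpa using h')
      have h2 : u.degree = 0 := by simpa using this
      rw [Finsupp.degree_eq_zero_iff] at h2
      subst h2
      exact h' (by rw [h0 rfl]; rfl)
    · exact (hf J).1 hJ
  · let eqv : (σ →₀ ℕ) ≃ (T0 σ).ST :=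
      ⟨fun u => ⟨u, (T0 σ).nf_std u⟩, fun u => u.1, fun _ => rfl, fun _ => rfl⟩
    have := Tor.exact0 (T := T0 σ) (b := (basisMonomials σ K).reindex eqv) (φ := LinearMap.id) (q := q) (j := j)
      (by intro u; simp [eqv]; rfl) ?_ hf (by intro J; rw [hk]; rfl)
    · obtain ⟨g, hg, h⟩ := this
      refine ⟨g, hg, ?_⟩
      funext J
      have := h J
      simp only [LinearMap.id_apply, sub_eq_zero] at this
      exact this.symm
    · intro x hx hc
      obtain ⟨h1, h2⟩ := Tor.crit_prop hc
      have hb : bet (T0 σ).bad x.2.1 = ∅ := by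
        ext w; rw [mem_bet]; simp [T0]
      have hF : Fa (T0 σ).bad ∅ = univ := by
        ext w; rw [mem_Fa]; simp [T0]
      have hR : Ra (T0 σ).bad ∅ = ∅ := by
        ext w; rw [mem_Ra]; simp
      rw [hb, hF] at h1
      rw [hb, hR] at h2
      have h3 : x.1 = ∅ := by
        rw [Finset.eq_empty_iff_forall_notMem]
        intro v hv
        exact (Finset.disjoint_left.1 h1) hv (mem_univ _)
      simp only [Tor.typ, h2, h3, Prod.mk.injEq] at hx
      simp at hx
      exact hqj ⟨hx.1.symm, hx.2.symm⟩

theorem free_exactV {t : ℕ} {tw : Fin t → ℤ} {q : ℕ} {j : ℤ} {f : Finset σ → Fin t → MvPolynomial σ K}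
    (hf : f ∈ tyV σ K tw q j)
    (hk : kos (K := K) f = 0) (h0 : q = 0 → ∀ i, coeff 0 (f ∅ i) = 0) :
    ∃ g ∈ tyV σ K tw (q + 1) j, kos (K := K) g = f := by
  have : ∀ i, ∃ g ∈ tyS σ K (q + 1) (j - tw i), kos (K := K) g = fun J => f J i := by
    intro i
    apply free_exact (tyV_comp hf i)
    · funext J
      rw [← kos_comp, hk]; rfl
    · intro h; exact h0 h i
  choose g hg hg' using this
  refine ⟨fun J i => g i J, tyV_of_comp hg, ?_⟩
  funext J i
  rw [kos_comp]
  exact congrFun (hg' i) J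

/-- homogeneous component of integer degree -/
noncomputable def hc (k : ℤ) : MvPolynomial σ K →ₗ[K] MvPolynomial σ K :=
  if 0 ≤ k then homogeneousComponent k.toNat else 0

lemma coeff_hc (k : ℤ) (p : MvPolynomial σ K) (u : σ →₀ ℕ) :
    coeff u (hc k p) = if (u.degree : ℤ) = k then coeff u p else 0 := by
  unfold hc
  split_ifs with h1 h2 h2
  · rw [coeff_homogeneousComponent, if_pos]; omega
  · rw [coeff_homogeneousComponent, if_neg]; omega
  · omega
  · simp

lemma hc_mem (k : ℤ) (p : MvPolynomial σ K) : hc k p ∈ hz σ K k := by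
  intro u hu
  rw [coeff_hc] at hu
  by_contra h
  simp [h] at hu

lemma hc_eq {k : ℤ} {p : MvPolynomial σ K} (hp : p ∈ hz σ K k) : hc k p = p := by
  ext u
  rw [coeff_hc]
  split_ifs with h
  · rfl
  · by_contra h'
    exact h (hp u (Ne.symm h'))

lemma hc_mul {e : ℤ} {m : MvPolynomial σ K} (hm : m ∈ hz σ K e) (k : ℤ) (p : MvPolynomial σ K) :
    hc k (m * p) = m * hc (k - e) p := by
  classical
  ext u
  rw [coeff_hc, coeff_mul, coeff_mul]
  split_ifs with h
  · refine Finset.sum_congr rfl fun x hx => ?_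
    rw [HasAntidiagonal.mem_antidiagonal] at hx
    by_cases h0 : coeff x.1 m = 0
    · simp [h0]
    · have h1 := hm _ h0
      rw [coeff_hc, if_pos]
      rw [← hx, map_add] at h
      push_cast at h; omega
  · symm
    refine Finset.sum_eq_zero fun x hx => ?_
    rw [HasAntidiagonal.mem_antidiagonal] at hx
    by_cases h0 : coeff x.1 m = 0
    · simp [h0]
    · have h1 := hm _ h0
      rw [coeff_hc, if_neg, mul_zero]
      rw [← hx, map_add] at h
      push_cast at h; omega

/-- graded vectors -/
def hv {t : ℕ} (σ K : Type) [Field K] (tw : Fin t → ℤ) (k : ℤ) : Submodule K (Fin t → MvPolynomial σ K) where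
  carrier := {x | ∀ i, x i ∈ hz σ K (k - tw i)}
  add_mem' := fun hx hy i => Submodule.add_mem _ (hx i) (hy i)
  zero_mem' := fun i => Submodule.zero_mem _
  smul_mem' := fun c x hx i => Submodule.smul_mem _ _ (hx i)

lemma mem_hv {t : ℕ} {tw : Fin t → ℤ} {k : ℤ} {x : Fin t → MvPolynomial σ K} :
    x ∈ hv σ K tw k ↔ ∀ i, x i ∈ hz σ K (k - tw i) := Iff.rfl

/-- homogeneous components of vectors -/
noncomputable def hcV {t : ℕ} (tw : Fin t → ℤ) (k : ℤ) (x : Fin t → MvPolynomial σ K) : Fin t → MvPolynomial σ K :=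
  fun i => hc (k - tw i) (x i)

lemma hcV_mem {t : ℕ} (tw : Fin t → ℤ) (k : ℤ) (x : Fin t → MvPolynomial σ K) : hcV tw k x ∈ hv σ K tw k :=
  fun i => hc_mem _ _

lemma hcV_eq {t : ℕ} {tw : Fin t → ℤ} {k : ℤ} {x : Fin t → MvPolynomial σ K} (hx : x ∈ hv σ K tw k) :
    hcV tw k x = x := funext fun i => hc_eq (hx i)

lemma mulVec_hv {t s : ℕ} {tw : Fin t → ℤ} {tw' : Fin s → ℤ} {A : Matrix (Fin t) (Fin s) (MvPolynomial σ K)}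
    (hA : ∀ i j, A i j ∈ hz σ K (tw' j - tw i)) {k : ℤ} {y : Fin s → MvPolynomial σ K} (hy : y ∈ hv σ K tw' k) :
    A.mulVecLin y ∈ hv σ K tw k := by
  intro i
  rw [Matrix.mulVecLin_apply, Matrix.mulVec, dotProduct]
  refine Submodule.sum_mem _ fun j _ => ?_
  have := hz_mul (hA i j) (hy j)
  rwa [show tw' j - tw i + (k - tw' j) = k - tw i by ring] at this

lemma mulVec_hcV {t s : ℕ} {tw : Fin t → ℤ} {tw' : Fin s → ℤ} {A : Matrix (Fin t) (Fin s) (MvPolynomial σ K)}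
    (hA : ∀ i j, A i j ∈ hz σ K (tw' j - tw i)) (k : ℤ) (y : Fin s → MvPolynomial σ K) :
    A.mulVecLin (hcV tw' k y) = hcV tw k (A.mulVecLin y) := by
  funext i
  simp only [hcV, Matrix.mulVecLin_apply, Matrix.mulVec, dotProduct, map_sum]
  refine Finset.sum_congr rfl fun j _ => ?_
  rw [hc_mul (hA i j), show k - tw i - (tw' j - tw i) = k - tw' j by ring]

/-- minimal graded resolution without finiteness -/
structure PreRes (σ K : Type) [Field K] (I : Ideal (MvPolynomial σ K)) where
  t : ℕ → ℕ
  tw : (d : ℕ) → Fin (t d) → ℤ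
  mat : (d : ℕ) → Matrix (Fin (t d)) (Fin (t (d + 1))) (MvPolynomial σ K)
  t0 : t 0 = 1
  tw0 : ∀ i, tw 0 i = 0
  graded : ∀ d i j, mat d i j ∈ hz σ K (tw (d + 1) j - tw d i)
  minimal : ∀ d i j, coeff 0 (mat d i j) = 0
  aug : LinearMap.range (mat 0).mulVecLin = Submodule.pi Set.univ (fun _ : Fin (t 0) => I)
  isexact : ∀ d, LinearMap.range (mat (d + 1)).mulVecLin = LinearMap.ker (mat d).mulVecLin

namespace PreRes
variable {I : Ideal (MvPolynomial σ K)} (R : PreRes σ K I)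

/-- the cycles -/
noncomputable def Z (d : ℕ) : Submodule (MvPolynomial σ K) (Fin (R.t d) → MvPolynomial σ K) := LinearMap.range (R.mat d).mulVecLin

lemma const_coeff {d : ℕ} (y : Fin (R.t (d+1)) → MvPolynomial σ K) (i : Fin (R.t d)) :
    coeff 0 ((R.mat d).mulVecLin y i) = 0 := by
  rw [Matrix.mulVecLin_apply, Matrix.mulVec, dotProduct, coeff_sum]
  refine Finset.sum_eq_zero fun j _ => ?_
  rw [← constantCoeff_eq, map_mul, constantCoeff_eq, R.minimal, zero_mul]

lemma lift {d : ℕ} {k : ℤ} {x : Fin (R.t d) → MvPolynomial σ K} (hx : x ∈ R.Z d) (hk : x ∈ hv σ K (R.tw d) k) :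
    ∃ y ∈ hv σ K (R.tw (d+1)) k, (R.mat d).mulVecLin y = x := by
  obtain ⟨y, rfl⟩ := hx
  exact ⟨hcV _ k y, hcV_mem _ _ _, by rw [mulVec_hcV (R.graded d), hcV_eq hk]⟩

/-- exactness of the Koszul complex modulo `Z d` -/
def QE (d q : ℕ) (j : ℤ) : Prop :=
  ∀ f ∈ tyV σ K (R.tw d) q j, (∀ J, kos (K := K) f J ∈ R.Z d) →
    ∃ g ∈ tyV σ K (R.tw d) (q + 1) j, ∀ J, f J - kos (K := K) g J ∈ R.Z d

lemma tyV_hv {t : ℕ} {tw : Fin t → ℤ} {q : ℕ} {j : ℤ} {f : Finset σ → Fin t → MvPolynomial σ K}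
    (hf : f ∈ tyV σ K tw q j) (J : Finset σ) : f J ∈ hv σ K tw (j - q) := (hf J).2

lemma map_tyV {d q : ℕ} {j : ℤ} {f : Finset σ → Fin (R.t (d+1)) → MvPolynomial σ K}
    (hf : f ∈ tyV σ K (R.tw (d+1)) q j) : (fun J => (R.mat d).mulVecLin (f J)) ∈ tyV σ K (R.tw d) q j := by
  intro J
  refine ⟨fun h => by simp only [(hf J).1 h, map_zero], ?_⟩
  exact mulVec_hv (R.graded d) (tyV_hv hf J)

lemma lift_tyV {d q : ℕ} {j : ℤ} {f : Finset σ → Fin (R.t d) → MvPolynomial σ K}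
    (hf : f ∈ tyV σ K (R.tw d) q j) (hZ : ∀ J, f J ∈ R.Z d) :
    ∃ y ∈ tyV σ K (R.tw (d+1)) q j, ∀ J, (R.mat d).mulVecLin (y J) = f J := by
  classical
  choose y hy hy' using fun J => R.lift (hZ J) (tyV_hv hf J)
  refine ⟨fun J => if J.card = q then y J else 0, ?_, ?_⟩
  · intro J
    by_cases h : J.card = q
    · simp only [h, if_true, ne_eq, not_true_eq_false, false_implies, true_and]
      exact hy J
    · simp only [h, if_false]
      exact ⟨fun _ => by simp, fun i => Submodule.zero_mem _⟩
  · intro J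
    by_cases h : J.card = q
    · simp only [h, if_true]; exact hy' J
    · simp only [h, if_false]; rw [map_zero, (hf J).1 h]

lemma mem_Z_succ {d : ℕ} {x : Fin (R.t (d+1)) → MvPolynomial σ K} :
    x ∈ R.Z (d+1) ↔ (R.mat d).mulVecLin x = 0 := by
  unfold Z; rw [R.isexact, LinearMap.mem_ker]

lemma kos_ty0V {t : ℕ} {tw : Fin t → ℤ} {j : ℤ} {f : Finset σ → Fin t → MvPolynomial σ K}
    (hf : f ∈ tyV σ K tw 0 j) : kos (K := K) f = 0 := by
  funext J i
  rw [kos_comp, kos_zero_of_ty0 (q := 0) (tyV_comp hf i)]; rfl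

lemma step_down {d q : ℕ} {j : ℤ} (h : R.QE d (q+1) j) : R.QE (d+1) q j := by
  intro f hf hk
  obtain ⟨y, hy, hy'⟩ := free_exactV (R.map_tyV hf) (by
    funext J
    rw [kos_map]
    exact R.mem_Z_succ.1 (hk J)) (fun _ i => R.const_coeff _ _)
  obtain ⟨g, hg, hg'⟩ := h y hy (by
    intro J; rw [hy']; exact ⟨f J, rfl⟩)
  obtain ⟨y', h1, h2⟩ := R.lift_tyV (f := y - kos (K := K) g) (Submodule.sub_mem _ hy (kos_tyV hg)) hg'
  refine ⟨y', h1, fun J => ?_⟩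
  rw [R.mem_Z_succ, map_sub, ← kos_map]
  have : (fun J => (R.mat d).mulVecLin (y' J)) = y - kos (K := K) g := funext h2
  rw [this, map_sub, kos_kos, hy', sub_zero, sub_self]

lemma step_up {d q : ℕ} {j : ℤ} (h : R.QE (d+1) q j) : R.QE d (q+1) j := by
  intro y hy hk
  obtain ⟨f, hf, hf'⟩ := R.lift_tyV (kos_tyV hy) hk
  have hf'' : (fun J => (R.mat d).mulVecLin (f J)) = kos (K := K) y := funext hf'
  obtain ⟨y', hy', h2⟩ := h f hf (by
    intro J
    rw [R.mem_Z_succ, ← kos_map, hf'', kos_kos]; rfl)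
  obtain ⟨g, hg, hg'⟩ := free_exactV (f := y - fun J => (R.mat d).mulVecLin (y' J))
    (Submodule.sub_mem _ hy (R.map_tyV hy')) (by
      rw [map_sub]
      funext J
      have := h2 J
      rw [R.mem_Z_succ, map_sub, sub_eq_zero, ← kos_map, hf'] at this
      rw [Pi.sub_apply, this, sub_self]; rfl) (fun h => by omega)
  refine ⟨g, hg, fun J => ⟨y' J, ?_⟩⟩
  rw [hg', Pi.sub_apply, sub_sub_cancel]

lemma QE_iff_zero {d : ℕ} {j : ℤ} : R.QE d 0 j ↔ ∀ i, R.tw d i ≠ j := by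
  classical
  constructor
  · intro h i hi
    have hf : (Pi.single ∅ (Pi.single i 1) : Finset σ → Fin (R.t d) → MvPolynomial σ K) ∈ tyV σ K (R.tw d) 0 j := by
      intro J
      by_cases hJ : J = ∅
      · subst hJ
        refine ⟨fun h => absurd rfl h, fun i' => ?_⟩
        rw [Pi.single_eq_same]
        by_cases hi' : i' = i
        · subst hi'
          rw [Pi.single_eq_same]
          rw [← C_1, C_apply]
          apply monomial_mem_hz
          simp [hi]
        · rw [Pi.single_eq_of_ne hi']; exact Submodule.zero_mem _
      · rw [Pi.single_eq_of_ne hJ]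
        exact ⟨fun _ => rfl, fun i => Submodule.zero_mem _⟩
    obtain ⟨g, hg, hg'⟩ := h _ hf (by
      intro J; rw [kos_ty0V hf]; exact Submodule.zero_mem _)
    obtain ⟨y, hy⟩ := hg' ∅
    have h1 := R.const_coeff y i
    rw [hy, Pi.sub_apply, coeff_sub, Pi.single_eq_same, Pi.single_eq_same, kos_comp, kos_apply, coeff_sum,
      Finset.sum_eq_zero] at h1
    · simp at h1
    · intro v _
      rw [← constantCoeff_eq, map_zsmul, smul_eq_mul, map_mul]
      simp
  · intro h f hf hk
    obtain ⟨g, hg, hg'⟩ := free_exactV hf (kos_ty0V hf) (by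
      intro _ i
      by_contra h'
      have := (hf ∅).2 i 0 h'
      simp at this
      exact h i (by omega))
    exact ⟨g, hg, fun J => by rw [hg', sub_self]; exact Submodule.zero_mem _⟩

lemma QE_shift {d q : ℕ} {j : ℤ} : R.QE d q j ↔ R.QE 0 (d + q) j := by
  induction d generalizing q with
  | zero => rw [Nat.zero_add]
  | succ d ih =>
    rw [show d + 1 + q = d + (q + 1) by ring, ← ih]
    exact ⟨R.step_up, R.step_down⟩

theorem twist_iff (d : ℕ) (j : ℤ) : R.QE 0 d j ↔ ∀ i, R.tw d i ≠ j := by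
  rw [← QE_iff_zero, R.QE_shift (d := d) (q := 0), Nat.add_zero]

lemma QE_base (q : ℕ) (j : ℤ) : R.QE 0 q j ↔ ∀ f ∈ tyS σ K q j, (∀ J, kos (K := K) f J ∈ I) →
    ∃ g ∈ tyS σ K (q+1) j, ∀ J, f J - kos (K := K) g J ∈ I := by
  have hZ : ∀ x, x ∈ R.Z 0 ↔ ∀ i, x i ∈ I := by
    intro x; unfold Z; rw [R.aug]; simp
  constructor
  · intro h f hf hk
    obtain ⟨g, hg, hg'⟩ := h (fun J _ => f J) (tyV_of_comp (by intro i; rw [R.tw0, sub_zero]; exact hf)) (by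
      intro J; rw [hZ]; intro i; rw [kos_comp]; exact hk J)
    have i0 : Fin (R.t 0) := ⟨0, by rw [R.t0]; exact one_pos⟩
    refine ⟨fun J => g J i0, ?_, ?_⟩
    · have := tyV_comp hg i0
      rwa [R.tw0, sub_zero] at this
    · intro J
      have := (hZ _).1 (hg' J) i0
      rwa [Pi.sub_apply, kos_comp] at this
  · intro h f hf hk
    have : ∀ i, ∃ g ∈ tyS σ K (q+1) j, ∀ J, f J i - kos (K := K) g J ∈ I := by
      intro i
      apply h (fun J => f J i)
      · have := tyV_comp hf i
        rwa [R.tw0, sub_zero] at this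
      · intro J
        rw [← kos_comp]
        exact (hZ _).1 (hk J) i
    choose g hg hg' using this
    refine ⟨fun J i => g i J, tyV_of_comp (by intro i; rw [R.tw0, sub_zero]; exact hg i), ?_⟩
    intro J
    rw [hZ]
    intro i
    rw [Pi.sub_apply, kos_comp]
    exact hg' i J

end PreRes

theorem PreRes.main {I : Ideal (MvPolynomial σ K)} (R : PreRes σ K I) {T : Tor σ}
    (b : Module.Basis T.ST K (MvPolynomial σ K ⧸ I))
    (hφ : ∀ u, Submodule.mkQ I (monomial u 1) = b ⟨T.nf u, T.nf_std u⟩) {c r : ℕ}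
    (hp : ∀ u, Std T.bad u → (Fa T.bad (bet T.bad u)).card + c = Fintype.card σ)
    (hr : ∀ u, Std T.bad u → (Ra T.bad (bet T.bad u)).card ≤ r)
    (u₀ : σ →₀ ℕ) (hu₀ : Std T.bad u₀) (hr₀ : (Ra T.bad (bet T.bad u₀)).card = r) :
    (∀ d, c < d → R.t d = 0) ∧ IsGreatest { z : ℤ | ∃ (d : ℕ) (i : Fin (R.t d)), z = R.tw d i - (d : ℤ) } (r : ℤ) := by
  have hI : ∀ x, x ∈ I ↔ Submodule.mkQ I x = 0 := by
    intro x; exact (Submodule.Quotient.mk_eq_zero I).symm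
  have key : ∀ d (j : ℤ), (∃ i, R.tw d i = j) → d ≤ c ∧ j ≤ d + r := by
    rintro d j ⟨i, hi⟩
    by_contra hcon
    apply (R.twist_iff d j).1 _ i hi
    rw [R.QE_base]
    intro f hf hk
    by_cases hj : j < d
    · rw [tyS_neg hf hj]
      exact ⟨0, Submodule.zero_mem _, fun J => by simp⟩
    lift j to ℕ using (by omega)
    simp only [hI] at hk ⊢
    refine Tor.exact0 hφ ?_ hf hk
    intro x hx hxc
    obtain ⟨h1, h2⟩ := Tor.crit_typ hp hxc
    have h3 := hr _ x.2.2
    rw [hx] at h1 h2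
    simp only at h1 h2
    omega
  refine ⟨?_, ?_, ?_⟩
  · intro d hd
    by_contra h
    have := (key d _ ⟨⟨0, Nat.pos_of_ne_zero h⟩, rfl⟩).1
    omega
  · have h1 : ¬ R.QE 0 c ((r + c : ℕ) : ℤ) := by
      rw [R.QE_base]
      intro h
      obtain ⟨f, hf, hk, hn⟩ := Tor.nonexact hφ hp hr u₀ hu₀ hr₀
      obtain ⟨g, hg, hg'⟩ := h f hf (fun J => (hI _).2 (hk J))
      exact hn g hg (fun J => (hI _).1 (hg' J))
    rw [R.twist_iff] at h1
    push Not at h1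
    obtain ⟨i, hi⟩ := h1
    exact ⟨c, i, by rw [hi]; push_cast; ring⟩
  · rintro z ⟨d, i, rfl⟩
    have := (key d _ ⟨i, rfl⟩).2
    omega

end
end FrameReg

set_option linter.unusedSectionVars false
set_option linter.unusedSimpArgs false
set_option linter.unusedVariables false

namespace FrameReg
open Finset MvPolynomial

section
variable {σ : Type} [Fintype σ] [LinearOrder σ] {K : Type} [Field K]

lemma weight_le (om : σ → ℕ) (u : σ →₀ ℕ) : Finsupp.weight om u ≤ u.degree * ∑ v, om v := by
  rw [Finsupp.weight_apply, Finsupp.sum_fintype _ _ (by simp), Finsupp.degree_eq_sum, Finset.sum_mul]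
  refine Finset.sum_le_sum fun v _ => ?_
  rw [smul_eq_mul]
  exact Nat.mul_le_mul_left _ (Finset.single_le_sum (f := om) (fun _ _ => Nat.zero_le _) (mem_univ v))

/-- the relation data of a toric binomial ideal -/
structure TorData (σ K : Type) [Fintype σ] [LinearOrder σ] [Field K] (A : Type) [AddCommMonoid A]
    (G : Set (MvPolynomial σ K)) where
  bad : σ → σ → Prop
  om : σ → ℕ
  inv : (σ →₀ ℕ) →+ A
  gen : ∀ g ∈ G, ∃ a b c d : σ, g = X a * X b - X c * X d ∧
    inv (Finsupp.single a 1 + Finsupp.single b 1) = inv (Finsupp.single c 1 + Finsupp.single d 1)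
  irr : ∀ w, ¬ bad w w
  red : ∀ w q, bad w q → ∃ a b : σ, X w * X q - X a * X b ∈ Ideal.span G ∧ om w + om q < om a + om b ∧
    inv (Finsupp.single w 1 + Finsupp.single q 1) = inv (Finsupp.single a 1 + Finsupp.single b 1)
  uniq : ∀ u u', Std bad u → Std bad u' → inv u = inv u' → u = u'
  P2 : ∀ u, Std bad u → ∀ w ∈ bet bad u, ∃ q ∈ Ra bad (bet bad u), bad w q

namespace TorData
variable {A : Type} [AddCommMonoid A] {G : Set (MvPolynomial σ K)} (D : TorData σ K A G)

lemma exists_nf (u : σ →₀ ℕ) : ∃ u', Std D.bad u' ∧ (Std D.bad u → u' = u) ∧ u'.degree = u.degree ∧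
    (¬ Std D.bad u → Finsupp.weight D.om u < Finsupp.weight D.om u') ∧ D.inv u' = D.inv u ∧
    (monomial u 1 - monomial u' 1 : MvPolynomial σ K) ∈ Ideal.span G := by
  classical
  generalize hN : u.degree * (∑ v, D.om v) - Finsupp.weight D.om u = N
  induction N using Nat.strong_induction_on generalizing u with
  | _ N ih =>
  by_cases hu : Std D.bad u
  · exact ⟨u, hu, fun _ => rfl, rfl, fun h => absurd hu h, rfl, by simp⟩
  have hu' := hu
  unfold Std at hu'
  push Not at hu'
  obtain ⟨w, q, hw, hq, hb⟩ := hu'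
  obtain ⟨a, b, h1, h2, h3⟩ := D.red w q hb
  have hwq : w ≠ q := by rintro rfl; exact D.irr _ hb
  obtain ⟨r, rfl⟩ : ∃ r, u = r + (Finsupp.single w 1 + Finsupp.single q 1) := by
    refine ⟨u - (Finsupp.single w 1 + Finsupp.single q 1), ?_⟩
    rw [tsub_add_cancel_of_le]
    intro v
    by_cases h : v = w
    · subst h; simp [Finsupp.single_apply, hwq.symm]; omega
    · by_cases h' : v = q
      · subst h'; simp [Finsupp.single_apply, hwq]; omega
      · simp [Finsupp.single_apply, Ne.symm h, Ne.symm h']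
  set u2 := r + (Finsupp.single a 1 + Finsupp.single b 1) with hu2
  have hdeg : u2.degree = (r + (Finsupp.single w 1 + Finsupp.single q 1)).degree := by
    simp [hu2]
  have hwt : Finsupp.weight D.om (r + (Finsupp.single w 1 + Finsupp.single q 1)) < Finsupp.weight D.om u2 := by
    simp only [hu2, map_add, weight_single_one']; omega
  have hI : (monomial (r + (Finsupp.single w 1 + Finsupp.single q 1)) 1 - monomial u2 1 : MvPolynomial σ K) ∈ Ideal.span G := by
    have := Ideal.mul_mem_left _ (monomial r (1:K)) h1
    have e : ∀ x y : σ, (monomial (r + (Finsupp.single x 1 + Finsupp.single y 1)) 1 : MvPolynomial σ K)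
        = monomial r 1 * (X x * X y) := by
      intro x y
      simp [X, monomial_mul]
    rw [hu2, e, e, ← mul_sub]
    exact this
  have hle := weight_le D.om u2
  obtain ⟨u', k1, k2, k3, k4, k5, k6⟩ := ih _ (by rw [← hN]; rw [hdeg] at hle ⊢; omega) u2 rfl
  refine ⟨u', k1, fun h => absurd h hu, k3.trans hdeg, fun _ => ?_, ?_, ?_⟩
  · by_cases h : Std D.bad u2
    · rw [k2 h]; exact hwt
    · exact hwt.trans (k4 h)
  · rw [k5, hu2, map_add, map_add _ r, h3]
  · have := Ideal.add_mem _ hI k6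
    rwa [sub_add_sub_cancel] at this

/-- the toric datum -/
noncomputable def tor : Tor σ where
  bad := D.bad
  om := D.om
  nf u := (D.exists_nf u).choose
  nf_std u := (D.exists_nf u).choose_spec.1
  nf_eq u := (D.exists_nf u).choose_spec.2.1
  nf_deg u := (D.exists_nf u).choose_spec.2.2.1
  nf_wt u := (D.exists_nf u).choose_spec.2.2.2.1
  P2 := D.P2

lemma nf_inv (u : σ →₀ ℕ) : D.inv (D.tor.nf u) = D.inv u := (D.exists_nf u).choose_spec.2.2.2.2.1
lemma nf_mem (u : σ →₀ ℕ) : (monomial u 1 - monomial (D.tor.nf u) 1 : MvPolynomial σ K) ∈ Ideal.span G :=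
  (D.exists_nf u).choose_spec.2.2.2.2.2

lemma nf_congr {u u' : σ →₀ ℕ} (h : D.inv u = D.inv u') : D.tor.nf u = D.tor.nf u' :=
  D.uniq _ _ (D.tor.nf_std _) (D.tor.nf_std _) (by rw [nf_inv, nf_inv, h])

/-- normal form map -/
noncomputable def Phi : MvPolynomial σ K →ₗ[K] (D.tor.ST →₀ K) :=
  (basisMonomials σ K).constr K (fun u => Finsupp.single ⟨D.tor.nf u, D.tor.nf_std u⟩ 1)

lemma Phi_mono (u : σ →₀ ℕ) : D.Phi (monomial u 1) = Finsupp.single ⟨D.tor.nf u, D.tor.nf_std u⟩ 1 := by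
  have := (basisMonomials σ K).constr_basis K (fun u => (Finsupp.single ⟨D.tor.nf u, D.tor.nf_std u⟩ 1 : D.tor.ST →₀ K)) u
  rwa [coe_basisMonomials] at this

lemma Phi_zero (x : MvPolynomial σ K) (hx : x ∈ Ideal.span G) : D.Phi x = 0 := by
  have : ∀ p : MvPolynomial σ K, D.Phi (p * x) = 0 := by
    refine Submodule.span_induction (p := fun x _ => ∀ p : MvPolynomial σ K, D.Phi (p * x) = 0) ?_ ?_ ?_ ?_ hx
    · intro g hg p
      obtain ⟨a, b, c, d, rfl, h⟩ := D.gen g hg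
      induction p using MvPolynomial.induction_on' with
      | monomial u k =>
        have e : ∀ x y : σ, (monomial u k * (X x * X y) : MvPolynomial σ K)
          = k • monomial (u + (Finsupp.single x 1 + Finsupp.single y 1)) 1 := by
          intro x y
          simp [X, monomial_mul, smul_monomial]
        rw [mul_sub, e, e, map_sub, map_smul, map_smul, Phi_mono, Phi_mono, sub_eq_zero]
        congr 3
        apply D.nf_congr
        rw [map_add, h, ← map_add]
      | add p q h1 h2 => rw [add_mul, map_add, h1, h2, add_zero]
    · intro p; simp
    · intro x y _ _ h1 h2 p
      rw [mul_add, map_add, h1, h2, add_zero]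
    · intro a x _ h p
      rw [smul_eq_mul, ← mul_assoc]; exact h _
  simpa using this 1

/-- the basis of standard monomials -/
theorem exists_basis : ∃ b : Module.Basis D.tor.ST K (MvPolynomial σ K ⧸ Ideal.span G),
    ∀ u, Submodule.mkQ (Ideal.span G) (monomial u 1) = b ⟨D.tor.nf u, D.tor.nf_std u⟩ := by
  let mk : MvPolynomial σ K →ₗ[K] (MvPolynomial σ K ⧸ Ideal.span G) := (Submodule.mkQ (Ideal.span G)).restrictScalars K
  have hmk : ∀ u, mk (monomial u 1) = mk (monomial (D.tor.nf u) 1) := by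
    intro u
    rw [← sub_eq_zero, ← map_sub]
    exact (Submodule.Quotient.mk_eq_zero _).2 (D.nf_mem u)
  let Ps : (D.tor.ST →₀ K) →ₗ[K] (MvPolynomial σ K ⧸ Ideal.span G) :=
    Finsupp.linearCombination K (fun u : D.tor.ST => mk (monomial u.1 1))
  let Ph : (MvPolynomial σ K ⧸ Ideal.span G) →ₗ[K] (D.tor.ST →₀ K) :=
    ((Ideal.span G).restrictScalars K).liftQ D.Phi (fun x hx => D.Phi_zero x hx)
  have hPh : ∀ x, Ph (mk x) = D.Phi x := fun x => rfl
  let e : (MvPolynomial σ K ⧸ Ideal.span G) ≃ₗ[K] (D.tor.ST →₀ K) := LinearEquiv.ofLinearMap Ph Ps (by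
      ext u : 2
      simp only [LinearMap.comp_apply, Finsupp.lsingle_apply, LinearMap.id_apply]
      change Ph (Finsupp.linearCombination K (fun u : D.tor.ST => mk (monomial u.1 1)) (Finsupp.single u 1)) = _
      rw [Finsupp.linearCombination_single, one_smul, hPh, Phi_mono]
      congr 1
      exact Subtype.ext (D.tor.nf_eq _ u.2)) (by
      apply LinearMap.ext
      intro x
      obtain ⟨x, rfl⟩ := Submodule.mkQ_surjective _ x
      change Ps (Ph (mk x)) = mk x
      induction x using MvPolynomial.induction_on' with
      | monomial u k =>
        have e : (monomial u k : MvPolynomial σ K) = k • monomial u 1 := by simp [smul_monomial]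
        rw [e, map_smul, map_smul, map_smul, hPh, Phi_mono]
        congr 1
        change Finsupp.linearCombination K (fun u : D.tor.ST => mk (monomial u.1 1)) _ = _
        rw [Finsupp.linearCombination_single, one_smul, hmk u]
      | add p q h1 h2 => rw [map_add, map_add, map_add, h1, h2])
  refine ⟨Module.Basis.ofRepr e, fun u => ?_⟩
  apply e.injective
  rw [show e ((Module.Basis.ofRepr e) ⟨D.tor.nf u, D.tor.nf_std u⟩) = Finsupp.single ⟨D.tor.nf u, D.tor.nf_std u⟩ 1
    from (Module.Basis.ofRepr e).repr_self _]
  change Ph (mk (monomial u 1)) = _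
  rw [hPh, Phi_mono]

end TorData

end
end FrameReg

set_option linter.unusedSectionVars false
set_option linter.unusedSimpArgs false
set_option linter.unusedVariables false

namespace FrameReg
open Finset MvPolynomial

section
variable {σ : Type} [Fintype σ] [LinearOrder σ] {K : Type} [Field K]

lemma sum_hc (p : MvPolynomial σ K) (N : ℕ) (hN : p.totalDegree < N) (e : ℤ) (a b : ℤ) (ha : a + e ≤ 0) (hb : N ≤ b + e) :
    ∑ k ∈ Finset.Icc a b, hc (k + e) p = p := by
  classical
  ext u
  rw [coeff_sum]
  by_cases h : coeff u p = 0
  · rw [h]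
    refine Finset.sum_eq_zero fun k _ => ?_
    rw [coeff_hc, h, ite_self]
  · have hu : u.degree ≤ p.totalDegree := by
      have := MvPolynomial.le_totalDegree (mem_support_iff.2 h)
      rw [Finsupp.degree_eq_sum]
      rwa [Finsupp.sum_fintype _ _ (by simp)] at this
    rw [Finset.sum_eq_single ((u.degree : ℤ) - e)]
    · rw [coeff_hc, if_pos (by ring)]
    · intro k _ hk
      rw [coeff_hc, if_neg (by omega)]
    · intro h'
      exfalso
      apply h'
      rw [Finset.mem_Icc]
      omega

lemma exists_sum_hcV {t : ℕ} (tw : Fin t → ℤ) (x : Fin t → MvPolynomial σ K) :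
    ∃ s : Finset ℤ, ∑ k ∈ s, hcV tw k x = x := by
  classical
  let N := ∑ i, ((x i).totalDegree + (tw i).natAbs) + 1
  have hle : ∀ i, (x i).totalDegree + (tw i).natAbs < N := fun i =>
    Nat.lt_succ_of_le (Finset.single_le_sum (f := fun i => (x i).totalDegree + (tw i).natAbs) (fun _ _ => Nat.zero_le _) (mem_univ i))
  refine ⟨Finset.Icc (-N) (2 * N), ?_⟩
  funext i
  rw [Finset.sum_apply]
  have := hle i
  simp only [hcV, sub_eq_add_neg]
  exact sum_hc (x i) N (by omega) _ _ _ (by omega) (by omega)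

lemma cover_exists {t : ℕ} (tw : Fin t → ℤ) (Z : Submodule (MvPolynomial σ K) (Fin t → MvPolynomial σ K))
    (hZ : ∀ x ∈ Z, ∀ k, hcV tw k x ∈ Z) :
    ∃ s, ∃ (g : Fin s → Fin t → MvPolynomial σ K) (tw' : Fin s → ℤ), (∀ j, g j ∈ hv σ K tw (tw' j)) ∧
      Submodule.span (MvPolynomial σ K) (Set.range g) = Z := by
  classical
  let H : Set (Fin t → MvPolynomial σ K) := {x | x ∈ Z ∧ ∃ k, x ∈ hv σ K tw k}
  have hH : Submodule.span (MvPolynomial σ K) H = Z := by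
    apply le_antisymm
    · exact Submodule.span_le.2 fun x hx => hx.1
    · intro x hx
      obtain ⟨s, hs⟩ := exists_sum_hcV tw x
      rw [← hs]
      exact Submodule.sum_mem _ fun k _ => Submodule.subset_span ⟨hZ x hx k, k, hcV_mem _ _ _⟩
  have hfg : (Submodule.span (MvPolynomial σ K) H).FG := IsNoetherian.noetherian _
  obtain ⟨T, hT, hT'⟩ := Submodule.fg_span_iff_fg_span_finset_subset H |>.1 hfg
  have : ∀ j : Fin T.card, ∃ k, (T.equivFin.symm j).1 ∈ hv σ K tw k := fun j => (hT (T.equivFin.symm j).2).2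
  choose tw' htw' using this
  refine ⟨T.card, fun j => (T.equivFin.symm j).1, tw', htw', ?_⟩
  rw [← hH, hT']
  congr 1
  ext x
  constructor
  · rintro ⟨j, rfl⟩; exact (T.equivFin.symm j).2
  · intro hx; exact ⟨T.equivFin ⟨x, hx⟩, by simp⟩

lemma mulVec_eq_sum {t s : ℕ} (g : Fin s → Fin t → MvPolynomial σ K) (y : Fin s → MvPolynomial σ K) :
    (Matrix.of fun i j => g j i).mulVecLin y = ∑ j, y j • g j := by
  funext i
  rw [Matrix.mulVecLin_apply, Matrix.mulVec, dotProduct, Finset.sum_apply]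
  refine Finset.sum_congr rfl fun j _ => ?_
  simp [mul_comm]

lemma cover_min {t : ℕ} (tw : Fin t → ℤ) (Z : Submodule (MvPolynomial σ K) (Fin t → MvPolynomial σ K))
    (hZ : ∀ x ∈ Z, ∀ k, hcV tw k x ∈ Z) :
    ∃ (s : ℕ) (tw' : Fin s → ℤ) (A : Matrix (Fin t) (Fin s) (MvPolynomial σ K)),
      (∀ i j, A i j ∈ hz σ K (tw' j - tw i)) ∧ LinearMap.range A.mulVecLin = Z ∧
      ∀ y ∈ LinearMap.ker A.mulVecLin, ∀ j, coeff 0 (y j) = 0 := by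
  classical
  have hex := cover_exists tw Z hZ
  obtain ⟨g, tw', hg, hspan⟩ := Nat.find_spec hex
  have hmin := fun s hs => Nat.find_min hex (m := s) hs
  generalize Nat.find hex = s at g tw' hg hspan hmin
  have hA : ∀ i j, (Matrix.of fun i j => g j i) i j ∈ hz σ K (tw' j - tw i) := fun i j => hg j i
  refine ⟨s, tw', Matrix.of fun i j => g j i, hA, ?_, ?_⟩
  · rw [← hspan]
    ext x
    rw [LinearMap.mem_range, Submodule.mem_span_range_iff_exists_fun]
    simp only [mulVec_eq_sum]
  · intro y hy j0
    by_contra hc0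
    obtain _ | s := s
    · exact j0.elim0
    apply hmin s (Nat.lt_succ_self s)
    refine ⟨fun j => g (j0.succAbove j), fun j => tw' (j0.succAbove j), fun j => hg _, ?_⟩
    have h1 : (Matrix.of fun i j => g j i).mulVecLin (hcV tw' (tw' j0) y) = 0 := by
      rw [mulVec_hcV hA, LinearMap.mem_ker.1 hy]
      funext i; simp [hcV]
    rw [mulVec_eq_sum, Fin.sum_univ_succAbove _ j0] at h1
    have h2 : hcV tw' (tw' j0) y j0 = C (coeff 0 (y j0)) := by
      ext u
      rw [hcV, coeff_hc, coeff_C, sub_self]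
      by_cases h : u = 0
      · subst h; simp
      · rw [if_neg (by rw [Nat.cast_eq_zero, Finsupp.degree_eq_zero_iff]; exact h), if_neg (Ne.symm h)]
    rw [h2] at h1
    have h3 : g j0 ∈ Submodule.span (MvPolynomial σ K) (Set.range fun j => g (j0.succAbove j)) := by
      have : g j0 = (C (coeff 0 (y j0))⁻¹ : MvPolynomial σ K) • ((C (coeff 0 (y j0)) : MvPolynomial σ K) • g j0) := by
        rw [smul_smul, ← C_mul, inv_mul_cancel₀ hc0, C_1, one_smul]
      rw [this, eq_neg_of_add_eq_zero_left h1]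
      refine Submodule.smul_mem _ _ (Submodule.neg_mem _ (Submodule.sum_mem _ fun j _ => Submodule.smul_mem _ _ ?_))
      exact Submodule.subset_span ⟨j, rfl⟩
    rw [← hspan]
    apply le_antisymm
    · apply Submodule.span_mono
      rintro _ ⟨j, rfl⟩; exact ⟨_, rfl⟩
    · rw [Submodule.span_le]
      rintro _ ⟨j, rfl⟩
      by_cases h : j = j0
      · rw [h]; exact h3
      · obtain ⟨k, rfl⟩ := Fin.exists_succAbove_eq h
        exact Submodule.subset_span ⟨k, rfl⟩

/-- one step of a minimal resolution -/
structure Stage (σ K : Type) [Field K] where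
  t : ℕ
  tw : Fin t → ℤ
  s : ℕ
  tw' : Fin s → ℤ
  A : Matrix (Fin t) (Fin s) (MvPolynomial σ K)
  graded : ∀ i j, A i j ∈ hz σ K (tw' j - tw i)
  kmin : ∀ y ∈ LinearMap.ker A.mulVecLin, ∀ j, coeff 0 (y j) = 0

lemma Stage.ker_graded (S : Stage σ K) : ∀ x ∈ LinearMap.ker S.A.mulVecLin, ∀ k, hcV S.tw' k x ∈ LinearMap.ker S.A.mulVecLin := by
  intro x hx k
  rw [LinearMap.mem_ker] at hx ⊢
  rw [mulVec_hcV S.graded, hx]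
  funext i; simp [hcV]

/-- the next stage -/
noncomputable def Stage.next (S : Stage σ K) : Stage σ K where
  t := S.s
  tw := S.tw'
  s := (cover_min S.tw' _ S.ker_graded).choose
  tw' := (cover_min S.tw' _ S.ker_graded).choose_spec.choose
  A := (cover_min S.tw' _ S.ker_graded).choose_spec.choose_spec.choose
  graded := (cover_min S.tw' _ S.ker_graded).choose_spec.choose_spec.choose_spec.1
  kmin := (cover_min S.tw' _ S.ker_graded).choose_spec.choose_spec.choose_spec.2.2

lemma Stage.next_range (S : Stage σ K) : LinearMap.range S.next.A.mulVecLin = LinearMap.ker S.A.mulVecLin :=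
  (cover_min S.tw' _ S.ker_graded).choose_spec.choose_spec.choose_spec.2.1

/-- iteration -/
noncomputable def Stage.it (S : Stage σ K) : ℕ → Stage σ K
  | 0 => S
  | d + 1 => (S.it d).next

lemma col_mem {t s : ℕ} (A : Matrix (Fin t) (Fin s) (MvPolynomial σ K)) (j : Fin s) :
    (fun i => A i j) ∈ LinearMap.range A.mulVecLin := by
  classical
  refine ⟨Pi.single j 1, ?_⟩
  rw [Matrix.mulVecLin_apply, Matrix.mulVec_single_one]; rfl

theorem exists_preRes (I : Ideal (MvPolynomial σ K)) (hI : ∀ x ∈ I, ∀ k, hc k x ∈ I) (h0 : ∀ x ∈ I, coeff 0 x = 0) :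
    Nonempty (PreRes σ K I) := by
  obtain ⟨s, tw', A, h1, h2, h3⟩ := cover_min (fun _ : Fin 1 => (0:ℤ)) (Submodule.pi Set.univ (fun _ : Fin 1 => I)) (by
    intro x hx k
    rw [Submodule.mem_pi] at hx ⊢
    intro i _
    exact hI _ (hx i trivial) _)
  let S : Stage σ K := ⟨1, fun _ => 0, s, tw', A, h1, h3⟩
  refine ⟨⟨fun d => (S.it d).t, fun d => (S.it d).tw, fun d => (S.it d).A, rfl, fun _ => rfl, ?_, ?_, h2, ?_⟩⟩
  · intro d; exact (S.it d).graded
  · intro d i j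
    cases d with
    | zero =>
      have := col_mem A j
      rw [h2, Submodule.mem_pi] at this
      exact h0 _ (this i trivial)
    | succ d =>
      have := col_mem (S.it d).next.A j
      rw [Stage.next_range] at this
      exact (S.it d).kmin _ this i
  · intro d
    exact (S.it d).next_range

end
end FrameReg

set_option linter.unusedSectionVars false
set_option linter.unusedSimpArgs false
set_option linter.unusedVariables false

namespace FrameReg

/-- the numerical data of a frame -/
structure Shape where
  m : ℤ
  n : ℤ
  a0 : ℤ
  b0 : ℤ
  ak : ℤ
  bk : ℤ
  G1 : ℤ → ℤ
  G2 : ℤ → ℤ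
  mono1 : ∀ i j, i ≤ j → G1 i ≤ G1 j
  mono2 : ∀ i j, i ≤ j → G2 i ≤ G2 j
  h1 : ∀ i, i ≤ a0 → G1 i ≤ 1
  h2 : ∀ i, i ≤ a0 → G2 i = b0
  h3 : ∀ i, a0 < i → b0 < G1 i
  h4 : ∀ i, i < ak → G2 i < bk
  h5 : ∀ i, ak ≤ i → G1 i = bk
  h6 : ∀ i, ak ≤ i → G2 i = n
  h7 : ∀ i, a0 < i → i < ak → G2 i < G1 i
  h8 : ∀ i, a0 ≤ i → i < ak → G2 i < G1 (i + 1)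
  ha : a0 < ak
  hb : b0 < bk
  ham : ak < m
  hbn : bk < n
  hnd : (2 ≤ a0 ∧ 2 ≤ b0) ∨ (a0 = 0 ∧ b0 = 0 ∧ ak = 1 ∧ bk = 1)

lemma exists_max (p : ℤ → ℤ → Prop) (M : ℤ) (hM : ∀ x y, p x y → x - y ≤ M) {x y : ℤ} (h : p x y) :
    ∃ x' y', p x' y' ∧ ∀ x'' y'', p x'' y'' → x'' - y'' ≤ x' - y' := by
  obtain ⟨z, ⟨x', y', h1, h2⟩, h3⟩ := Int.exists_greatest_of_bdd (P := fun z => ∃ x y, p x y ∧ z = x - y)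
    ⟨M, by rintro z ⟨x, y, h, rfl⟩; exact hM x y h⟩ ⟨_, x, y, h, rfl⟩
  exact ⟨x', y', h1, fun x'' y'' h => by rw [← h2]; exact h3 _ ⟨_, _, h, rfl⟩⟩

namespace Shape
variable (S : Shape)

/-- upper part -/
def Vu (x y : ℤ) : Prop := 1 ≤ x ∧ x ≤ S.m ∧ 1 ≤ y ∧ y ≤ S.n ∧ S.G1 x ≤ y
/-- lower part -/
def Vl (x y : ℤ) : Prop := 1 ≤ x ∧ x ≤ S.m ∧ 1 ≤ y ∧ y ≤ S.n ∧ y ≤ S.G2 x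
/-- vertices -/
def V (x y : ℤ) : Prop := S.Vu x y ∨ S.Vl x y
/-- bad pairs -/
def bad (x y x' y' : ℤ) : Prop := x < x' ∧ y' < y ∧ ((S.Vu x y ∧ S.Vu x' y') ∨ (S.Vl x y ∧ S.Vl x' y'))

variable {S}

/-- lower left block -/
lemma VuVl {x y : ℤ} (h : S.Vu x y) (h' : S.Vl x y) :
    (x ≤ S.a0 ∧ y ≤ S.b0) ∨ (S.ak ≤ x ∧ S.bk ≤ y) := by
  obtain ⟨h1, h2, h3, h4, h5⟩ := h
  obtain ⟨-, -, -, -, h6⟩ := h'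
  have e1 := S.h7 x
  have e2 := S.h2 x
  have e3 := S.h5 x
  omega

lemma low_of {x y : ℤ} (h : S.Vu x y) (h' : y ≤ S.b0) : x ≤ S.a0 ∧ S.Vl x y := by
  obtain ⟨h1, h2, h3, h4, h5⟩ := h
  have e1 := S.h3 x
  have e2 := S.h2 x
  refine ⟨by omega, h1, h2, h3, h4, by omega⟩

lemma Vu_low {x y : ℤ} (h1 : 1 ≤ x) (h2 : x ≤ S.a0) (h3 : 1 ≤ y) (h4 : y ≤ S.n) : S.Vu x y := by
  have e1 := S.h1 x
  have := S.ha
  have := S.ham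
  exact ⟨h1, by omega, h3, h4, by omega⟩

lemma Vl_low {x y : ℤ} (h1 : 1 ≤ x) (h2 : x ≤ S.a0) (h3 : 1 ≤ y) (h4 : y ≤ S.b0) : S.Vl x y := by
  have e1 := S.h2 x
  have := S.ha
  have := S.ham
  have := S.hb
  have := S.hbn
  exact ⟨h1, by omega, h3, by omega, by omega⟩

lemma not_Vl_low {x y : ℤ} (h2 : x ≤ S.a0) (h4 : S.b0 < y) : ¬ S.Vl x y := by
  rintro ⟨-, -, -, -, h⟩
  have e1 := S.h2 x
  omega

lemma Vu_high {x y : ℤ} (h1 : 1 ≤ x) (h2 : x ≤ S.m) (h3 : S.bk ≤ y) (h4 : y ≤ S.n) : S.Vu x y := by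
  have e1 := S.h5 (max x S.ak) (by omega)
  have e2 := S.mono1 x (max x S.ak) (by omega)
  have := S.hnd
  have := S.hb
  exact ⟨h1, by omega, by omega, h4, by omega⟩

lemma Vl_high {x y : ℤ} (h1 : S.ak ≤ x) (h2 : x ≤ S.m) (h3 : 1 ≤ y) (h4 : y ≤ S.n) : S.Vl x y := by
  have e1 := S.h6 x (by omega)
  have := S.hnd
  have := S.ha
  exact ⟨by omega, by omega, by omega, h4, by omega⟩

lemma not_Vl_left {x y : ℤ} (h1 : x < S.ak) (h3 : S.bk ≤ y) : ¬ S.Vl x y := by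
  rintro ⟨-, -, -, -, h⟩
  have e1 := S.h4 x
  omega

lemma high_of {x y : ℤ} (h : S.Vu x y) (h' : S.ak ≤ x) : S.bk ≤ y ∧ S.Vl x y := by
  obtain ⟨h1, h2, h3, h4, h5⟩ := h
  have e1 := S.h5 x
  have e2 := S.h6 x
  refine ⟨by omega, h1, h2, h3, h4, by omega⟩

lemma Vu_mono {x y x' y' : ℤ} (h : S.Vu x y) (h1 : x' ≤ x) (h2 : y ≤ y') (h3 : 1 ≤ x') (h4 : y' ≤ S.n) : S.Vu x' y' := by
  obtain ⟨_, _, _, _, _⟩ := h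
  have := S.mono1 x' x h1
  refine ⟨by omega, by omega, by omega, by omega, by omega⟩

lemma Vl_mono {x y x' y' : ℤ} (h : S.Vl x y) (h1 : x ≤ x') (h2 : y' ≤ y) (h3 : x' ≤ S.m) (h4 : 1 ≤ y') : S.Vl x' y' := by
  obtain ⟨_, _, _, _, _⟩ := h
  have := S.mono2 x x' h1
  refine ⟨by omega, by omega, by omega, by omega, by omega⟩

lemma V_bd {x y : ℤ} (h : S.V x y) : 1 ≤ x ∧ x ≤ S.m ∧ 1 ≤ y ∧ y ≤ S.n := by
  rcases h with ⟨_, _, _, _, _⟩ | ⟨_, _, _, _, _⟩ <;> omega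

lemma Vu_bd {x y : ℤ} (h : S.Vu x y) : 1 ≤ x ∧ x ≤ S.m ∧ 1 ≤ y ∧ y ≤ S.n := V_bd (Or.inl h)
lemma Vl_bd {x y : ℤ} (h : S.Vl x y) : 1 ≤ x ∧ x ≤ S.m ∧ 1 ≤ y ∧ y ≤ S.n := V_bd (Or.inr h)

/-- lower only points -/
lemma Lo_bd {x y : ℤ} (h : S.Vl x y) (h' : ¬ S.Vu x y) : S.a0 < x ∧ y < S.bk ∧ 1 ≤ S.a0 ∧ 1 ≤ S.b0 := by
  obtain ⟨h1, h2, h3, h4, h5⟩ := h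
  have : y < S.G1 x := by
    by_contra hc
    exact h' ⟨h1, h2, h3, h4, by omega⟩
  have e1 := S.h1 x
  have e2 := S.h5 (max x S.ak) (by omega)
  have e3 := S.mono1 x (max x S.ak) (by omega)
  have := S.hnd
  omega

/-- upper only points -/
lemma U_bd {x y : ℤ} (h : S.Vu x y) (h' : ¬ S.Vl x y) : x < S.ak ∧ S.b0 < y ∧ 1 ≤ S.a0 ∧ 1 ≤ S.b0 := by
  obtain ⟨h1, h2, h3, h4, h5⟩ := h
  have : S.G2 x < y := by
    by_contra hc
    exact h' ⟨h1, h2, h3, h4, by omega⟩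
  have e1 := S.h6 x
  have e2 := S.h2 (min x S.a0) (by omega)
  have e3 := S.mono2 (min x S.a0) x (by omega)
  have := S.hnd
  omega

lemma bad_or {x y x' y' : ℤ} (h : S.V x y) (h' : S.V x' y') (h1 : x < x') (h2 : y' < y) :
    S.bad x y x' y' ∨ (S.Vu x y ∧ ¬ S.Vl x y ∧ S.Vl x' y' ∧ ¬ S.Vu x' y') := by
  by_cases a1 : S.Vu x y <;> by_cases a2 : S.Vl x y <;> by_cases a3 : S.Vu x' y' <;> by_cases a4 : S.Vl x' y' <;>
    simp only [bad, V, a1, a2, a3, a4, h1, h2, true_and, and_true, false_and, and_false, or_true, true_or, not_true, not_false_eq_true, or_false, false_or] at h h' ⊢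
  -- lower, upper
  exact a1 (Vu_mono a3 (by omega) (by omega) (Vl_bd a2).1 (Vl_bd a2).2.2.2)

/-- a closed pair -/
structure CP (S : Shape) (F β : ℤ → ℤ → Prop) : Prop where
  hβ : ∀ x y, β x y ↔ ∃ x' y', F x' y' ∧ S.bad x y x' y'
  hF : ∀ x y, F x y ↔ S.V x y ∧ ¬ β x y ∧ ∀ x' y', S.bad x' y' x y → β x' y'

namespace CP
variable {F β : ℤ → ℤ → Prop} (c : CP S F β)
include c

lemma no_bad {x y x' y' : ℤ} (h : F x y) (h' : F x' y') : ¬ S.bad x y x' y' := by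
  intro hb
  exact ((c.hF x y).1 h).2.1 ((c.hβ x y).2 ⟨_, _, h', hb⟩)

lemma FV {x y : ℤ} (h : F x y) : S.V x y := ((c.hF x y).1 h).1

lemma P2u {x y x' y' : ℤ} (hf : F x' y') (h1 : x < x') (h2 : y' < y) (hu : S.Vu x y) (hu' : S.Vu x' y') :
    ∃ p q, F p q ∧ S.bad x y p q ∧ ∃ a b, β a b ∧ ∀ p' q', F p' q' → S.bad a b p' q' → p' = p ∧ q' = q := by
  obtain ⟨a, b, ⟨h3, h4, h5, p, q, h6, h7, h8, h9⟩, hmax⟩ := exists_max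
    (fun a b => x ≤ a ∧ b ≤ y ∧ S.Vu a b ∧ ∃ p q, F p q ∧ a < p ∧ q < b ∧ S.Vu p q) S.m
    (by rintro a b ⟨-, -, h, -⟩; have := Vu_bd h; omega) ⟨le_refl x, le_refl y, hu, x', y', hf, h1, h2, hu'⟩
  have hab := Vu_bd h5
  have key : ∀ p q, F p q → a < p → q < b → S.Vu p q → p = a + 1 ∧ q = b - 1 := by
    intro p q h6 h7 h8 h9
    constructor
    · by_contra h
      have := hmax (a + 1) b ⟨by omega, by omega, Vu_mono h9 (by omega) (by omega) (by omega) (by omega),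
        p, q, h6, by omega, by omega, h9⟩
      omega
    · by_contra h
      have := hmax a (b - 1) ⟨by omega, by omega, Vu_mono h9 (by omega) (by omega) (by omega) (by omega),
        p, q, h6, by omega, by omega, h9⟩
      omega
  obtain ⟨rfl, rfl⟩ := key p q h6 h7 h8 h9
  refine ⟨a + 1, b - 1, h6, ⟨by omega, by omega, Or.inl ⟨hu, h9⟩⟩, ?_⟩
  by_cases hlo : ∃ p q, F p q ∧ a < p ∧ q < b ∧ S.Vl p q ∧ S.Vl a b ∧ ¬ S.Vu p q
  · obtain ⟨p, q, g1, g2, g3, g4, g5, g6⟩ := hlo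
    have hlo := Lo_bd g4 g6
    have s1 := S.ha
    have s2 := S.hb
    have s3 := S.ham
    have s4 := S.hbn
    have hpq := Vl_bd g4
    rcases VuVl h5 g5 with ⟨k1, k2⟩ | ⟨k1, k2⟩
    · have hw : S.Vu a (S.b0 + 1) := Vu_low (by omega) (by omega) (by omega) (by omega)
      have hw' : ¬ S.Vl a (S.b0 + 1) := not_Vl_low k1 (by omega)
      refine ⟨a, S.b0 + 1, (c.hβ _ _).2 ⟨_, _, h6, by omega, by omega, Or.inl ⟨hw, h9⟩⟩, ?_⟩
      rintro p' q' hf' ⟨l1, l2, ⟨-, l3⟩ | ⟨l3, -⟩⟩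
      · by_cases hq : q' < b
        · exact key p' q' hf' l1 hq l3
        · exfalso
          obtain ⟨i1, i2⟩ := low_of l3 (by omega)
          exact c.no_bad hf' g1 ⟨by omega, by omega, Or.inr ⟨i2, g4⟩⟩
      · exact absurd l3 hw'
    · have hw : S.Vu (S.ak - 1) b := Vu_high (by omega) (by omega) (by omega) (by omega)
      have hw' : ¬ S.Vl (S.ak - 1) b := not_Vl_left (by omega) k2
      refine ⟨S.ak - 1, b, (c.hβ _ _).2 ⟨_, _, h6, by omega, by omega, Or.inl ⟨hw, h9⟩⟩, ?_⟩
      rintro p' q' hf' ⟨l1, l2, ⟨-, l3⟩ | ⟨l3, -⟩⟩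
      · by_cases hq : a < p'
        · exact key p' q' hf' hq l2 l3
        · exfalso
          obtain ⟨i1, i2⟩ := high_of l3 (by omega)
          exact c.no_bad hf' g1 ⟨by omega, by omega, Or.inr ⟨i2, g4⟩⟩
      · exact absurd l3 hw'
  · refine ⟨a, b, (c.hβ _ _).2 ⟨_, _, h6, by omega, by omega, Or.inl ⟨h5, h9⟩⟩, ?_⟩
    rintro p' q' hf' ⟨l1, l2, ⟨-, l3⟩ | ⟨l3, l4⟩⟩
    · exact key p' q' hf' l1 l2 l3
    · apply key p' q' hf' l1 l2
      by_contra h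
      exact hlo ⟨p', q', hf', l1, l2, l4, l3, h⟩

lemma P2l {x y x' y' : ℤ} (hf : F x' y') (h1 : x < x') (h2 : y' < y) (hu : S.Vl x y) (hu' : S.Vl x' y')
    (hn : ¬ S.Vu x' y') :
    ∃ p q, F p q ∧ S.bad x y p q ∧ ∃ a b, β a b ∧ ∀ p' q', F p' q' → S.bad a b p' q' → p' = p ∧ q' = q := by
  obtain ⟨a, b, ⟨h3, h4, h5, p, q, h6, h7, h8, h9, h10⟩, hmax⟩ := exists_max
    (fun a b => x ≤ a ∧ b ≤ y ∧ S.Vl a b ∧ ∃ p q, F p q ∧ a < p ∧ q < b ∧ S.Vl p q ∧ ¬ S.Vu p q) S.m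
    (by rintro a b ⟨-, -, h, -⟩; have := Vl_bd h; omega) ⟨le_refl x, le_refl y, hu, x', y', hf, h1, h2, hu', hn⟩
  have hab := Vl_bd h5
  have key : ∀ p q, F p q → a < p → q < b → S.Vl p q → ¬ S.Vu p q → p = a + 1 ∧ q = b - 1 := by
    intro p q h6 h7 h8 h9 h10
    have hpq := Vl_bd h9
    constructor
    · by_contra h
      have := hmax (a + 1) b ⟨by omega, by omega, Vl_mono h5 (by omega) (by omega) (by omega) (by omega),
        p, q, h6, by omega, by omega, h9, h10⟩
      omega
    · by_contra h
      have := hmax a (b - 1) ⟨by omega, by omega, Vl_mono h5 (by omega) (by omega) (by omega) (by omega),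
        p, q, h6, by omega, by omega, h9, h10⟩
      omega
  obtain ⟨rfl, rfl⟩ := key p q h6 h7 h8 h9 h10
  have hlo := Lo_bd h9 h10
  refine ⟨a + 1, b - 1, h6, ⟨by omega, by omega, Or.inr ⟨hu, h9⟩⟩, a, b,
    (c.hβ _ _).2 ⟨_, _, h6, by omega, by omega, Or.inr ⟨h5, h9⟩⟩, ?_⟩
  rintro p' q' hf' ⟨l1, l2, l3⟩
  by_cases hB : S.Vu a b ∧ S.Vu p' q'
  · exfalso
    rcases VuVl hB.1 h5 with ⟨k1, k2⟩ | ⟨k1, k2⟩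
    · have := low_of hB.2 (by omega); omega
    · have := high_of hB.2 (by omega); omega
  · simp only [hB, false_or] at l3
    by_cases hv : S.Vu p' q'
    · exact absurd ⟨Vu_mono hv (by omega) (by omega) (by omega) (by omega), hv⟩ hB
    · exact key p' q' hf' l1 l2 l3.2 hv

theorem P2 {x y : ℤ} (hw : β x y) :
    ∃ p q, F p q ∧ S.bad x y p q ∧ ∃ a b, β a b ∧ ∀ p' q', F p' q' → S.bad a b p' q' → p' = p ∧ q' = q := by
  obtain ⟨x', y', hf, h1, h2, ⟨h3, h4⟩ | ⟨h3, h4⟩⟩ := (c.hβ _ _).1 hw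
  · exact c.P2u hf h1 h2 h3 h4
  · by_cases h : S.Vu x' y'
    · exact c.P2u hf h1 h2 (Vu_mono h (by omega) (by omega) (Vl_bd h3).1 (Vl_bd h3).2.2.2) h
    · exact c.P2l hf h1 h2 h3 h4 h

end CP
end Shape
end FrameReg

set_option linter.unusedSectionVars false
set_option linter.unusedSimpArgs false
set_option linter.unusedVariables false

namespace FrameReg

/-- set of a binary predicate -/
def st (A : ℤ → ℤ → Prop) : Set (ℤ × ℤ) := {p | A p.1 p.2}

lemma chain_count (A : ℤ → ℤ → Prop) (x0 y0 x1 y1 : ℤ) (hmin : A x0 y0)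
    (hbd : ∀ x y, A x y → x0 ≤ x ∧ x ≤ x1 ∧ y0 ≤ y ∧ y ≤ y1)
    (hch : ∀ x y x' y', A x y → A x' y' → x < x' → y' < y → False)
    (hsucc : ∀ x y, A x y → ¬ (x = x1 ∧ y = y1) → A (x + 1) y ∨ A x (y + 1)) :
    (st A).Finite ∧ ((st A).ncard : ℤ) = x1 + y1 - x0 - y0 + 1 := by
  have hinj : Set.InjOn (fun p : ℤ × ℤ => p.1 + p.2) (st A) := by
    rintro ⟨x, y⟩ h ⟨x', y'⟩ h' he
    simp only at he
    have h1 := hch x y x' y' h h'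
    have h2 := hch x' y' x y h' h
    rcases lt_trichotomy x x' with h3 | h3 | h3
    · exact (h1 h3 (by omega)).elim
    · exact Prod.ext h3 (by simp only; omega)
    · exact (h2 h3 (by omega)).elim
  have himg : (fun p : ℤ × ℤ => p.1 + p.2) '' (st A) = ((Finset.Icc (x0 + y0) (x1 + y1) : Finset ℤ) : Set ℤ) := by
    ext z
    rw [Finset.coe_Icc, Set.mem_Icc]
    constructor
    · rintro ⟨⟨x, y⟩, h, rfl⟩
      have := hbd x y h
      simp only; omega
    · rintro ⟨h1, h2⟩
      have : ∀ k : ℕ, x0 + y0 + k ≤ x1 + y1 → ∃ x y, A x y ∧ x + y = x0 + y0 + k := by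
        intro k
        induction k with
        | zero => intro _; exact ⟨x0, y0, hmin, by simp⟩
        | succ k ih =>
          intro hk
          push_cast at hk
          obtain ⟨x, y, h, he⟩ := ih (by omega)
          rcases hsucc x y h (by omega) with h' | h'
          · exact ⟨_, _, h', by push_cast; omega⟩
          · exact ⟨_, _, h', by push_cast; omega⟩
      obtain ⟨x, y, h, he⟩ := this (z - (x0 + y0)).toNat (by omega)
      exact ⟨(x, y), h, by simp only; omega⟩
  constructor
  · apply Set.Finite.of_finite_image _ hinj
    rw [himg]; exact Finset.finite_toSet _
  · rw [← Set.ncard_image_of_injOn hinj, himg, Set.ncard_coe_finset, Int.card_Icc]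
    have := hbd _ _ hmin
    omega

namespace Shape
variable {S : Shape}
namespace CP
variable {F β : ℤ → ℤ → Prop} (c : CP S F β)
include c

/-- membership criterion -/
lemma mkF {x y : ℤ} (hV : S.V x y) (h1 : ∀ x' y', F x' y' → S.bad x y x' y' → False)
    (h2 : ∀ x' y', S.bad x' y' x y → ∃ p q, F p q ∧ S.bad x' y' p q) : F x y := by
  refine (c.hF x y).2 ⟨hV, fun h => ?_, fun x' y' h => (c.hβ _ _).2 (h2 x' y' h)⟩
  obtain ⟨x', y', h3, h4⟩ := (c.hβ _ _).1 h
  exact h1 _ _ h3 h4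

lemma cov {x y x' y' : ℤ} (h : F x y) (hb : S.bad x' y' x y) : ∃ p q, F p q ∧ S.bad x' y' p q := ⟨_, _, h, hb⟩

lemma top_mem : F S.m S.n := by
  have a1 := S.ha
  have a2 := S.hb
  have a3 := S.ham
  have a4 := S.hbn
  have a5 := S.hnd
  apply c.mkF (Or.inl (Vu_high (by omega) (by omega) (by omega) (by omega)))
  · rintro x' y' h ⟨h1, -, -⟩
    have := V_bd (c.FV h); omega
  · rintro x' y' ⟨-, h1, h⟩
    have : y' ≤ S.n := by
      rcases h with h | h
      · exact (Vu_bd h.1).2.2.2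
      · exact (Vl_bd h.1).2.2.2
    omega

lemma bot_mem : F 1 1 := by
  have a1 := S.ha
  have a2 := S.hb
  have a3 := S.ham
  have a4 := S.hbn
  have a5 := S.hnd
  have hV : S.V 1 1 := by
    rcases a5 with h | h
    · exact Or.inl (Vu_low (by omega) (by omega) (by omega) (by omega))
    · exact Or.inl (Vu_high (by omega) (by omega) (by omega) (by omega))
  apply c.mkF hV
  · rintro x' y' h ⟨-, h1, -⟩
    have := V_bd (c.FV h); omega
  · rintro x' y' ⟨h1, -, h⟩
    have : 1 ≤ x' := by
      rcases h with h | h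
      · exact (Vu_bd h.1).1
      · exact (Vl_bd h.1).1
    omega

lemma chU {x y x' y' : ℤ} (h : F x y) (h' : F x' y') (hu : S.Vu x' y') (hx : x < x') (hy : y' < y) (hu' : S.Vu x y) : False :=
  c.no_bad h h' ⟨hx, hy, Or.inl ⟨hu', hu⟩⟩

lemma chL {x y x' y' : ℤ} (h : F x y) (h' : F x' y') (hu : S.Vl x' y') (hx : x < x') (hy : y' < y) (hu' : S.Vl x y) : False :=
  c.no_bad h h' ⟨hx, hy, Or.inr ⟨hu', hu⟩⟩

/-- the upper right block -/
def RR (S : Shape) (F : ℤ → ℤ → Prop) (x y : ℤ) : Prop := F x y ∧ S.ak ≤ x ∧ S.bk ≤ y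
/-- the lower left block -/
def LL (S : Shape) (F : ℤ → ℤ → Prop) (x y : ℤ) : Prop := F x y ∧ x ≤ S.a0 ∧ y ≤ S.b0
/-- the upper block -/
def UU (S : Shape) (F : ℤ → ℤ → Prop) (x y : ℤ) : Prop := F x y ∧ S.Vu x y ∧ ¬ S.Vl x y
/-- the lower block -/
def OO (S : Shape) (F : ℤ → ℤ → Prop) (x y : ℤ) : Prop := F x y ∧ S.Vl x y ∧ ¬ S.Vu x y

lemma RR_V {x y : ℤ} (h : RR S F x y) : S.Vu x y ∧ S.Vl x y := by
  have := V_bd (c.FV h.1)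
  exact ⟨Vu_high (by omega) (by omega) h.2.2 (by omega), Vl_high h.2.1 (by omega) (by omega) (by omega)⟩

lemma LL_V {x y : ℤ} (h : LL S F x y) : S.Vu x y ∧ S.Vl x y := by
  have := V_bd (c.FV h.1)
  exact ⟨Vu_low (by omega) h.2.1 (by omega) (by omega), Vl_low (by omega) h.2.1 (by omega) h.2.2⟩

lemma exists_pR : ∃ x y, RR S F x y ∧ ∀ x' y', RR S F x' y' → x ≤ x' ∧ y ≤ y' := by
  obtain ⟨z, ⟨x, y, h, rfl⟩, hz⟩ := Int.exists_least_of_bdd (P := fun z => ∃ x y, RR S F x y ∧ z = x + y)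
    ⟨0, by rintro z ⟨x, y, h, rfl⟩; have := V_bd (c.FV h.1); omega⟩
    ⟨_, S.m, S.n, ⟨c.top_mem, S.ham.le, S.hbn.le⟩, rfl⟩
  refine ⟨x, y, h, fun x' y' h' => ?_⟩
  have := hz _ ⟨x', y', h', rfl⟩
  have h1 := c.RR_V h
  have h2 := c.RR_V h'
  have h3 := c.chU h.1 h'.1 h2.1 (hu' := h1.1)
  have h4 := c.chU h'.1 h.1 h1.1 (hu' := h2.1)
  constructor
  · by_contra hc
    exact h4 (by omega) (by omega)
  · by_contra hc
    exact h3 (by omega) (by omega)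

lemma exists_pL (hnd : 1 ≤ S.a0 ∧ 1 ≤ S.b0) : ∃ x y, LL S F x y ∧ ∀ x' y', LL S F x' y' → x' ≤ x ∧ y' ≤ y := by
  obtain ⟨z, ⟨x, y, h, rfl⟩, hz⟩ := Int.exists_greatest_of_bdd (P := fun z => ∃ x y, LL S F x y ∧ z = x + y)
    ⟨S.a0 + S.b0, by rintro z ⟨x, y, h, rfl⟩; have := h.2; omega⟩
    ⟨_, 1, 1, ⟨c.bot_mem, hnd.1, hnd.2⟩, rfl⟩
  refine ⟨x, y, h, fun x' y' h' => ?_⟩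
  have := hz _ ⟨x', y', h', rfl⟩
  have h1 := c.LL_V h
  have h2 := c.LL_V h'
  have h3 := c.chU h.1 h'.1 h2.1 (hu' := h1.1)
  have h4 := c.chU h'.1 h.1 h1.1 (hu' := h2.1)
  constructor
  · by_contra hc
    exact h3 (by omega) (by omega)
  · by_contra hc
    exact h4 (by omega) (by omega)

lemma countR {p q : ℤ} (hp : RR S F p q) (hmin : ∀ x' y', RR S F x' y' → p ≤ x' ∧ q ≤ y') :
    (st (RR S F)).Finite ∧ ((st (RR S F)).ncard : ℤ) = S.m + S.n - p - q + 1 := by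
  apply chain_count _ p q S.m S.n hp
  · intro x y h
    have := hmin x y h
    have := V_bd (c.FV h.1)
    omega
  · intro x y x' y' h h' h1 h2
    exact c.chU h.1 h'.1 (c.RR_V h').1 h1 h2 (c.RR_V h).1
  · intro x y h hne
    have hV := c.RR_V h
    have bd := V_bd (c.FV h.1)
    have h2 := h.2
    have bds : 1 ≤ S.ak ∧ 1 ≤ S.bk := by
      have := S.hnd; have := S.ha; have := S.hb; omega
    by_cases hr : ∃ x', x < x' ∧ F x' y
    · left
      obtain ⟨x', hx', hf⟩ := hr
      have bd' := V_bd (c.FV hf)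
      refine ⟨?_, by omega, by omega⟩
      have hVf := c.RR_V ⟨hf, by omega, by omega⟩
      apply c.mkF (Or.inl (Vu_high (by omega) (by omega) (by omega) (by omega)))
      · rintro x'' y'' hf' ⟨h1, h2, h3⟩
        refine c.no_bad h.1 hf' ⟨by omega, by omega, ?_⟩
        rcases h3 with h3 | h3
        · exact Or.inl ⟨hV.1, h3.2⟩
        · exact Or.inr ⟨hV.2, h3.2⟩
      · rintro x'' y'' ⟨h1, h2, h3⟩
        by_cases hx : x'' < x
        · refine c.cov h.1 ⟨by omega, by omega, ?_⟩
          rcases h3 with h3 | h3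
          · exact Or.inl ⟨h3.1, hV.1⟩
          · exact Or.inr ⟨h3.1, hV.2⟩
        · refine c.cov hf ⟨by omega, by omega, ?_⟩
          rcases h3 with h3 | h3
          · exact Or.inl ⟨h3.1, hVf.1⟩
          · exact Or.inr ⟨h3.1, hVf.2⟩
    · right
      have hy : y ≠ S.n := by
        intro hy
        apply hr
        refine ⟨S.m, by omega, ?_⟩
        rw [hy]; exact c.top_mem
      refine ⟨?_, by omega, by omega⟩
      apply c.mkF (Or.inl (Vu_high (by omega) (by omega) (by omega) (by omega)))
      · rintro x'' y'' hf' ⟨h1, h2, h3⟩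
        by_cases hy' : y'' = y
        · exact hr ⟨x'', h1, hy' ▸ hf'⟩
        refine c.no_bad h.1 hf' ⟨by omega, by omega, ?_⟩
        rcases h3 with h3 | h3
        · exact Or.inl ⟨hV.1, h3.2⟩
        · exact Or.inr ⟨hV.2, h3.2⟩
      · rintro x'' y'' ⟨h1, h2, h3⟩
        refine c.cov h.1 ⟨by omega, by omega, ?_⟩
        rcases h3 with h3 | h3
        · exact Or.inl ⟨h3.1, hV.1⟩
        · exact Or.inr ⟨h3.1, hV.2⟩

lemma countL (hnd : 1 ≤ S.a0 ∧ 1 ≤ S.b0) {p q : ℤ} (hp : LL S F p q) (hmax : ∀ x' y', LL S F x' y' → x' ≤ p ∧ y' ≤ q) :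
    (st (LL S F)).Finite ∧ ((st (LL S F)).ncard : ℤ) = p + q - 1 - 1 + 1 := by
  have s1 := S.ha
  have s2 := S.hb
  have s3 := S.ham
  have s4 := S.hbn
  apply chain_count _ 1 1 p q ⟨c.bot_mem, hnd.1, hnd.2⟩
  · intro x y h
    have := hmax x y h
    have := V_bd (c.FV h.1)
    omega
  · intro x y x' y' h h' h1 h2
    exact c.chU h.1 h'.1 (c.LL_V h').1 h1 h2 (c.LL_V h).1
  · intro x y h hne
    have hV := c.LL_V h
    have hVp := c.LL_V hp
    have hpp := hp.2
    have bd := V_bd (c.FV h.1)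
    have h2 := h.2
    have hle := hmax x y h
    by_cases hr : ∃ x', x < x' ∧ LL S F x' y
    · left
      obtain ⟨x', hx', hf⟩ := hr
      have h4 := hf.2
      refine ⟨?_, by omega, by omega⟩
      have hVf := c.LL_V hf
      apply c.mkF (Or.inl (Vu_low (by omega) (by omega) (by omega) (by omega)))
      · rintro x'' y'' hf' ⟨h1, h2, h3⟩
        refine c.no_bad h.1 hf' ⟨by omega, by omega, ?_⟩
        rcases h3 with h3 | h3
        · exact Or.inl ⟨hV.1, h3.2⟩
        · exact Or.inr ⟨hV.2, h3.2⟩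
      · rintro x'' y'' ⟨h1, h2, h3⟩
        by_cases hx : x'' < x
        · refine c.cov h.1 ⟨by omega, by omega, ?_⟩
          rcases h3 with h3 | h3
          · exact Or.inl ⟨h3.1, hV.1⟩
          · exact Or.inr ⟨h3.1, hV.2⟩
        · refine c.cov hf.1 ⟨by omega, by omega, ?_⟩
          rcases h3 with h3 | h3
          · exact Or.inl ⟨h3.1, hVf.1⟩
          · exact Or.inr ⟨h3.1, hVf.2⟩
    · right
      have hy : y < q := by
        by_contra hy
        apply hr
        have : y = q := by omega
        subst this
        exact ⟨p, by omega, hp⟩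
      refine ⟨?_, by omega, by omega⟩
      apply c.mkF (Or.inl (Vu_low (by omega) (by omega) (by omega) (by omega)))
      · rintro x'' y'' hf' ⟨h1, h2, h3⟩
        by_cases hy' : y'' = y
        · subst hy'
          by_cases hx'' : x'' ≤ S.a0
          · exact hr ⟨x'', h1, hf', hx'', by omega⟩
          · rcases h3 with h3 | h3
            · exact hx'' (low_of h3.2 (by omega)).1
            · exact c.chL hp.1 hf' h3.2 (by omega) (by omega) hVp.2
        refine c.no_bad h.1 hf' ⟨by omega, by omega, ?_⟩
        rcases h3 with h3 | h3
        · exact Or.inl ⟨hV.1, h3.2⟩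
        · exact Or.inr ⟨hV.2, h3.2⟩
      · rintro x'' y'' ⟨h1, h2, h3⟩
        refine c.cov h.1 ⟨by omega, by omega, ?_⟩
        rcases h3 with h3 | h3
        · exact Or.inl ⟨h3.1, hV.1⟩
        · exact Or.inr ⟨h3.1, hV.2⟩

lemma countU (hnd : 1 ≤ S.a0 ∧ 1 ≤ S.b0) {p q : ℤ} (hp : LL S F p q) (hmax : ∀ x' y', LL S F x' y' → x' ≤ p ∧ y' ≤ q)
    {p' q' : ℤ} (hp' : RR S F p' q') (hmin : ∀ x' y', RR S F x' y' → p' ≤ x' ∧ q' ≤ y') :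
    (st (UU S F)).Finite ∧ ((st (UU S F)).ncard : ℤ) = (S.ak - 1) + q' - p - (S.b0 + 1) + 1 := by
  have s1 := S.ha
  have s2 := S.hb
  have s3 := S.ham
  have s4 := S.hbn
  have hVp := c.LL_V hp
  have hVp' := c.RR_V hp'
  have hpp := hp.2
  have hpp' := hp'.2
  have bdp := V_bd (c.FV hp.1)
  have bdp' := V_bd (c.FV hp'.1)
  have hbdx : ∀ x y, UU S F x y → x < S.ak ∧ S.b0 < y ∧ p ≤ x ∧ y ≤ q' := by
    intro x y h
    have hU := U_bd h.2.1 h.2.2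
    refine ⟨hU.1, hU.2.1, ?_, ?_⟩
    · by_contra hc
      exact c.chU h.1 hp.1 hVp.1 (by omega) (by omega) h.2.1
    · by_contra hc
      exact c.chU h.1 hp'.1 hVp'.1 (by omega) (by omega) h.2.1
  apply chain_count _ p (S.b0 + 1) (S.ak - 1) q'
  · have hu : S.Vu p (S.b0 + 1) := Vu_low (by omega) (by omega) (by omega) (by omega)
    have hl : ¬ S.Vl p (S.b0 + 1) := not_Vl_low (by omega) (by omega)
    refine ⟨c.mkF (Or.inl hu) ?_ ?_, hu, hl⟩
    · rintro x y hf ⟨h1, h2, ⟨-, h3⟩ | ⟨h3, -⟩⟩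
      · have h4 := low_of h3 (by omega)
        have := hmax x y ⟨hf, h4.1, by omega⟩
        omega
      · exact hl h3
    · rintro x y ⟨h1, h2, ⟨h3, -⟩ | ⟨-, h3⟩⟩
      · exact c.cov hp.1 ⟨by omega, by omega, Or.inl ⟨h3, hVp.1⟩⟩
      · exact absurd h3 hl
  · intro x y h
    have := hbdx x y h
    omega
  · intro x y x' y' h h' h1 h2
    exact c.chU h.1 h'.1 h'.2.1 h1 h2 h.2.1
  · intro x y h hne
    have bd := V_bd (c.FV h.1)
    have hb := hbdx x y h
    have hG := h.2.1.2.2.2.2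
    have hG2 : S.G2 x < y := by
      by_contra hc
      exact h.2.2 ⟨by omega, by omega, by omega, by omega, by omega⟩
    by_cases hr : ∃ x', x < x' ∧ F x' y ∧ S.Vu x' y
    · left
      obtain ⟨x', hx', hf, hfu⟩ := hr
      have bd' := Vu_bd hfu
      have hu : S.Vu (x + 1) y := Vu_mono hfu (by omega) (by omega) (by omega) (by omega)
      have hl : ¬ S.Vl (x + 1) y := by
        intro hl
        rcases VuVl hu hl with h3 | h3
        · omega
        · have h4 := high_of hfu (by omega)
          have := hmin x' y ⟨hf, by omega, by omega⟩
          omega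
      refine ⟨c.mkF (Or.inl hu) ?_ ?_, hu, hl⟩
      · rintro x'' y'' hf' ⟨h1, h2, ⟨-, h3⟩ | ⟨h3, -⟩⟩
        · exact c.chU h.1 hf' h3 (by omega) (by omega) h.2.1
        · exact hl h3
      · rintro x'' y'' ⟨h1, h2, ⟨h3, -⟩ | ⟨-, h3⟩⟩
        · by_cases hx : x'' < x
          · exact c.cov h.1 ⟨by omega, by omega, Or.inl ⟨h3, h.2.1⟩⟩
          · exact c.cov hf ⟨by omega, by omega, Or.inl ⟨h3, hfu⟩⟩
        · exact absurd h3 hl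
    · right
      have hy : y ≠ S.n := by
        rintro rfl
        exact hr ⟨S.m, by omega, c.top_mem, Vu_high (by omega) (by omega) (by omega) (by omega)⟩
      have hu : S.Vu x (y + 1) := Vu_mono h.2.1 (by omega) (by omega) (by omega) (by omega)
      have hl : ¬ S.Vl x (y + 1) := by
        rintro ⟨_, _, _, _, _⟩; omega
      refine ⟨c.mkF (Or.inl hu) ?_ ?_, hu, hl⟩
      · rintro x'' y'' hf' ⟨h1, h2, ⟨-, h3⟩ | ⟨h3, -⟩⟩
        · by_cases hy : y'' = y
          · subst hy
            exact hr ⟨x'', h1, hf', h3⟩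
          · exact c.chU h.1 hf' h3 (by omega) (by omega) h.2.1
        · exact hl h3
      · rintro x'' y'' ⟨h1, h2, ⟨h3, -⟩ | ⟨-, h3⟩⟩
        · exact c.cov h.1 ⟨by omega, by omega, Or.inl ⟨h3, h.2.1⟩⟩
        · exact absurd h3 hl

lemma countO (hnd : 1 ≤ S.a0 ∧ 1 ≤ S.b0) {p q : ℤ} (hp : LL S F p q) (hmax : ∀ x' y', LL S F x' y' → x' ≤ p ∧ y' ≤ q)
    {p' q' : ℤ} (hp' : RR S F p' q') (hmin : ∀ x' y', RR S F x' y' → p' ≤ x' ∧ q' ≤ y') :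
    (st (OO S F)).Finite ∧ ((st (OO S F)).ncard : ℤ) = p' + (S.bk - 1) - (S.a0 + 1) - q + 1 := by
  have s1 := S.ha
  have s2 := S.hb
  have s3 := S.ham
  have s4 := S.hbn
  have hVp := c.LL_V hp
  have hVp' := c.RR_V hp'
  have hpp := hp.2
  have hpp' := hp'.2
  have bdp := V_bd (c.FV hp.1)
  have bdp' := V_bd (c.FV hp'.1)
  have hbdx : ∀ x y, OO S F x y → S.a0 < x ∧ y < S.bk ∧ q ≤ y ∧ x ≤ p' := by
    intro x y h
    have hU := Lo_bd h.2.1 h.2.2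
    refine ⟨hU.1, hU.2.1, ?_, ?_⟩
    · by_contra hc
      exact c.chL hp.1 h.1 h.2.1 (by omega) (by omega) hVp.2
    · by_contra hc
      exact c.chL hp'.1 h.1 h.2.1 (by omega) (by omega) hVp'.2
  have hMax : OO S F p' (S.bk - 1) := by
    have hl : S.Vl p' (S.bk - 1) := Vl_high (by omega) (by omega) (by omega) (by omega)
    have hu : ¬ S.Vu p' (S.bk - 1) := by
      rintro ⟨_, _, _, _, h⟩
      have := S.h5 p' (by omega); omega
    refine ⟨c.mkF (Or.inr hl) ?_ ?_, hl, hu⟩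
    · rintro x y hf ⟨h1, h2, ⟨h3, -⟩ | ⟨-, h3⟩⟩
      · exact hu h3
      · exact c.chL hp'.1 hf h3 (by omega) (by omega) hVp'.2
    · rintro x y ⟨h1, h2, ⟨-, h3⟩ | ⟨h3, -⟩⟩
      · exact absurd h3 hu
      · by_cases hy : q' < y
        · exact c.cov hp'.1 ⟨by omega, by omega, Or.inr ⟨h3, hVp'.2⟩⟩
        · have bd3 := Vl_bd h3
          have hx : S.ak ≤ x := by
            by_contra hc
            exact not_Vl_left (by omega) (by omega) h3
          have hxy : S.Vu x y := Vu_high (by omega) (by omega) (by omega) (by omega)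
          by_contra hno
          have hF : F x q' := by
            apply c.mkF (Or.inl (Vu_high (by omega) (by omega) (by omega) (by omega)))
            · rintro x'' y'' hf ⟨k1, k2, k3⟩
              have bd4 := V_bd (c.FV hf)
              by_cases hy2 : y'' < y
              · apply hno
                refine c.cov hf ⟨by omega, by omega, ?_⟩
                rcases k3 with k3 | k3
                · exact Or.inl ⟨hxy, k3.2⟩
                · exact Or.inr ⟨h3, k3.2⟩
              · have := hmin x'' y'' ⟨hf, by omega, by omega⟩
                omega
            · rintro x'' y'' ⟨k1, k2, k3⟩
              refine c.cov hp'.1 ⟨by omega, by omega, ?_⟩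
              rcases k3 with k3 | k3
              · exact Or.inl ⟨k3.1, hVp'.1⟩
              · exact Or.inr ⟨k3.1, hVp'.2⟩
          have := hmin x q' ⟨hF, by omega, by omega⟩
          omega
  apply chain_count _ (S.a0 + 1) q p' (S.bk - 1)
  · have hl : S.Vl (S.a0 + 1) q := Vl_mono hVp.2 (by omega) (by omega) (by omega) (by omega)
    have hu : ¬ S.Vu (S.a0 + 1) q := by
      rintro ⟨_, _, _, _, h⟩
      have := S.h3 (S.a0 + 1) (by omega); omega
    refine ⟨c.mkF (Or.inr hl) ?_ ?_, hl, hu⟩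
    · rintro x y hf ⟨h1, h2, ⟨h3, -⟩ | ⟨-, h3⟩⟩
      · exact hu h3
      · exact c.chL hp.1 hf h3 (by omega) (by omega) hVp.2
    · rintro x y ⟨h1, h2, ⟨-, h3⟩ | ⟨h3, -⟩⟩
      · exact absurd h3 hu
      · by_cases hx : x < p
        · exact c.cov hp.1 ⟨by omega, by omega, Or.inr ⟨h3, hVp.2⟩⟩
        · have bd3 := Vl_bd h3
          have hy : y ≤ S.b0 := by
            by_contra hc
            exact not_Vl_low (by omega) (by omega) h3
          have hxy : S.Vu x y := Vu_low (by omega) (by omega) (by omega) (by omega)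
          by_contra hno
          have hF : F p y := by
            apply c.mkF (Or.inl (Vu_low (by omega) (by omega) (by omega) (by omega)))
            · rintro x'' y'' hf ⟨k1, k2, k3⟩
              by_cases hx2 : x < x''
              · apply hno
                refine c.cov hf ⟨by omega, by omega, ?_⟩
                rcases k3 with k3 | k3
                · exact Or.inl ⟨hxy, k3.2⟩
                · exact Or.inr ⟨h3, k3.2⟩
              · have := hmax x'' y'' ⟨hf, by omega, by omega⟩
                omega
            · rintro x'' y'' ⟨k1, k2, k3⟩
              refine c.cov hp.1 ⟨by omega, by omega, ?_⟩
              rcases k3 with k3 | k3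
              · exact Or.inl ⟨k3.1, hVp.1⟩
              · exact Or.inr ⟨k3.1, hVp.2⟩
          have := hmax p y ⟨hF, by omega, by omega⟩
          omega
  · intro x y h
    have := hbdx x y h
    omega
  · intro x y x' y' h h' h1 h2
    exact c.chL h.1 h'.1 h'.2.1 h1 h2 h.2.1
  · intro x y h hne
    have bd := V_bd (c.FV h.1)
    have hb := hbdx x y h
    have hG2 := h.2.1.2.2.2.2
    have hG : y < S.G1 x := by
      by_contra hc
      exact h.2.2 ⟨by omega, by omega, by omega, by omega, by omega⟩
    have hright : x < S.m → S.Vl (x + 1) y ∧ ¬ S.Vu (x + 1) y := by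
      intro hx
      refine ⟨Vl_mono h.2.1 (by omega) (by omega) (by omega) (by omega), ?_⟩
      rintro ⟨_, _, _, _, _⟩
      have := S.mono1 x (x + 1) (by omega)
      omega
    by_cases hr : ∃ x', x < x' ∧ F x' y ∧ S.Vl x' y
    · left
      obtain ⟨x', hx', hf, hfl⟩ := hr
      have bd' := Vl_bd hfl
      obtain ⟨hl, hu⟩ := hright (by omega)
      refine ⟨c.mkF (Or.inr hl) ?_ ?_, hl, hu⟩
      · rintro x'' y'' hf' ⟨h1, h2, ⟨h3, -⟩ | ⟨-, h3⟩⟩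
        · exact hu h3
        · exact c.chL h.1 hf' h3 (by omega) (by omega) h.2.1
      · rintro x'' y'' ⟨h1, h2, ⟨-, h3⟩ | ⟨h3, -⟩⟩
        · exact absurd h3 hu
        · by_cases hx : x'' < x
          · exact c.cov h.1 ⟨by omega, by omega, Or.inr ⟨h3, h.2.1⟩⟩
          · exact c.cov hf ⟨by omega, by omega, Or.inr ⟨h3, hfl⟩⟩
    · by_cases hup : S.Vl x (y + 1)
      · right
        have hu : ¬ S.Vu x (y + 1) := by
          intro hu
          rcases VuVl hu hup with h3 | h3
          · omega
          · apply hr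
            have : y = S.bk - 1 := by omega
            subst this
            exact ⟨p', by omega, hMax.1, hMax.2.1⟩
        refine ⟨c.mkF (Or.inr hup) ?_ ?_, hup, hu⟩
        · rintro x'' y'' hf' ⟨h1, h2, ⟨h3, -⟩ | ⟨-, h3⟩⟩
          · exact hu h3
          · by_cases hy : y'' = y
            · subst hy
              exact hr ⟨x'', h1, hf', h3⟩
            · exact c.chL h.1 hf' h3 (by omega) (by omega) h.2.1
        · rintro x'' y'' ⟨h1, h2, ⟨-, h3⟩ | ⟨h3, -⟩⟩
          · exact absurd h3 hu
          · exact c.cov h.1 ⟨by omega, by omega, Or.inr ⟨h3, h.2.1⟩⟩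
      · left
        have hy : S.G2 x < y + 1 := by
          by_contra hc
          exact hup ⟨by omega, by omega, by omega, by omega, by omega⟩
        have hxak : x < S.ak := by
          by_contra hc
          have := S.h6 x (by omega); omega
        obtain ⟨hl, hu⟩ := hright (by omega)
        refine ⟨c.mkF (Or.inr hl) ?_ ?_, hl, hu⟩
        · rintro x'' y'' hf' ⟨h1, h2, ⟨h3, -⟩ | ⟨-, h3⟩⟩
          · exact hu h3
          · exact c.chL h.1 hf' h3 (by omega) (by omega) h.2.1
        · rintro x'' y'' ⟨h1, h2, ⟨-, h3⟩ | ⟨h3, -⟩⟩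
          · exact absurd h3 hu
          · exfalso
            have := S.mono2 x'' x (by omega)
            have := h3.2.2.2.2
            omega

/-- purity -/
theorem purity : ((st F).ncard : ℤ) = if 1 ≤ S.a0 then S.ak - S.b0 + S.bk - S.a0 + S.m + S.n - 2 else S.m + S.n - 1 := by
  have s1 := S.ha
  have s2 := S.hb
  have s3 := S.hnd
  have hsub : ∀ x y, F x y → LL S F x y ∨ RR S F x y ∨ UU S F x y ∨ OO S F x y := by
    intro x y h
    have hV := c.FV h
    by_cases a : S.Vu x y <;> by_cases b : S.Vl x y
    · rcases VuVl a b with h1 | h1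
      · exact Or.inl ⟨h, h1⟩
      · exact Or.inr (Or.inl ⟨h, h1⟩)
    · exact Or.inr (Or.inr (Or.inl ⟨h, a, b⟩))
    · exact Or.inr (Or.inr (Or.inr ⟨h, b, a⟩))
    · exact absurd hV (by simp [V, a, b])
  obtain ⟨p', q', hp', hmin⟩ := c.exists_pR
  have cR := c.countR hp' hmin
  split_ifs with hnd
  · obtain ⟨p, q, hp, hmax⟩ := c.exists_pL (by omega)
    have cL := c.countL (by omega) hp hmax
    have cU := c.countU (by omega) hp hmax hp' hmin
    have cO := c.countO (by omega) hp hmax hp' hmin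
    have e : st F = ((st (LL S F) ∪ st (RR S F)) ∪ st (UU S F)) ∪ st (OO S F) := by
      ext ⟨x, y⟩
      constructor
      · intro h
        rcases hsub x y h with h | h | h | h
        · exact Or.inl (Or.inl (Or.inl h))
        · exact Or.inl (Or.inl (Or.inr h))
        · exact Or.inl (Or.inr h)
        · exact Or.inr h
      · rintro (((h | h) | h) | h)
        · exact h.1
        · exact h.1
        · exact h.1
        · exact h.1
    have d1 : Disjoint (st (LL S F)) (st (RR S F)) := by
      rw [Set.disjoint_left]
      rintro ⟨x, y⟩ h1 h2
      have := h1.2.1; have := h2.2.1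
      simp only at *
      omega
    have d2 : Disjoint (st (LL S F) ∪ st (RR S F)) (st (UU S F)) := by
      rw [Set.disjoint_left]
      rintro ⟨x, y⟩ (h1 | h1) h2
      · exact h2.2.2 (c.LL_V h1).2
      · exact h2.2.2 (c.RR_V h1).2
    have d3 : Disjoint ((st (LL S F) ∪ st (RR S F)) ∪ st (UU S F)) (st (OO S F)) := by
      rw [Set.disjoint_left]
      rintro ⟨x, y⟩ ((h1 | h1) | h1) h2
      · exact h2.2.2 (c.LL_V h1).1
      · exact h2.2.2 (c.RR_V h1).1
      · exact h2.2.2 h1.2.1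
    rw [e, Set.ncard_union_eq d3 ((cL.1.union cR.1).union cU.1) cO.1,
      Set.ncard_union_eq d2 (cL.1.union cR.1) cU.1, Set.ncard_union_eq d1 cL.1 cR.1]
    push_cast
    rw [cL.2, cR.2, cU.2, cO.2]; ring
  · have e : st F = st (RR S F) := by
      ext ⟨x, y⟩
      constructor
      · intro h
        have bd := V_bd (c.FV h)
        rcases hsub x y h with h | h | h | h
        · have := h.2; omega
        · exact h
        · have := U_bd h.2.1 h.2.2; omega
        · have := Lo_bd h.2.1 h.2.2; omega
      · exact fun h => h.1
    have h1 := hmin 1 1 ⟨c.bot_mem, by omega, by omega⟩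
    have h2 := hp'.2
    rw [e, cR.2]
    omega

end CP
end Shape
end FrameReg

set_option linter.unusedSectionVars false
set_option linter.unusedSimpArgs false
set_option linter.unusedVariables false

namespace FrameReg
namespace Shape
variable {S : Shape}

/-- cells of the frame -/
def cell (S : Shape) (x y : ℤ) : Prop :=
  1 ≤ x ∧ x < S.m ∧ 1 ≤ y ∧ y < S.n ∧ ¬ (S.G2 x ≤ y ∧ y < S.G1 (x + 1))

lemma cell_of_bad {x y x' y' c d : ℤ} (h : S.bad x y x' y') (h1 : x ≤ c) (h2 : c < x') (h3 : y' ≤ d)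
    (h4 : d < y) : S.cell c d := by
  obtain ⟨k1, k2, ⟨⟨_, _, _, _, _⟩, ⟨_, _, _, _, _⟩⟩ | ⟨⟨_, _, _, _, _⟩, ⟨_, _, _, _, _⟩⟩⟩ := h
  · have := S.mono1 (c + 1) x' (by omega)
    refine ⟨by omega, by omega, by omega, by omega, by omega⟩
  · have := S.mono2 x c (by omega)
    refine ⟨by omega, by omega, by omega, by omega, by omega⟩

lemma bad_of_cells {x y x' y' : ℤ} (hw : S.V x y) (hq : S.V x' y') (h1 : x < x') (h2 : y' < y)
    (hc : ∀ c d, x ≤ c → c < x' → y' ≤ d → d < y → S.cell c d) : S.bad x y x' y' := by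
  rcases bad_or hw hq h1 h2 with h | ⟨a1, a2, a3, a4⟩
  · exact h
  exfalso
  have u1 := U_bd a1 a2
  have u2 := Lo_bd a3 a4
  have g1 : S.G2 x < y := by
    by_contra h
    exact a2 ⟨a1.1, a1.2.1, a1.2.2.1, a1.2.2.2.1, by omega⟩
  have g2 : y' < S.G1 x' := by
    by_contra h
    exact a4 ⟨a3.1, a3.2.1, a3.2.2.1, a3.2.2.2.1, by omega⟩
  obtain ⟨s, ⟨s1, s2, s3⟩, s4⟩ := Int.exists_least_of_bdd (P := fun s => x ≤ s ∧ s < x' ∧ y' < S.G1 (s + 1))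
    ⟨x, fun z hz => hz.1⟩ ⟨x' - 1, by omega, by omega, by simpa using g2⟩
  have bq := Vl_bd a3
  have s5 : S.a0 ≤ s := by
    by_contra h
    have := S.h1 (s + 1) (by omega)
    omega
  have s6 : x < s → S.G1 s ≤ y' := by
    intro h
    by_contra h'
    have := s4 (s - 1) ⟨by omega, by omega, by rw [sub_add_cancel]; omega⟩
    omega
  have s7 : s < S.ak := by
    by_contra h
    have e := S.h5 s (by omega)
    have := s6 (by omega)
    omega
  have s8 := S.h8 s s5 s7
  have s9 : S.G2 s < y := by
    by_cases e : x = s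
    · rw [← e]; exact g1
    · have := s6 (by omega)
      by_cases e' : s = S.a0
      · have := S.h2 s (by omega)
        omega
      · have := S.h7 s (by omega) s7
        omega
  have := (hc s (max (S.G2 s) y') s1 s2 (by omega) (by omega)).2.2.2.2
  omega

lemma V_iff (x y : ℤ) : S.V x y ↔ ∃ c d, S.cell c d ∧ (x = c ∨ x = c + 1) ∧ (y = d ∨ y = d + 1) := by
  have s1 := S.ha
  have s2 := S.hb
  have s3 := S.ham
  have s4 := S.hbn
  have s5 := S.hnd
  constructor
  · rintro (⟨h1, h2, h3, h4, h5⟩ | ⟨h1, h2, h3, h4, h5⟩)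
    · refine ⟨max (x - 1) 1, min y (S.n - 1), ⟨by omega, by omega, by omega, by omega, ?_⟩, by omega, by omega⟩
      have e1 := S.h5 (max x S.ak) (by omega)
      have e2 := S.mono1 x (max x S.ak) (by omega)
      have e3 := S.h1 2
      have e4 := S.h6 1
      have e5 := S.mono1 x x
      by_cases hx : x = 1
      · subst hx
        have : max ((1 : ℤ) - 1) 1 = 1 := by omega
        rw [this]
        have e : (1 : ℤ) + 1 = 2 := rfl
        rw [e]
        omega
      · have : max (x - 1) 1 = x - 1 := by omega
        rw [this, sub_add_cancel]
        omega
    · refine ⟨min x (S.m - 1), max (y - 1) 1, ⟨by omega, by omega, by omega, by omega, ?_⟩, by omega, by omega⟩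
      have e4 := S.h6 (min x (S.m - 1))
      have e6 := S.h2 (min x S.a0) (by omega)
      have e7 := S.mono2 (min x S.a0) x (by omega)
      by_cases hx : x = S.m
      · omega
      · have : min x (S.m - 1) = x := by omega
        rw [this] at e4 ⊢
        omega
  · rintro ⟨c, d, ⟨h1, h2, h3, h4, h5⟩, h6, h7⟩
    have e1 := S.mono1 x (c + 1) (by omega)
    have e2 := S.mono2 c x (by omega)
    by_cases h : d < S.G2 c
    · exact Or.inr ⟨by omega, by omega, by omega, by omega, by omega⟩
    · exact Or.inl ⟨by omega, by omega, by omega, by omega, by omega⟩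

lemma cell_bad {x y : ℤ} (h : S.cell x y) : S.bad x (y + 1) (x + 1) y := by
  obtain ⟨h1, h2, h3, h4, h5⟩ := h
  have e1 := S.mono1 x (x + 1) (by omega)
  have e2 := S.mono2 x (x + 1) (by omega)
  refine ⟨by omega, by omega, ?_⟩
  by_cases h : y < S.G2 x
  · exact Or.inr ⟨⟨by omega, by omega, by omega, by omega, by omega⟩, ⟨by omega, by omega, by omega, by omega, by omega⟩⟩
  · exact Or.inl ⟨⟨by omega, by omega, by omega, by omega, by omega⟩, ⟨by omega, by omega, by omega, by omega, by omega⟩⟩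

lemma bad_V {x y x' y' : ℤ} (h : S.bad x y x' y') : S.V x y ∧ S.V x' y' := by
  obtain ⟨_, _, ⟨h1, h2⟩ | ⟨h1, h2⟩⟩ := h
  · exact ⟨Or.inl h1, Or.inl h2⟩
  · exact ⟨Or.inr h1, Or.inr h2⟩

/-- attacking cells -/
def att (S : Shape) (c d : ℤ × ℤ) : Prop :=
  (c.2 = d.2 ∧ ∀ x, min c.1 d.1 ≤ x → x ≤ max c.1 d.1 → S.cell x c.2) ∨
   (c.1 = d.1 ∧ ∀ y, min c.2 d.2 ≤ y → y ≤ max c.2 d.2 → S.cell c.1 y)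

/-- rook configurations -/
def Conf (S : Shape) (R : Finset (ℤ × ℤ)) : Prop :=
  (∀ c ∈ R, S.cell c.1 c.2) ∧ ∀ c ∈ R, ∀ d ∈ R, c ≠ d → ¬ S.att c d

lemma att_symm {c d : ℤ × ℤ} (h : S.att c d) : S.att d c := by
  rcases h with ⟨h1, h2⟩ | ⟨h1, h2⟩
  · refine Or.inl ⟨h1.symm, fun x hx hx' => ?_⟩
    rw [← h1]; exact h2 x (by omega) (by omega)
  · refine Or.inr ⟨h1.symm, fun x hx hx' => ?_⟩
    rw [← h1]; exact h2 x (by omega) (by omega)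

/-- witness for a facet element -/
def wit (S : Shape) (F β : ℤ → ℤ → Prop) (p q a b : ℤ) : Prop :=
  β a b ∧ ∀ p' q', F p' q' → S.bad a b p' q' → p' = p ∧ q' = q

/-- best witness -/
def best (S : Shape) (F β : ℤ → ℤ → Prop) (p q a b : ℤ) : Prop :=
  S.wit F β p q a b ∧ ∀ a' b', S.wit F β p q a' b' → a' - b' ≤ a - b

namespace CP
variable {F β : ℤ → ℤ → Prop} (cp : CP S F β)
include cp

lemma wit_bad {p q a b : ℤ} (h : S.wit F β p q a b) : F p q ∧ S.bad a b p q := by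
  obtain ⟨x, y, h1, h2⟩ := (cp.hβ _ _).1 h.1
  obtain ⟨rfl, rfl⟩ := h.2 x y h1 h2
  exact ⟨h1, h2⟩

lemma best_down {p q a b : ℤ} (h : S.best F β p q a b) (hl : S.Vl a b) (hq : S.Vl p q) : q = b - 1 := by
  obtain ⟨h1, h2⟩ := cp.wit_bad h.1
  have bq := Vl_bd hq
  have bw := Vl_bd hl
  obtain ⟨k1, k2, -⟩ := h2
  by_contra hn
  have := h.2 a (b - 1) ⟨(cp.hβ _ _).2 ⟨p, q, h1, by omega, by omega,
    Or.inr ⟨Vl_mono hl (by omega) (by omega) (by omega) (by omega), hq⟩⟩, ?_⟩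
  · omega
  · rintro p' q' hf ⟨l1, l2, ⟨l3, l4⟩ | ⟨l3, l4⟩⟩
    · exact h.1.2 p' q' hf ⟨by omega, by omega, Or.inl ⟨Vu_mono l3 (by omega) (by omega) (by omega) (by omega), l4⟩⟩
    · exact h.1.2 p' q' hf ⟨by omega, by omega, Or.inr ⟨hl, l4⟩⟩

lemma best_right {p q a b : ℤ} (h : S.best F β p q a b) (hl : S.Vl a b) (hq : S.Vl p q) : p = a + 1 := by
  obtain ⟨h1, h2⟩ := cp.wit_bad h.1
  have bq := Vl_bd hq
  have bw := Vl_bd hl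
  obtain ⟨k1, k2, -⟩ := h2
  by_contra hn
  have := h.2 (a + 1) b ⟨(cp.hβ _ _).2 ⟨p, q, h1, by omega, by omega,
    Or.inr ⟨Vl_mono hl (by omega) (by omega) (by omega) (by omega), hq⟩⟩, ?_⟩
  · omega
  · rintro p' q' hf ⟨l1, l2, ⟨l3, l4⟩ | ⟨l3, l4⟩⟩
    · exact h.1.2 p' q' hf ⟨by omega, by omega, Or.inl ⟨Vu_mono l3 (by omega) (by omega) (by omega) (by omega), l4⟩⟩
    · exact h.1.2 p' q' hf ⟨by omega, by omega, Or.inr ⟨hl, l4⟩⟩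

lemma row {p q a b p' q' a' : ℤ} (h : S.best F β p q a b) (h' : S.best F β p' q' a' b) (ha : a < a')
    (hne : ¬ (p' = p ∧ q' = q)) (hc : ∀ x, a ≤ x → x ≤ a' → S.cell x (b - 1)) : False := by
  obtain ⟨f1, f2⟩ := cp.wit_bad h.1
  obtain ⟨f1', f2'⟩ := cp.wit_bad h'.1
  have hnb : ¬ S.bad a b p' q' := fun hb => hne (h.1.2 _ _ f1' hb)
  obtain ⟨k1, k2, k3⟩ := id f2'
  rcases bad_or (bad_V f2).1 (bad_V f2').2 (by omega) (by omega) with g | ⟨g1, g2, g3, g4⟩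
  · exact hnb g
  simp only [g4, and_false, false_or] at k3
  have hq := cp.best_down h' k3.1 g3
  have u1 := U_bd g1 g2
  have u2 := Lo_bd g3 g4
  have e1 : S.G2 a < b := by
    by_contra h
    exact g2 ⟨g1.1, g1.2.1, g1.2.2.1, g1.2.2.2.1, by omega⟩
  have e2 := k3.1.2.2.2.2
  obtain ⟨s, ⟨s1, s2, s3⟩, s4⟩ := Int.exists_least_of_bdd (P := fun s => a ≤ s ∧ s ≤ a' ∧ b ≤ S.G2 s)
    ⟨a, fun z hz => hz.1⟩ ⟨a', by omega, by omega, e2⟩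
  have hs : a ≠ s := by
    rintro rfl
    omega
  have s5 : S.G2 (s - 1) < b := by
    by_contra hh
    have := s4 (s - 1) ⟨by omega, by omega, by omega⟩
    omega
  have hcell := hc (s - 1) (by omega) (by omega)
  obtain ⟨c1, c2, c3, c4, c5⟩ := hcell
  rw [sub_add_cancel] at c5
  have bb := Vl_bd k3.1
  have bw := Vu_bd g1
  rcases VuVl (S := S) (x := s) (y := b) ⟨by omega, by omega, by omega, by omega, by omega⟩
    ⟨by omega, by omega, by omega, by omega, by omega⟩ with ⟨v1, v2⟩ | ⟨v1, v2⟩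
  · omega
  · have := S.h5 s v1
    omega

lemma col {p q a b p' q' b' : ℤ} (h : S.best F β p q a b) (h' : S.best F β p' q' a b') (hb : b < b')
    (hne : ¬ (p' = p ∧ q' = q)) (hc : ∀ y, b - 1 ≤ y → y ≤ b' - 1 → S.cell a y) : False := by
  obtain ⟨f1, f2⟩ := cp.wit_bad h.1
  obtain ⟨f1', f2'⟩ := cp.wit_bad h'.1
  have hnb : ¬ S.bad a b' p q := fun hb => hne (by
    obtain ⟨e1, e2⟩ := h'.1.2 _ _ f1 hb
    exact ⟨e1.symm, e2.symm⟩)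
  obtain ⟨k1, k2, k3⟩ := id f2
  rcases bad_or (bad_V f2').1 (bad_V f2).2 (by omega) (by omega) with g | ⟨g1, g2, g3, g4⟩
  · exact hnb g
  simp only [g4, and_false, false_or] at k3
  have hp := cp.best_right h k3.1 g3
  have u1 := U_bd g1 g2
  have u2 := Lo_bd g3 g4
  have e1 : S.G2 a < b' := by
    by_contra h
    exact g2 ⟨g1.1, g1.2.1, g1.2.2.1, g1.2.2.2.1, by omega⟩
  have e2 := k3.1.2.2.2.2
  have e3 := S.h8 a (by omega) (by omega)
  have := (hc (S.G2 a) (by omega) (by omega)).2.2.2.2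
  omega

lemma no_att {p q a b p' q' a' b' : ℤ} (h : S.best F β p q a b) (h' : S.best F β p' q' a' b')
    (hne : ¬ (p' = p ∧ q' = q)) : (a, b - 1) ≠ (a', b' - 1) ∧ ¬ S.att (a, b - 1) (a', b' - 1) := by
  have hne' : ¬ (p = p' ∧ q = q') := fun h => hne ⟨h.1.symm, h.2.symm⟩
  have hd : (a, b - 1) ≠ (a', b' - 1) := by
    intro e
    simp only [Prod.mk.injEq] at e
    obtain ⟨rfl, e⟩ := e
    obtain rfl : b = b' := by omega
    obtain ⟨f1, f2⟩ := cp.wit_bad h'.1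
    exact hne (h.1.2 _ _ f1 f2)
  refine ⟨hd, ?_⟩
  rintro (⟨h1, h2⟩ | ⟨h1, h2⟩)
  · simp only at h1 h2
    obtain rfl : b = b' := by omega
    rcases lt_trichotomy a a' with e | e | e
    · exact cp.row h h' e hne fun x h1 h3 => h2 x (by omega) (by omega)
    · subst e; exact hd rfl
    · exact cp.row h' h e hne' fun x h1 h3 => h2 x (by omega) (by omega)
  · simp only at h1 h2
    subst h1
    rcases lt_trichotomy b b' with e | e | e
    · exact cp.col h h' e hne fun x h1 h3 => h2 x (by omega) (by omega)
    · subst e; exact hd rfl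
    · exact cp.col h' h e hne' fun x h1 h3 => h2 x (by omega) (by omega)

theorem rook_ge (Q : Finset (ℤ × ℤ)) (hQ : ∀ q ∈ Q, ∃ a b, S.wit F β q.1 q.2 a b) :
    ∃ R, S.Conf R ∧ R.card = Q.card := by
  have hb : ∀ q : ℤ × ℤ, q ∈ Q → ∃ w : ℤ × ℤ, S.best F β q.1 q.2 w.1 w.2 := by
    intro q hq
    obtain ⟨a, b, h⟩ := hQ q hq
    obtain ⟨x, y, h1, h2⟩ := exists_max (S.wit F β q.1 q.2) S.m
      (by
        intro x y h
        have := V_bd (bad_V (cp.wit_bad h).2).1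
        omega) h
    exact ⟨(x, y), h1, h2⟩
  choose! w hw using hb
  refine ⟨Q.image (fun q => ((w q).1, (w q).2 - 1)), ⟨?_, ?_⟩, ?_⟩
  · intro c hc
    simp only [Finset.mem_image] at hc
    obtain ⟨q, hq, rfl⟩ := hc
    have := (cp.wit_bad (hw q hq).1).2
    obtain ⟨k1, k2, -⟩ := id this
    exact cell_of_bad this (by simp) (by simpa using k1) (by simp only; omega) (by simp)
  · intro c hc d hd hcd
    simp only [Finset.mem_image] at hc hd
    obtain ⟨q, hq, rfl⟩ := hc
    obtain ⟨q', hq', rfl⟩ := hd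
    refine (cp.no_att (hw q hq) (hw q' hq') ?_).2
    rintro ⟨e1, e2⟩
    apply hcd
    have : q' = q := Prod.ext e1 e2
    rw [this]
  · rw [Finset.card_image_of_injOn]
    intro q hq q' hq' e
    by_contra hne
    exact (cp.no_att (hw q hq) (hw q' hq') (by
      rintro ⟨e1, e2⟩
      exact hne (Prod.ext e1.symm e2.symm))).1 e

end CP

/-- weight of a configuration -/
def wt (R : Finset (ℤ × ℤ)) : ℤ := ∑ c ∈ R, (c.1 + c.2) ^ 2

lemma exists_conf_max {k : ℕ} (R : Finset (ℤ × ℤ)) (hR : S.Conf R) (hk : R.card = k) :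
    ∃ R, S.Conf R ∧ R.card = k ∧ ∀ R', S.Conf R' → R'.card = k → wt R' ≤ wt R := by
  classical
  let T := ((Finset.Icc (1 : ℤ) S.m ×ˢ Finset.Icc (1 : ℤ) S.n).powerset).filter (fun R => S.Conf R ∧ R.card = k)
  have hT : ∀ R, R ∈ T ↔ S.Conf R ∧ R.card = k := by
    intro R
    simp only [T, Finset.mem_filter, Finset.mem_powerset, and_iff_right_iff_imp]
    rintro ⟨h, -⟩ c hc
    obtain ⟨h1, h2, h3, h4, -⟩ := h.1 c hc
    simp only [Finset.mem_product, Finset.mem_Icc]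
    omega
  obtain ⟨R', h1, h2⟩ := Finset.exists_max_image T wt ⟨R, (hT R).2 ⟨hR, hk⟩⟩
  exact ⟨R', ((hT _).1 h1).1, ((hT _).1 h1).2, fun R'' h3 h4 => h2 _ ((hT _).2 ⟨h3, h4⟩)⟩

/-- no switch can improve -/
lemma no_switch {k : ℕ} {R : Finset (ℤ × ℤ)} (hR : S.Conf R) (hk : R.card = k)
    (hm : ∀ R', S.Conf R' → R'.card = k → wt R' ≤ wt R) {p s q r : ℤ} (hc : (p, s) ∈ R) (hd : (q, r) ∈ R)
    (hb : S.bad p (s + 1) (q + 1) r) : p = q ∧ s = r := by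
  classical
  by_contra hne
  have hcd : ((p, s) : ℤ × ℤ) ≠ (q, r) := by
    intro e; simp only [Prod.mk.injEq] at e; exact hne e
  obtain ⟨k1, k2, -⟩ := id hb
  have cells : ∀ x y, p ≤ x → x ≤ q → r ≤ y → y ≤ s → S.cell x y := fun x y h1 h2 h3 h4 =>
    cell_of_bad hb h1 (by omega) h3 (by omega)
  have hna := hR.2 _ hc _ hd hcd
  have e1 : p < q := by
    by_contra h
    apply hna
    refine Or.inr ⟨by simp only; omega, fun y h1 h2 => ?_⟩
    simp only at h1 h2
    exact cells _ _ (by simp) (by simp only; omega) (by omega) (by omega)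
  have e2 : r < s := by
    by_contra h
    apply hna
    refine Or.inl ⟨by simp only; omega, fun y h1 h2 => ?_⟩
    simp only at h1 h2
    exact cells _ _ (by omega) (by omega) (by simp only; omega) (by simp)
  have na : ∀ d ∈ R, d ≠ (p, s) → d ≠ (q, r) → ¬ S.att (p, r) d := by
    intro d hd' n1 n2
    rintro (⟨h1, h2⟩ | ⟨h1, h2⟩)
    · apply hR.2 _ hd' _ hd n2
      refine Or.inl ⟨h1.symm, fun x g1 g2 => ?_⟩
      simp only at h1 h2 g1 g2
      rw [← h1]
      by_cases hx : min p d.1 ≤ x ∧ x ≤ max p d.1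
      · exact h2 x hx.1 hx.2
      · exact cells _ _ (by omega) (by omega) (by omega) (by omega)
    · apply hR.2 _ hd' _ hc n1
      refine Or.inr ⟨h1.symm, fun x g1 g2 => ?_⟩
      simp only at h1 h2 g1 g2
      rw [← h1]
      by_cases hx : min r d.2 ≤ x ∧ x ≤ max r d.2
      · exact h2 x hx.1 hx.2
      · exact cells _ _ (by omega) (by omega) (by omega) (by omega)
  have nb : ∀ d ∈ R, d ≠ (p, s) → d ≠ (q, r) → ¬ S.att (q, s) d := by
    intro d hd' n1 n2
    rintro (⟨h1, h2⟩ | ⟨h1, h2⟩)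
    · apply hR.2 _ hd' _ hc n1
      refine Or.inl ⟨h1.symm, fun x g1 g2 => ?_⟩
      simp only at h1 h2 g1 g2
      rw [← h1]
      by_cases hx : min q d.1 ≤ x ∧ x ≤ max q d.1
      · exact h2 x hx.1 hx.2
      · exact cells _ _ (by omega) (by omega) (by omega) (by omega)
    · apply hR.2 _ hd' _ hd n2
      refine Or.inr ⟨h1.symm, fun x g1 g2 => ?_⟩
      simp only at h1 h2 g1 g2
      rw [← h1]
      by_cases hx : min s d.2 ≤ x ∧ x ≤ max s d.2
      · exact h2 x hx.1 hx.2
      · exact cells _ _ (by omega) (by omega) (by omega) (by omega)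
  have ca : S.cell p r := cells _ _ (by omega) (by omega) (by omega) (by omega)
  have cb : S.cell q s := cells _ _ (by omega) (by omega) (by omega) (by omega)
  have att_self : ∀ x y, S.cell x y → S.att (x, y) (x, y) := by
    intro x y h
    refine Or.inl ⟨rfl, fun t g1 g2 => ?_⟩
    simp only at g1 g2 ⊢
    obtain rfl : t = x := by omega
    exact h
  have aR : (p, r) ∉ R := fun h => na _ h (by simp; omega) (by simp; omega) (att_self _ _ ca)
  have bR : (q, s) ∉ R := fun h => nb _ h (by simp; omega) (by simp; omega) (att_self _ _ cb)
  have ab : ¬ S.att (p, r) (q, s) := by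
    rintro (⟨h1, -⟩ | ⟨h1, -⟩) <;> simp only at h1 <;> omega
  set R0 := (R.erase (p, s)).erase (q, r) with hR0
  have hd0 : (q, r) ∈ R.erase (p, s) := Finset.mem_erase.2 ⟨hcd.symm, hd⟩
  have m0 : ∀ d, d ∈ R0 ↔ d ≠ (q, r) ∧ d ≠ (p, s) ∧ d ∈ R := by
    intro d; simp [hR0]
  have b0 : (q, s) ∉ R0 := fun h => bR ((m0 _).1 h).2.2
  have a0 : (p, r) ∉ insert (q, s) R0 := by
    intro h
    rcases Finset.mem_insert.1 h with h | h
    · simp only [Prod.mk.injEq] at h; omega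
    · exact aR ((m0 _).1 h).2.2
  have := hm (insert (p, r) (insert (q, s) R0)) ⟨?_, ?_⟩ ?_
  · have w1 : wt (insert (p, r) (insert (q, s) R0)) = (p + r) ^ 2 + ((q + s) ^ 2 + wt R0) := by
      unfold wt
      rw [Finset.sum_insert a0, Finset.sum_insert b0]
    have w2 : wt R = (p + s) ^ 2 + ((q + r) ^ 2 + wt R0) := by
      unfold wt
      rw [← Finset.add_sum_erase R _ hc, ← Finset.add_sum_erase _ _ hd0]
    rw [w1, w2] at this
    nlinarith [mul_pos (sub_pos.2 e1) (sub_pos.2 e2)]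
  · intro d hd'
    rcases Finset.mem_insert.1 hd' with rfl | hd'
    · exact ca
    rcases Finset.mem_insert.1 hd' with rfl | hd'
    · exact cb
    · exact hR.1 d ((m0 _).1 hd').2.2
  · intro c hc' d hd' hne'
    rcases Finset.mem_insert.1 hc' with rfl | hc'
    · rcases Finset.mem_insert.1 hd' with rfl | hd'
      · exact absurd rfl hne'
      rcases Finset.mem_insert.1 hd' with rfl | hd'
      · exact ab
      · obtain ⟨g1, g2, g3⟩ := (m0 _).1 hd'
        exact na d g3 g2 g1
    rcases Finset.mem_insert.1 hc' with rfl | hc'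
    · rcases Finset.mem_insert.1 hd' with rfl | hd'
      · exact fun h => ab (att_symm h)
      rcases Finset.mem_insert.1 hd' with rfl | hd'
      · exact absurd rfl hne'
      · obtain ⟨g1, g2, g3⟩ := (m0 _).1 hd'
        exact nb d g3 g2 g1
    · obtain ⟨l1, l2, l3⟩ := (m0 _).1 hc'
      rcases Finset.mem_insert.1 hd' with rfl | hd'
      · exact fun h => na c l3 l2 l1 (att_symm h)
      rcases Finset.mem_insert.1 hd' with rfl | hd'
      · exact fun h => nb c l3 l2 l1 (att_symm h)
      · obtain ⟨g1, g2, g3⟩ := (m0 _).1 hd'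
        exact hR.2 _ l3 _ g3 hne'
  · rw [Finset.card_insert_of_notMem a0, Finset.card_insert_of_notMem b0, hR0,
      Finset.card_erase_of_mem hd0, Finset.card_erase_of_mem hc]
    have : 2 ≤ R.card := by
      have := Finset.card_le_card (show ({(p, s), (q, r)} : Finset (ℤ × ℤ)) ⊆ R by
        intro x hx
        simp only [Finset.mem_insert, Finset.mem_singleton] at hx
        rcases hx with rfl | rfl <;> assumption)
      rwa [Finset.card_pair hcd] at this
    omega

theorem rook_le (R : Finset (ℤ × ℤ)) (hR : S.Conf R) : ∃ F β, CP S F β ∧ ∃ Q : Finset (ℤ × ℤ),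
    Q.card = R.card ∧ ∀ q ∈ Q, ∃ a b, S.wit F β q.1 q.2 a b := by
  classical
  obtain ⟨R', hR', hk', hm⟩ := exists_conf_max R hR rfl
  rw [← hk']
  clear hR
  generalize R.card = k at hk' hm
  clear R
  rename' R' => R, hR' => hR, hk' => hk
  have star : ∀ p s q r, (p, s) ∈ R → (q, r) ∈ R → S.bad p (s + 1) (q + 1) r → p = q ∧ s = r :=
    fun p s q r h1 h2 h3 => no_switch hR hk hm h1 h2 h3
  have Rb : ∀ p s, (p, s) ∈ R → S.bad p (s + 1) (p + 1) s := fun p s h => cell_bad (hR.1 _ h)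
  have nstar : ∀ p s q r, (p, s) ∈ R → (q, r) ∈ R → p ≤ q → r ≤ s → ¬ (p = q ∧ s = r) →
      S.Vu p (s + 1) ∧ ¬ S.Vl p (s + 1) ∧ S.Vl (q + 1) r ∧ ¬ S.Vu (q + 1) r := by
    intro p s q r h1 h2 h3 h4 h5
    rcases bad_or (bad_V (Rb _ _ h1)).1 (bad_V (Rb _ _ h2)).2 (by omega) (by omega) with h | h
    · exact absurd (star _ _ _ _ h1 h2 h) h5
    · exact h
  have sa := S.ha
  have sb := S.hb
  have sam := S.ham
  have sbn := S.hbn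
  let β : ℤ → ℤ → Prop := fun x y => ∃ p s, (p, s) ∈ R ∧ S.bad x y (p + 1) s
  let Fβ : ℤ → ℤ → Prop := fun x y => S.V x y ∧ ¬ β x y ∧ ∀ x' y', S.bad x' y' x y → β x' y'
  let β' : ℤ → ℤ → Prop := fun x y => ∃ x' y', Fβ x' y' ∧ S.bad x y x' y'
  let F' : ℤ → ℤ → Prop := fun x y => S.V x y ∧ ¬ β' x y ∧ ∀ x' y', S.bad x' y' x y → β' x' y'
  have ββ : ∀ x y, β' x y → β x y := by
    rintro x y ⟨x', y', h1, h2⟩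
    exact h1.2.2 _ _ h2
  have FF : ∀ x y, Fβ x y → F' x y := by
    intro x y h
    exact ⟨h.1, fun h' => h.2.1 (ββ _ _ h'), fun x' y' hb => ⟨x, y, h, hb⟩⟩
  have cp : CP S F' β' := by
    constructor
    · intro x y
      constructor
      · rintro ⟨x', y', h1, h2⟩
        exact ⟨x', y', FF _ _ h1, h2⟩
      · rintro ⟨x', y', h1, h2⟩
        exact h1.2.2 _ _ h2
    · intro x y; exact Iff.rfl
  have cover : ∀ p s, (p, s) ∈ R → β' p (s + 1) := by
    intro p s h
    obtain ⟨x, y, ⟨g1, g2, g3⟩, hmax⟩ := exists_max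
      (fun x y => S.V x y ∧ S.bad p (s + 1) x y ∧ ∀ x' y', S.bad x' y' x y → β x' y') S.m
      (by rintro x y ⟨h, -⟩; have := V_bd h; omega)
      ⟨(bad_V (Rb _ _ h)).2, Rb _ _ h, fun x' y' hb => ⟨p, s, h, hb⟩⟩
    refine ⟨x, y, ⟨g1, ?_, g3⟩, g2⟩
    rintro ⟨q, r, k1, k2⟩
    obtain ⟨i1, i2, i3⟩ := id g2
    obtain ⟨j1, j2, j3⟩ := id k2
    obtain ⟨n1, n2, n3, n4⟩ := nstar _ _ _ _ h k1 (by omega) (by omega) (by omega)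
    simp only [n2, n4, false_and, and_false, or_false, false_or] at i3 j3
    have bw := Vu_bd n1
    have bv := Vl_bd n3
    have bz := V_bd g1
    rcases VuVl i3.2 j3.1 with ⟨v1, v2⟩ | ⟨v1, v2⟩
    · have hu : S.Vu x (y - 1) := Vu_low (by omega) v1 (by omega) (by omega)
      have := hmax x (y - 1) ⟨Or.inl hu, ⟨by omega, by omega, Or.inl ⟨n1, hu⟩⟩, ?_⟩
      · omega
      · rintro x' y' hb
        obtain ⟨l1, l2, l3⟩ := id hb
        by_cases e : y' = y
        · have := V_bd (bad_V hb).1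
          exact ⟨q, r, k1, by omega, by omega, Or.inr ⟨Vl_low (by omega) (by omega) (by omega) (by omega), n3⟩⟩
        · refine g3 _ _ ⟨l1, by omega, ?_⟩
          rcases l3 with l3 | l3
          · exact Or.inl ⟨l3.1, i3.2⟩
          · exact Or.inr ⟨l3.1, j3.1⟩
    · have hu : S.Vu (x + 1) y := Vu_high (by omega) (by omega) v2 (by omega)
      have := hmax (x + 1) y ⟨Or.inl hu, ⟨by omega, by omega, Or.inl ⟨n1, hu⟩⟩, ?_⟩
      · omega
      · rintro x' y' hb
        obtain ⟨l1, l2, l3⟩ := id hb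
        by_cases e : x' = x
        · have := V_bd (bad_V hb).1
          exact ⟨q, r, k1, by omega, by omega, Or.inr ⟨Vl_high (by omega) (by omega) (by omega) (by omega), n3⟩⟩
        · refine g3 _ _ ⟨by omega, by omega, ?_⟩
          rcases l3 with l3 | l3
          · exact Or.inl ⟨l3.1, i3.2⟩
          · exact Or.inr ⟨l3.1, j3.1⟩
  have hq : ∀ c : ℤ × ℤ, c ∈ R → ∃ q : ℤ × ℤ, Fβ q.1 q.2 ∧ S.bad c.1 (c.2 + 1) q.1 q.2 ∧
      ∃ a b, S.wit F' β' q.1 q.2 a b := by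
    intro c hc
    obtain ⟨p, q, h1, h2, a, b, h3, h4⟩ := cp.P2 (cover c.1 c.2 hc)
    obtain ⟨x, y, g1, g2⟩ := id h3
    obtain ⟨rfl, rfl⟩ := h4 x y (FF _ _ g1) g2
    exact ⟨(x, y), g1, h2, a, b, h3, h4⟩
  choose! q hq using hq
  refine ⟨F', β', cp, R.image q, ?_, ?_⟩
  · apply Finset.card_image_of_injOn
    -- case A
    have caseA : ∀ p s p' s' x y, (p, s) ∈ R → (p', s') ∈ R → ¬ (p = p' ∧ s = s') → S.bad p (s + 1) x y →
        S.bad p' (s' + 1) x y → p ≤ p' → s' ≤ s → False := by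
      intro p s p' s' x y h1 h2 h3 h4 h5 h6 h7
      obtain ⟨n1, n2, n3, n4⟩ := nstar _ _ _ _ h1 h2 h6 h7 h3
      obtain ⟨i1, i2, i3⟩ := h4
      obtain ⟨j1, j2, j3⟩ := h5
      have bv := Vl_bd n3
      simp only [n2, false_and, or_false] at i3
      exact n4 (Vu_mono i3.2 (by omega) (by omega) (by omega) (by omega))
    have caseB : ∀ p s p' s' x y, (p, s) ∈ R → (p', s') ∈ R → Fβ x y → S.bad p (s + 1) x y →
        S.bad p' (s' + 1) x y → p < p' → s < s' → False := by
      intro p s p' s' x y h1 h2 h3 h4 h5 h6 h7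
      have b1 := V_bd (bad_V h4).1
      have b2 := V_bd (bad_V h5).1
      obtain ⟨i1, i2, i3⟩ := h4
      obtain ⟨j1, j2, j3⟩ := h5
      have hz : S.bad p' (s + 1) x y := by
        refine ⟨by omega, by omega, ?_⟩
        rcases i3 with i3 | i3
        · exact Or.inl ⟨Vu_mono i3.2 (by omega) (by omega) (by omega) (by omega), i3.2⟩
        · exact Or.inr ⟨Vl_mono i3.1 (by omega) (by omega) (by omega) (by omega), i3.2⟩
      obtain ⟨p2, s2, k1, k2⟩ := h3.2.2 _ _ hz
      obtain ⟨l1, l2, l3⟩ := k2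
      obtain ⟨n1, n2, n3, n4⟩ := nstar _ _ _ _ h1 k1 (by omega) (by omega) (by omega)
      obtain ⟨n1', n2', -, -⟩ := nstar _ _ _ _ h2 k1 (by omega) (by omega) (by omega)
      simp only [n2, n4, false_and, and_false, or_false, false_or] at i3 l3
      have u1 := U_bd n1 n2
      have u2 := U_bd n1' n2'
      rcases VuVl (Vu_mono i3.2 (x' := p') (y' := s + 1) (by omega) (by omega) (by omega) (by omega)) l3.1 with h | h <;> omega
    intro c hc c' hc' e
    by_contra hne
    obtain ⟨f1, f2, -⟩ := hq c hc
    obtain ⟨f1', f2', -⟩ := hq c' hc'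
    rw [← e] at f2'
    have hne1 : ¬ (c.1 = c'.1 ∧ c.2 = c'.2) := fun h => hne (Prod.ext h.1 h.2)
    have hne2 : ¬ (c'.1 = c.1 ∧ c'.2 = c.2) := fun h => hne (Prod.ext h.1.symm h.2.symm)
    by_cases t1 : c.1 ≤ c'.1
    · by_cases t2 : c'.2 ≤ c.2
      · exact caseA _ _ _ _ _ _ hc hc' hne1 f2 f2' t1 t2
      · by_cases t3 : c'.1 ≤ c.1
        · exact caseA _ _ _ _ _ _ hc' hc hne2 f2' f2 t3 (by omega)
        · exact caseB _ _ _ _ _ _ hc hc' f1 f2 f2' (by omega) (by omega)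
    · by_cases t2 : c.2 ≤ c'.2
      · exact caseA _ _ _ _ _ _ hc' hc hne2 f2' f2 (by omega) t2
      · exact caseB _ _ _ _ _ _ hc' hc f1 f2' f2 (by omega) (by omega)
  · intro y hy
    obtain ⟨c, hc, rfl⟩ := Finset.mem_image.1 hy
    exact (hq c hc).2.2

end Shape
end FrameReg

set_option linter.unusedSectionVars false
set_option linter.unusedSimpArgs false
set_option linter.unusedVariables false

namespace FrameReg
namespace Shape
variable {S : Shape}

open Classical in
/-- indicator -/
noncomputable def ind (T : ℤ → ℤ → Prop) (x y : ℤ) : ℕ := if T x y then 1 else 0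

lemma ind_congr {T T' : ℤ → ℤ → Prop} {x y x' y' : ℤ} (h : T x y ↔ T' x' y') : ind T x y = ind T' x' y' := by
  unfold ind
  by_cases h1 : T x y
  · rw [if_pos h1, if_pos (h.1 h1)]
  · rw [if_neg h1, if_neg fun h2 => h1 (h.2 h2)]

/-- invariant classes -/
def good (S : Shape) (T : ℤ → ℤ → Prop) : Prop :=
  ∀ x y x' y', S.bad x y x' y' → ind T x y + ind T x' y' = ind T x y' + ind T x' y

lemma good_of {T : ℤ → ℤ → Prop}
    (hu : (∃ A : ℤ → Prop, ∀ x y, S.Vu x y → (T x y ↔ A x)) ∨ (∃ A : ℤ → Prop, ∀ x y, S.Vu x y → (T x y ↔ A y)))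
    (hl : (∃ A : ℤ → Prop, ∀ x y, S.Vl x y → (T x y ↔ A x)) ∨ (∃ A : ℤ → Prop, ∀ x y, S.Vl x y → (T x y ↔ A y))) :
    S.good T := by
  rintro x y x' y' ⟨h1, h2, ⟨h3, h4⟩ | ⟨h3, h4⟩⟩
  · have b1 := Vu_bd h3
    have b2 := Vu_bd h4
    have h5 : S.Vu x y' := Vu_mono h4 (by omega) (by omega) (by omega) (by omega)
    have h6 : S.Vu x' y := Vu_mono h4 (by omega) (by omega) (by omega) (by omega)
    rcases hu with ⟨A, hA⟩ | ⟨A, hA⟩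
    · rw [ind_congr (T' := T) ((hA _ _ h3).trans (hA _ _ h5).symm), ind_congr (T' := T) ((hA _ _ h4).trans (hA _ _ h6).symm)]
    · rw [ind_congr (T' := T) ((hA _ _ h3).trans (hA _ _ h6).symm), ind_congr (T' := T) ((hA _ _ h4).trans (hA _ _ h5).symm), add_comm]
  · have b1 := Vl_bd h3
    have b2 := Vl_bd h4
    have h5 : S.Vl x y' := Vl_mono h3 (by omega) (by omega) (by omega) (by omega)
    have h6 : S.Vl x' y := Vl_mono h3 (by omega) (by omega) (by omega) (by omega)
    rcases hl with ⟨A, hA⟩ | ⟨A, hA⟩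
    · rw [ind_congr (T' := T) ((hA _ _ h3).trans (hA _ _ h5).symm), ind_congr (T' := T) ((hA _ _ h4).trans (hA _ _ h6).symm)]
    · rw [ind_congr (T' := T) ((hA _ _ h3).trans (hA _ _ h6).symm), ind_congr (T' := T) ((hA _ _ h4).trans (hA _ _ h5).symm), add_comm]

lemma good_true : S.good (fun _ _ => True) :=
  good_of (Or.inl ⟨fun _ => True, by simp⟩) (Or.inl ⟨fun _ => True, by simp⟩)

/-- lower left block -/
def cL (S : Shape) (x y : ℤ) : Prop := x ≤ S.a0 ∧ y ≤ S.b0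
/-- upper right block -/
def cR (S : Shape) (x y : ℤ) : Prop := S.ak ≤ x ∧ S.bk ≤ y
/-- upper only -/
def cU (S : Shape) (x y : ℤ) : Prop := S.Vu x y ∧ ¬ S.Vl x y
/-- lower only -/
def cO (S : Shape) (x y : ℤ) : Prop := S.Vl x y ∧ ¬ S.Vu x y

lemma cL_V {x y : ℤ} (h : S.V x y) (h' : S.cL x y) : S.Vu x y ∧ S.Vl x y := by
  have := V_bd h
  exact ⟨Vu_low (by omega) h'.1 (by omega) (by omega), Vl_low (by omega) h'.1 (by omega) h'.2⟩

lemma cR_V {x y : ℤ} (h : S.V x y) (h' : S.cR x y) : S.Vu x y ∧ S.Vl x y := by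
  have := V_bd h
  exact ⟨Vu_high (by omega) (by omega) h'.2 (by omega), Vl_high h'.1 (by omega) (by omega) (by omega)⟩

lemma Vu_cL {x y : ℤ} (h : S.Vu x y) : S.cL x y ↔ y ≤ S.b0 :=
  ⟨fun h => h.2, fun h' => ⟨(low_of h h').1, h'⟩⟩

lemma Vl_cL {x y : ℤ} (h : S.Vl x y) : S.cL x y ↔ x ≤ S.a0 :=
  ⟨fun h => h.1, fun h' => ⟨h', by by_contra h2; exact not_Vl_low h' (by omega) h⟩⟩

lemma Vu_cR {x y : ℤ} (h : S.Vu x y) : S.cR x y ↔ S.ak ≤ x :=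
  ⟨fun h => h.1, fun h' => ⟨h', (high_of h h').1⟩⟩

lemma Vl_cR {x y : ℤ} (h : S.Vl x y) : S.cR x y ↔ S.bk ≤ y :=
  ⟨fun h => h.2, fun h' => ⟨by by_contra h2; exact not_Vl_left (by omega) h' h, h'⟩⟩

lemma Vu_cLU {x y : ℤ} (h : S.Vu x y) : (S.cL x y ∨ S.cU x y) ↔ x < S.ak := by
  have := S.ha
  constructor
  · rintro (h' | h')
    · have := h'.1; omega
    · exact (U_bd h'.1 h'.2).1
  · intro h'
    by_cases h2 : S.Vl x y
    · rcases VuVl h h2 with h3 | h3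
      · exact Or.inl h3
      · omega
    · exact Or.inr ⟨h, h2⟩

lemma Vl_cLU {x y : ℤ} (h : S.Vl x y) : (S.cL x y ∨ S.cU x y) ↔ x ≤ S.a0 := by
  rw [← Vl_cL h]
  exact or_iff_left fun h' => h'.2 h

lemma Vu_cLO {x y : ℤ} (h : S.Vu x y) : (S.cL x y ∨ S.cO x y) ↔ y ≤ S.b0 := by
  rw [← Vu_cL h]
  exact or_iff_left fun h' => h'.2 h

lemma Vl_cLO {x y : ℤ} (h : S.Vl x y) : (S.cL x y ∨ S.cO x y) ↔ y < S.bk := by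
  have := S.hb
  constructor
  · rintro (h' | h')
    · have := h'.2; omega
    · exact (Lo_bd h'.1 h'.2).2.1
  · intro h'
    by_cases h2 : S.Vu x y
    · rcases VuVl h2 h with h3 | h3
      · exact Or.inl h3
      · omega
    · exact Or.inr ⟨h, h2⟩

lemma Vu_cUR {x y : ℤ} (h : S.Vu x y) : (S.cU x y ∨ S.cR x y) ↔ S.b0 < y := by
  have := S.hb
  constructor
  · rintro (h' | h')
    · exact (U_bd h'.1 h'.2).2.1
    · have := h'.2; omega
  · intro h'
    by_cases h2 : S.Vl x y
    · rcases VuVl h h2 with h3 | h3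
      · omega
      · exact Or.inr h3
    · exact Or.inl ⟨h, h2⟩

lemma Vl_cUR {x y : ℤ} (h : S.Vl x y) : (S.cU x y ∨ S.cR x y) ↔ S.bk ≤ y := by
  rw [← Vl_cR h]
  exact or_iff_right fun h' => h'.2 h

lemma Vu_cOR {x y : ℤ} (h : S.Vu x y) : (S.cO x y ∨ S.cR x y) ↔ S.ak ≤ x := by
  rw [← Vu_cR h]
  exact or_iff_right fun h' => h'.2 h

lemma Vl_cOR {x y : ℤ} (h : S.Vl x y) : (S.cO x y ∨ S.cR x y) ↔ S.a0 < x := by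
  have := S.ha
  constructor
  · rintro (h' | h')
    · exact (Lo_bd h'.1 h'.2).1
    · have := h'.1; omega
  · intro h'
    by_cases h2 : S.Vu x y
    · rcases VuVl h2 h with h3 | h3
      · omega
      · exact Or.inr h3
    · exact Or.inl ⟨h, h2⟩

lemma good_cL : S.good S.cL := good_of (Or.inr ⟨_, fun x y h => Vu_cL h⟩) (Or.inl ⟨_, fun x y h => Vl_cL h⟩)
lemma good_cR : S.good S.cR := good_of (Or.inl ⟨_, fun x y h => Vu_cR h⟩) (Or.inr ⟨_, fun x y h => Vl_cR h⟩)
lemma good_cU : S.good S.cU := by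
  rintro x y x' y' h
  have e1 := (good_of (T := fun x y => S.cL x y ∨ S.cU x y) (Or.inl ⟨_, fun x y h => Vu_cLU h⟩) (Or.inl ⟨_, fun x y h => Vl_cLU h⟩)) _ _ _ _ h
  have e2 := good_cL (S := S) _ _ _ _ h
  have e3 : ∀ x y, ind (fun x y => S.cL x y ∨ S.cU x y) x y = ind S.cL x y + ind S.cU x y := by
    intro x y
    unfold ind
    by_cases h1 : S.cL x y <;> by_cases h2 : S.cU x y <;> simp [h1, h2]
    exact h2.2 (cL_V (Or.inl h2.1) h1).2
  simp only [e3] at e1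
  omega
lemma good_cO : S.good S.cO := by
  rintro x y x' y' h
  have e1 := (good_of (T := fun x y => S.cL x y ∨ S.cO x y) (Or.inr ⟨_, fun x y h => Vu_cLO h⟩) (Or.inr ⟨_, fun x y h => Vl_cLO h⟩)) _ _ _ _ h
  have e2 := good_cL (S := S) _ _ _ _ h
  have e3 : ∀ x y, ind (fun x y => S.cL x y ∨ S.cO x y) x y = ind S.cL x y + ind S.cO x y := by
    intro x y
    unfold ind
    by_cases h1 : S.cL x y <;> by_cases h2 : S.cO x y <;> simp [h1, h2]
    exact h2.2 (cL_V (Or.inr h2.1) h1).1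
  simp only [e3] at e1
  omega

lemma good_LU (i : ℤ) : S.good (fun x y => (S.cL x y ∨ S.cU x y) ∧ x = i) :=
  good_of (Or.inl ⟨fun x => x < S.ak ∧ x = i, fun x y h => by rw [Vu_cLU h]⟩)
    (Or.inl ⟨fun x => x ≤ S.a0 ∧ x = i, fun x y h => by rw [Vl_cLU h]⟩)
lemma good_LO (i : ℤ) : S.good (fun x y => (S.cL x y ∨ S.cO x y) ∧ y = i) :=
  good_of (Or.inr ⟨fun x => x ≤ S.b0 ∧ x = i, fun x y h => by rw [Vu_cLO h]⟩)
    (Or.inr ⟨fun x => x < S.bk ∧ x = i, fun x y h => by rw [Vl_cLO h]⟩)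
lemma good_UR (i : ℤ) : S.good (fun x y => (S.cU x y ∨ S.cR x y) ∧ y = i) :=
  good_of (Or.inr ⟨fun x => S.b0 < x ∧ x = i, fun x y h => by rw [Vu_cUR h]⟩)
    (Or.inr ⟨fun x => S.bk ≤ x ∧ x = i, fun x y h => by rw [Vl_cUR h]⟩)
lemma good_OR (i : ℤ) : S.good (fun x y => (S.cO x y ∨ S.cR x y) ∧ x = i) :=
  good_of (Or.inl ⟨fun x => S.ak ≤ x ∧ x = i, fun x y h => by rw [Vu_cOR h]⟩)
    (Or.inl ⟨fun x => S.a0 < x ∧ x = i, fun x y h => by rw [Vl_cOR h]⟩)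

/-- a standard support -/
def std (S : Shape) (s : ℤ → ℤ → Prop) : Prop :=
  (∀ x y, s x y → S.V x y) ∧ ∀ x y x' y', s x y → s x' y' → ¬ S.bad x y x' y'

lemma common_of {s s' : ℤ → ℤ → Prop} (H : ∀ T, S.good T → ((∃ x y, s x y ∧ T x y) ↔ (∃ x y, s' x y ∧ T x y)))
    {C A B : ℤ → ℤ → Prop} (hA : ∀ x y, C x y → A x y) (hB : ∀ x y, C x y → B x y)
    (gC : S.good C) (gA : ∀ i, S.good (fun x y => A x y ∧ x = i)) (gB : ∀ i, S.good (fun x y => B x y ∧ y = i))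
    (hm : ∀ s0, (s0 = s ∨ s0 = s') → (∃ x y, s0 x y ∧ C x y) → ∃ x y, s0 x y ∧ C x y ∧
      (∀ x' y', s0 x' y' → A x' y' → x ≤ x') ∧ (∀ x' y', s0 x' y' → B x' y' → y ≤ y'))
    (hne : ∃ x y, s x y ∧ C x y) : ∃ x y, s x y ∧ s' x y := by
  obtain ⟨x, y, h1, h2, h3, h4⟩ := hm s (Or.inl rfl) hne
  obtain ⟨x', y', h1', h2', h3', h4'⟩ := hm s' (Or.inr rfl) ((H C gC).1 hne)
  obtain ⟨p1, q1, a1, a2, a3⟩ := (H _ (gA x)).1 ⟨x, y, h1, hA _ _ h2, rfl⟩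
  obtain ⟨p2, q2, b1, b2, b3⟩ := (H _ (gA x')).2 ⟨x', y', h1', hA _ _ h2', rfl⟩
  obtain ⟨p3, q3, c1, c2, c3⟩ := (H _ (gB y)).1 ⟨x, y, h1, hB _ _ h2, rfl⟩
  obtain ⟨p4, q4, d1, d2, d3⟩ := (H _ (gB y')).2 ⟨x', y', h1', hB _ _ h2', rfl⟩
  have e1 := h3' _ _ a1 a2
  have e2 := h3 _ _ b1 b2
  have e3 := h4' _ _ c1 c2
  have e4 := h4 _ _ d1 d2
  obtain rfl : x = x' := by omega
  obtain rfl : y = y' := by omega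
  exact ⟨x, y, h1, h1'⟩

/-- minimum of a class which is contained in one side -/
lemma min_of {s C : ℤ → ℤ → Prop} (hs : S.std s)
    (hC : (∀ x y, s x y → C x y → S.Vu x y) ∨ (∀ x y, s x y → C x y → S.Vl x y))
    (hne : ∃ x y, s x y ∧ C x y) : ∃ x y, s x y ∧ C x y ∧ ∀ x' y', s x' y' → C x' y' → x ≤ x' ∧ y ≤ y' := by
  obtain ⟨x, y, h⟩ := hne
  obtain ⟨z, ⟨p, q, h1, h2, h3⟩, h4⟩ := Int.exists_least_of_bdd
    (P := fun z => ∃ x y, s x y ∧ C x y ∧ z = x + y)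
    ⟨0, by rintro z ⟨x, y, h, -, rfl⟩; have := V_bd (hs.1 _ _ h); omega⟩ ⟨_, x, y, h.1, h.2, rfl⟩
  refine ⟨p, q, h1, h2, fun x' y' g1 g2 => ?_⟩
  have h5 := h4 _ ⟨x', y', g1, g2, rfl⟩
  by_contra hcon
  by_cases hx : x' < p
  · refine hs.2 _ _ _ _ g1 h1 ⟨hx, by omega, ?_⟩
    rcases hC with hC | hC
    · exact Or.inl ⟨hC _ _ g1 g2, hC _ _ h1 h2⟩
    · exact Or.inr ⟨hC _ _ g1 g2, hC _ _ h1 h2⟩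
  · refine hs.2 _ _ _ _ h1 g1 ⟨by omega, by omega, ?_⟩
    rcases hC with hC | hC
    · exact Or.inl ⟨hC _ _ h1 h2, hC _ _ g1 g2⟩
    · exact Or.inr ⟨hC _ _ h1 h2, hC _ _ g1 g2⟩

theorem common {s s' : ℤ → ℤ → Prop} (hs : S.std s) (hs' : S.std s')
    (H : ∀ T, S.good T → ((∃ x y, s x y ∧ T x y) ↔ (∃ x y, s' x y ∧ T x y)))
    (hne : ∃ x y, s x y) : ∃ x y, s x y ∧ s' x y := by
  have sa := S.ha
  have sb := S.hb
  have hst : ∀ s0, (s0 = s ∨ s0 = s') → S.std s0 := by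
    rintro s0 (rfl | rfl) <;> assumption
  by_cases nL : ∃ x y, s x y ∧ S.cL x y
  · refine common_of H (A := fun x y => S.cL x y ∨ S.cU x y) (B := fun x y => S.cL x y ∨ S.cO x y)
      (fun _ _ h => Or.inl h) (fun _ _ h => Or.inl h) good_cL good_LU good_LO ?_ nL
    intro s0 h0 hn
    have hs0 := hst s0 h0
    obtain ⟨x, y, h1, h2, h3⟩ := min_of hs0 (Or.inl fun x y h h' => (cL_V (hs0.1 _ _ h) h').1) hn
    have hv := cL_V (hs0.1 _ _ h1) h2
    refine ⟨x, y, h1, h2, ?_, ?_⟩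
    · rintro x' y' g1 (g2 | g2)
      · exact (h3 _ _ g1 g2).1
      · by_contra hc
        have := U_bd g2.1 g2.2
        have := h2.2
        exact hs0.2 _ _ _ _ g1 h1 ⟨by omega, by omega, Or.inl ⟨g2.1, hv.1⟩⟩
    · rintro x' y' g1 (g2 | g2)
      · exact (h3 _ _ g1 g2).2
      · by_contra hc
        have := Lo_bd g2.1 g2.2
        have := h2.1
        exact hs0.2 _ _ _ _ h1 g1 ⟨by omega, by omega, Or.inr ⟨hv.2, g2.1⟩⟩
  have nL' : ¬ ∃ x y, s' x y ∧ S.cL x y := fun h => nL ((H _ good_cL).2 h)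
  have nL0 : ∀ s0, (s0 = s ∨ s0 = s') → ∀ x y, s0 x y → ¬ S.cL x y := by
    rintro s0 (rfl | rfl) x y h h'
    · exact nL ⟨x, y, h, h'⟩
    · exact nL' ⟨x, y, h, h'⟩
  by_cases nU : ∃ x y, s x y ∧ S.cU x y
  · refine common_of H (A := fun x y => S.cL x y ∨ S.cU x y) (B := fun x y => S.cU x y ∨ S.cR x y)
      (fun _ _ h => Or.inr h) (fun _ _ h => Or.inl h) good_cU good_LU good_UR ?_ nU
    intro s0 h0 hn
    have hs0 := hst s0 h0
    obtain ⟨x, y, h1, h2, h3⟩ := min_of hs0 (Or.inl fun x y h h' => h'.1) hn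
    refine ⟨x, y, h1, h2, ?_, ?_⟩
    · rintro x' y' g1 (g2 | g2)
      · exact absurd g2 (nL0 _ h0 _ _ g1)
      · exact (h3 _ _ g1 g2).1
    · rintro x' y' g1 (g2 | g2)
      · exact (h3 _ _ g1 g2).2
      · by_contra hc
        have := U_bd h2.1 h2.2
        have := g2.1
        exact hs0.2 _ _ _ _ h1 g1 ⟨by omega, by omega, Or.inl ⟨h2.1, (cR_V (hs0.1 _ _ g1) g2).1⟩⟩
  by_cases nO : ∃ x y, s x y ∧ S.cO x y
  · refine common_of H (A := fun x y => S.cO x y ∨ S.cR x y) (B := fun x y => S.cL x y ∨ S.cO x y)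
      (fun _ _ h => Or.inl h) (fun _ _ h => Or.inr h) good_cO good_OR good_LO ?_ nO
    intro s0 h0 hn
    have hs0 := hst s0 h0
    obtain ⟨x, y, h1, h2, h3⟩ := min_of hs0 (Or.inr fun x y h h' => h'.1) hn
    refine ⟨x, y, h1, h2, ?_, ?_⟩
    · rintro x' y' g1 (g2 | g2)
      · exact (h3 _ _ g1 g2).1
      · by_contra hc
        have := Lo_bd h2.1 h2.2
        have := g2.2
        exact hs0.2 _ _ _ _ g1 h1 ⟨by omega, by omega, Or.inr ⟨(cR_V (hs0.1 _ _ g1) g2).2, h2.1⟩⟩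
    · rintro x' y' g1 (g2 | g2)
      · exact absurd g2 (nL0 _ h0 _ _ g1)
      · exact (h3 _ _ g1 g2).2
  have nR : ∃ x y, s x y ∧ S.cR x y := by
    obtain ⟨x, y, h⟩ := hne
    refine ⟨x, y, h, ?_⟩
    have hV := hs.1 _ _ h
    by_contra hc
    by_cases a : S.Vu x y <;> by_cases b : S.Vl x y
    · rcases VuVl a b with h1 | h1
      · exact nL ⟨x, y, h, h1⟩
      · exact hc h1
    · exact nU ⟨x, y, h, a, b⟩
    · exact nO ⟨x, y, h, b, a⟩
    · exact absurd hV (by simp [V, a, b])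
  have nU' : ¬ ∃ x y, s' x y ∧ S.cU x y := fun h => nU ((H _ good_cU).2 h)
  have nU0 : ∀ s0, (s0 = s ∨ s0 = s') → ∀ x y, s0 x y → ¬ S.cU x y := by
    rintro s0 (rfl | rfl) x y h h'
    · exact nU ⟨x, y, h, h'⟩
    · exact nU' ⟨x, y, h, h'⟩
  have nO' : ¬ ∃ x y, s' x y ∧ S.cO x y := fun h => nO ((H _ good_cO).2 h)
  have nO0 : ∀ s0, (s0 = s ∨ s0 = s') → ∀ x y, s0 x y → ¬ S.cO x y := by
    rintro s0 (rfl | rfl) x y h h'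
    · exact nO ⟨x, y, h, h'⟩
    · exact nO' ⟨x, y, h, h'⟩
  refine common_of H (A := fun x y => S.cO x y ∨ S.cR x y) (B := fun x y => S.cU x y ∨ S.cR x y)
    (fun _ _ h => Or.inr h) (fun _ _ h => Or.inr h) good_cR good_OR good_UR ?_ nR
  intro s0 h0 hn
  have hs0 := hst s0 h0
  obtain ⟨x, y, h1, h2, h3⟩ := min_of hs0 (Or.inl fun x y h h' => (cR_V (hs0.1 _ _ h) h').1) hn
  refine ⟨x, y, h1, h2, ?_, ?_⟩
  · rintro x' y' g1 (g2 | g2)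
    · exact absurd g2 (nO0 _ h0 _ _ g1)
    · exact (h3 _ _ g1 g2).1
  · rintro x' y' g1 (g2 | g2)
    · exact absurd g2 (nU0 _ h0 _ _ g1)
    · exact (h3 _ _ g1 g2).2

end Shape
end FrameReg

set_option linter.unusedSectionVars false
set_option linter.unusedSimpArgs false
set_option linter.unusedVariables false

namespace FrameReg
open Finset MvPolynomial

section
variable {σ : Type} [Fintype σ] [LinearOrder σ] {K : Type} [Field K]

/-- a frame presentation of a set of binomials -/
structure Pres (S : Shape) (σ K : Type) [Fintype σ] [LinearOrder σ] [Field K] (G : Set (MvPolynomial σ K)) where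
  e : σ → ℤ × ℤ
  inj : ∀ v w, e v = e w → v = w
  hV : ∀ x y, S.V x y ↔ ∃ v, e v = (x, y)
  gen : ∀ g ∈ G, ∃ a b c d : σ, g = X a * X b - X c * X d ∧ S.bad (e c).1 (e c).2 (e d).1 (e d).2 ∧
    e a = ((e c).1, (e d).2) ∧ e b = ((e d).1, (e c).2)
  red : ∀ a b c d : σ, S.bad (e c).1 (e c).2 (e d).1 (e d).2 →
    e a = ((e c).1, (e d).2) → e b = ((e d).1, (e c).2) → X a * X b - X c * X d ∈ G

namespace Pres
variable {S : Shape} {G : Set (MvPolynomial σ K)} (D : Pres S σ K G)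

/-- bad pairs -/
def bd (v w : σ) : Prop := S.bad (D.e v).1 (D.e v).2 (D.e w).1 (D.e w).2

/-- the index type of the invariants -/
abbrev IT (S : Shape) : Type := {T : ℤ → ℤ → Prop // S.good T}

/-- the invariants -/
noncomputable def inv : (σ →₀ ℕ) →+ (IT S → ℕ) :=
  AddMonoidHom.pi (fun T => Finsupp.weight (fun v => Shape.ind T.1 (D.e v).1 (D.e v).2))

lemma inv_apply (u : σ →₀ ℕ) (T : IT S) :
    D.inv u T = Finsupp.weight (fun v => Shape.ind T.1 (D.e v).1 (D.e v).2) u := rfl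

lemma inv_eq {a b c d : σ} (h : S.bad (D.e c).1 (D.e c).2 (D.e d).1 (D.e d).2)
    (ha : D.e a = ((D.e c).1, (D.e d).2)) (hb : D.e b = ((D.e d).1, (D.e c).2)) :
    D.inv (Finsupp.single a 1 + Finsupp.single b 1) = D.inv (Finsupp.single c 1 + Finsupp.single d 1) := by
  funext T
  simp only [inv_apply, map_add, weight_single_one', ha, hb]
  exact (T.2 _ _ _ _ h).symm

lemma inv_ne (u : σ →₀ ℕ) (T : IT S) : D.inv u T ≠ 0 ↔ ∃ x y, (∃ v, D.e v = (x, y) ∧ u v ≠ 0) ∧ T.1 x y := by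
  classical
  rw [inv_apply, Finsupp.weight_apply, Finsupp.sum_fintype _ _ (by simp), Ne, Finset.sum_eq_zero_iff]
  push Not
  constructor
  · rintro ⟨v, -, h⟩
    rw [smul_eq_mul] at h
    refine ⟨_, _, ⟨v, rfl, fun h0 => h (by simp [h0])⟩, ?_⟩
    by_contra hT
    exact h (by simp [Shape.ind, hT])
  · rintro ⟨x, y, ⟨v, h1, h2⟩, h3⟩
    refine ⟨v, mem_univ _, ?_⟩
    rw [smul_eq_mul, h1]
    simp [Shape.ind, h2, h3]

lemma Std_std {u : σ →₀ ℕ} (hu : Std D.bd u) : S.std (fun x y => ∃ v, D.e v = (x, y) ∧ u v ≠ 0) := by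
  constructor
  · rintro x y ⟨v, h, -⟩
    exact (D.hV _ _).2 ⟨v, h⟩
  · rintro x y x' y' ⟨v, h1, h2⟩ ⟨w, h3, h4⟩ hb
    apply hu v w h2 h4
    unfold bd
    rw [h1, h3]
    exact hb

lemma uniq (N : ℕ) : ∀ u u', u.degree = N → Std D.bd u → Std D.bd u' → D.inv u = D.inv u' → u = u' := by
  induction N with
  | zero =>
    intro u u' h0 hu hu' h
    rw [Finsupp.degree_eq_zero_iff] at h0
    subst h0
    by_contra hne
    have : ∃ v, u' v ≠ 0 := by
      by_contra hc
      push Not at hc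
      exact hne (Finsupp.ext fun v => by simp [hc v])
    obtain ⟨v, hv⟩ := this
    have h1 := (D.inv_ne u' ⟨_, Shape.good_true⟩).2 ⟨_, _, ⟨v, rfl, hv⟩, trivial⟩
    rw [← h] at h1
    simp at h1
  | succ N ih =>
    intro u u' h0 hu hu' h
    have hne : ∃ v, u v ≠ 0 := by
      by_contra hc
      push Not at hc
      have : u = 0 := Finsupp.ext hc
      simp [this] at h0
    obtain ⟨v, hv⟩ := hne
    obtain ⟨x, y, ⟨v, h1, h2⟩, ⟨v', h3, h4⟩⟩ := Shape.common (D.Std_std hu) (D.Std_std hu')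
      (fun T hT => by rw [← D.inv_ne u ⟨T, hT⟩, ← D.inv_ne u' ⟨T, hT⟩, h]) ⟨_, _, v, rfl, hv⟩
    obtain rfl := D.inj v v' (h1.trans h3.symm)
    have e : ∀ w : σ →₀ ℕ, w v ≠ 0 → w = (w - Finsupp.single v 1) + Finsupp.single v 1 := by
      intro w hw
      rw [tsub_add_cancel_of_le]
      rw [Finsupp.single_le_iff]
      omega
    have hsub : ∀ w : σ →₀ ℕ, Std D.bd w → Std D.bd (w - Finsupp.single v 1) := by
      intro w hw a b ha hb
      refine hw a b ?_ ?_
      · intro h; simp [h] at ha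
      · intro h; simp [h] at hb
    rw [e u h2, e u' h4] at h ⊢
    congr 1
    refine ih _ _ ?_ (hsub _ hu) (hsub _ hu') ?_
    · rw [e u h2] at h0
      rw [map_add, Finsupp.degree_single] at h0
      omega
    · rw [map_add, map_add _ (u' - _)] at h
      exact add_right_cancel h

lemma cp_of {u : σ →₀ ℕ} (hu : Std D.bd u) :
    Shape.CP S (fun x y => ∃ v ∈ Fa D.bd (bet D.bd u), D.e v = (x, y)) (fun x y => ∃ v ∈ bet D.bd u, D.e v = (x, y)) := by
  constructor
  · intro x y
    constructor
    · rintro ⟨v, h1, h2⟩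
      obtain ⟨q, h3, h4⟩ := mem_bet.1 h1
      refine ⟨_, _, ⟨q, mem_Fa.2 ⟨?_, fun w hw => mem_bet.2 ⟨q, h3, hw⟩⟩, rfl⟩, ?_⟩
      · intro h
        obtain ⟨q', h5, h6⟩ := mem_bet.1 h
        exact hu _ _ h3 h5 h6
      · have : S.bad (D.e v).1 (D.e v).2 (D.e q).1 (D.e q).2 := h4
        rwa [h2] at this
    · rintro ⟨x', y', ⟨q, h1, h2⟩, h3⟩
      obtain ⟨v, hv⟩ := (D.hV _ _).1 (Shape.bad_V h3).1
      refine ⟨v, (mem_Fa.1 h1).2 v ?_, hv⟩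
      unfold bd
      rw [h2, hv]; exact h3
  · intro x y
    constructor
    · rintro ⟨v, h1, h2⟩
      refine ⟨(D.hV _ _).2 ⟨v, h2⟩, ?_, ?_⟩
      · rintro ⟨w, h3, h4⟩
        obtain rfl := D.inj v w (h2.trans h4.symm)
        exact (mem_Fa.1 h1).1 h3
      · intro x' y' h3
        obtain ⟨w, hw⟩ := (D.hV _ _).1 (Shape.bad_V h3).1
        refine ⟨w, (mem_Fa.1 h1).2 w ?_, hw⟩
        unfold bd
        rw [h2, hw]; exact h3
    · rintro ⟨h1, h2, h3⟩
      obtain ⟨v, hv⟩ := (D.hV _ _).1 h1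
      refine ⟨v, mem_Fa.2 ⟨fun h => h2 ⟨v, h, hv⟩, fun w hw => ?_⟩, hv⟩
      have hw' : S.bad (D.e w).1 (D.e w).2 (D.e v).1 (D.e v).2 := hw
      rw [hv] at hw'
      obtain ⟨w', h4, h5⟩ := h3 _ _ hw'
      obtain rfl := D.inj w w' h5.symm
      exact h4

lemma mem_Ra_of_wit {u : σ →₀ ℕ} {q : σ} (hu : Std D.bd u) :
    q ∈ Ra D.bd (bet D.bd u) ↔ ∃ a b, S.wit (fun x y => ∃ v ∈ Fa D.bd (bet D.bd u), D.e v = (x, y))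
      (fun x y => ∃ v ∈ bet D.bd u, D.e v = (x, y)) (D.e q).1 (D.e q).2 a b := by
  rw [mem_Ra]
  constructor
  · rintro ⟨h1, w, h2, h3⟩
    refine ⟨(D.e w).1, (D.e w).2, ⟨w, h2, rfl⟩, ?_⟩
    rintro p' q' ⟨f, h4, h5⟩ h6
    have := h3 f h4 (by unfold bd; rw [h5]; exact h6)
    subst this
    rw [h5]; exact ⟨rfl, rfl⟩
  · rintro ⟨a, b, h⟩
    obtain ⟨⟨q', h1, h2⟩, h3⟩ := (D.cp_of hu).wit_bad h
    obtain rfl := D.inj _ _ h2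
    obtain ⟨⟨w, h4, h5⟩, h6⟩ := h
    refine ⟨h1, w, h4, fun f hf hb => ?_⟩
    have hb' : S.bad (D.e w).1 (D.e w).2 (D.e f).1 (D.e f).2 := hb
    rw [h5] at hb'
    obtain ⟨e1, e2⟩ := h6 _ _ ⟨f, hf, rfl⟩ hb'
    exact D.inj _ _ (Prod.ext e1 e2)

/-- the toric data -/
noncomputable def td : TorData σ K (IT S → ℕ) G where
  bad := D.bd
  om := fun v => (((D.e v).1 + (D.e v).2) ^ 2).toNat
  inv := D.inv
  gen := by
    intro g hg
    obtain ⟨a, b, c, d, h1, h2, h3, h4⟩ := D.gen g hg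
    exact ⟨a, b, c, d, h1, D.inv_eq h2 h3 h4⟩
  irr := by
    rintro w ⟨h, -⟩
    exact lt_irrefl _ h
  red := by
    intro w q h
    have hb : S.bad (D.e w).1 (D.e w).2 (D.e q).1 (D.e q).2 := h
    have hV : S.V (D.e w).1 (D.e q).2 ∧ S.V (D.e q).1 (D.e w).2 := by
      obtain ⟨h1, h2, ⟨h3, h4⟩ | ⟨h3, h4⟩⟩ := hb
      · have b1 := Shape.Vu_bd h3
        have b2 := Shape.Vu_bd h4
        exact ⟨Or.inl (Shape.Vu_mono h4 (by omega) (by omega) (by omega) (by omega)),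
          Or.inl (Shape.Vu_mono h4 (by omega) (by omega) (by omega) (by omega))⟩
      · have b1 := Shape.Vl_bd h3
        have b2 := Shape.Vl_bd h4
        exact ⟨Or.inr (Shape.Vl_mono h3 (by omega) (by omega) (by omega) (by omega)),
          Or.inr (Shape.Vl_mono h3 (by omega) (by omega) (by omega) (by omega))⟩
    obtain ⟨a, ha⟩ := (D.hV _ _).1 hV.1
    obtain ⟨b, hb'⟩ := (D.hV _ _).1 hV.2
    refine ⟨a, b, ?_, ?_, (D.inv_eq hb ha hb').symm⟩
    · rw [← neg_sub]
      exact Ideal.neg_mem_iff _ |>.2 (Ideal.subset_span (D.red a b w q hb ha hb'))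
    · rw [ha, hb']
      obtain ⟨h1, h2, -⟩ := hb
      zify
      simp only [Int.toNat_of_nonneg (sq_nonneg _)]
      nlinarith [mul_pos (sub_pos.2 h1) (sub_pos.2 h2)]
  uniq := fun u u' h1 h2 h3 => D.uniq _ u u' rfl h1 h2 h3
  P2 := by
    intro u hu w hw
    obtain ⟨p, q, ⟨v, h1, h2⟩, h3, a, b, h4, h5⟩ := (D.cp_of hu).P2 (x := (D.e w).1) (y := (D.e w).2) ⟨w, hw, rfl⟩
    refine ⟨v, (D.mem_Ra_of_wit hu).2 ⟨a, b, h4, ?_⟩, ?_⟩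
    · rw [h2]; exact h5
    · show S.bad _ _ _ _
      rw [h2]; exact h3

lemma card_Fa {u : σ →₀ ℕ} (hu : Std D.bd u) : ((Fa D.bd (bet D.bd u)).card : ℤ) =
    if 1 ≤ S.a0 then S.ak - S.b0 + S.bk - S.a0 + S.m + S.n - 2 else S.m + S.n - 1 := by
  classical
  rw [← (D.cp_of hu).purity]
  congr 1
  have : st (fun x y => ∃ v ∈ Fa D.bd (bet D.bd u), D.e v = (x, y)) = ↑((Fa D.bd (bet D.bd u)).image D.e) := by
    ext ⟨x, y⟩
    simp [st]
  rw [this, Set.ncard_coe_finset, Finset.card_image_of_injective _ fun v w => D.inj v w]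

theorem core (D : Pres S σ K G) {r : ℕ} (h1 : ∃ R, S.Conf R ∧ R.card = r) (h2 : ∀ R, S.Conf R → R.card ≤ r) :
    ∃ c : ℕ, ∀ R : PreRes σ K (Ideal.span G), (∀ d, c < d → R.t d = 0) ∧
      IsGreatest { z : ℤ | ∃ (d : ℕ) (i : Fin (R.t d)), z = R.tw d i - (d : ℤ) } (r : ℤ) := by
  classical
  obtain ⟨b, hb⟩ := TorData.exists_basis D.td
  have hT : D.td.tor.bad = D.bd := rfl
  have s0 : Std D.bd (0 : σ →₀ ℕ) := by intro w q h; simp at h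
  have hle : ∀ u, Std D.bd u → (Ra D.bd (bet D.bd u)).card ≤ r := by
    intro u hu
    obtain ⟨R, hR, hc⟩ := (D.cp_of hu).rook_ge ((Ra D.bd (bet D.bd u)).image D.e) (by
      intro q hq
      obtain ⟨v, hv, rfl⟩ := Finset.mem_image.1 hq
      exact (D.mem_Ra_of_wit hu).1 hv)
    rw [Finset.card_image_of_injective _ fun v w => D.inj v w] at hc
    rw [← hc]; exact h2 R hR
  obtain ⟨R, hR, hRr⟩ := h1
  obtain ⟨F, β, cp, Q, hQ, hw⟩ := Shape.rook_le R hR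
  let u₀ : σ →₀ ℕ := Finsupp.equivFunOnFinite.symm (fun v => if F (D.e v).1 (D.e v).2 then 1 else 0)
  have hu : ∀ v, u₀ v ≠ 0 ↔ F (D.e v).1 (D.e v).2 := by
    intro v; simp [u₀]
  have std0 : Std D.bd u₀ := by
    intro w q h3 h4 h5
    exact cp.no_bad ((hu _).1 h3) ((hu _).1 h4) h5
  have hβ : (fun x y => ∃ v ∈ bet D.bd u₀, D.e v = (x, y)) = β := by
    funext x y
    apply propext
    rw [cp.hβ]
    constructor
    · rintro ⟨v, h3, h4⟩
      obtain ⟨q, h5, h6⟩ := mem_bet.1 h3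
      refine ⟨_, _, (hu q).1 h5, ?_⟩
      have h6 : S.bad _ _ _ _ := h6
      rwa [h4] at h6
    · rintro ⟨x', y', h3, h4⟩
      obtain ⟨v, hv⟩ := (D.hV _ _).1 (Shape.bad_V h4).1
      obtain ⟨q, hq⟩ := (D.hV _ _).1 (Shape.bad_V h4).2
      refine ⟨v, mem_bet.2 ⟨q, (hu q).2 (by rw [hq]; exact h3), ?_⟩, hv⟩
      unfold bd
      rw [hv, hq]; exact h4
  have hF : (fun x y => ∃ v ∈ Fa D.bd (bet D.bd u₀), D.e v = (x, y)) = F := by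
    funext x y
    apply propext
    have h := D.cp_of std0
    rw [hβ] at h
    rw [h.hF, cp.hF]
  have hge : r ≤ (Ra D.bd (bet D.bd u₀)).card := by
    rw [← hRr, ← hQ, ← Finset.card_image_of_injective (Ra D.bd (bet D.bd u₀)) fun v w => D.inj v w]
    apply Finset.card_le_card
    intro q hq
    obtain ⟨a, b, hab⟩ := hw q hq
    obtain ⟨v, hv⟩ := (D.hV _ _).1 (cp.FV (cp.wit_bad hab).1)
    have hv' : D.e v = q := hv
    refine Finset.mem_image.2 ⟨v, (D.mem_Ra_of_wit std0).2 ⟨a, b, ?_⟩, hv'⟩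
    rw [hβ, hF, hv']; exact hab
  refine ⟨Fintype.card σ - (Fa D.bd (bet D.bd (0 : σ →₀ ℕ))).card, fun R => ?_⟩
  refine R.main b hb (c := Fintype.card σ - (Fa D.bd (bet D.bd (0 : σ →₀ ℕ))).card) (r := r) ?_ hle u₀ std0 (le_antisymm (hle _ std0) hge)
  intro u hu
  have e1 := D.card_Fa hu
  have e2 := D.card_Fa s0
  have e3 : (Fa D.bd (bet D.bd (0 : σ →₀ ℕ))).card ≤ Fintype.card σ := Finset.card_le_univ _
  rw [hT]
  have : (Fa D.bd (bet D.bd u)).card = (Fa D.bd (bet D.bd (0 : σ →₀ ℕ))).card := by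
    have := e1.trans e2.symm
    exact_mod_cast this
  omega

end Pres
end
end FrameReg

set_option linter.unusedSectionVars false
set_option linter.unusedSimpArgs false
set_option linter.unusedVariables false

namespace FrameReg

lemma path_fun (L : List (ℤ × ℤ)) : ∀ (a b c d : ℤ),
    L.IsChain (fun u v => v = (u.1 + 1, u.2) ∨ v = (u.1, u.2 + 1)) → L.head? = some (a, b) →
    L.getLast? = some (c, d) → a ≤ c ∧ b ≤ d ∧ ∃ f : ℤ → ℤ,
      (∀ x h, eastStepOf L x h ↔ a ≤ x ∧ x < c ∧ h = f x) ∧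
      (∀ x, a ≤ x → x < c → b ≤ f x ∧ f x ≤ d) ∧
      (∀ x y, a ≤ x → x ≤ y → y < c → f x ≤ f y) ∧
      (∀ x y, a ≤ x → x ≤ c → (x = a → b ≤ y) → (a < x → f (x - 1) ≤ y) → (x = c → y ≤ d) →
        (x < c → y ≤ f x) → (x, y) ∈ L) := by
  induction L with
  | nil => intro a b c d _ h; simp at h
  | cons p L ih =>
    intro a b c d hc hh hl
    obtain rfl : p = (a, b) := by simpa using hh
    cases L with
    | nil =>
      simp at hl
      obtain ⟨rfl, rfl⟩ := hl
      refine ⟨le_rfl, le_rfl, fun _ => b, ?_, ?_, ?_, ?_⟩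
      · intro x h
        simp [eastStepOf]
        intro h1 h2; omega
      · intro x h1 h2; omega
      · intro x y h1 h2; omega
      · intro x y h1 h2 h3 h4 h5 h6
        obtain rfl : x = a := by omega
        have := h3 rfl
        have := h5 rfl
        obtain rfl : y = b := by omega
        simp
    | cons q L =>
      rw [List.isChain_cons_cons] at hc
      obtain ⟨hpq, hc⟩ := hc
      have hl' : (q :: L).getLast? = some (c, d) := by
        rw [← hl]; simp [List.getLast?_cons_cons]
      have hst : ∀ x h, eastStepOf ((a, b) :: q :: L) x h ↔ ((x, h) = (a, b) ∧ (x + 1, h) = q) ∨ eastStepOf (q :: L) x h := by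
        intro x h
        simp [eastStepOf]
      rcases hpq with rfl | rfl
      · obtain ⟨k1, k2, f, h1, h2, h3, h4⟩ := ih _ _ c d hc rfl hl'
        simp only at k1 k2 h1 h2 h3 h4
        refine ⟨by omega, k2, fun x => if x = a then b else f x, ?_, ?_, ?_, ?_⟩
        · intro x h
          rw [hst, h1]
          simp only [Prod.mk.injEq]
          split_ifs with hx
          · omega
          · constructor
            · rintro (h | h)
              · omega
              · exact ⟨by omega, h.2⟩
            · rintro ⟨h5, h6, h7⟩
              exact Or.inr ⟨by omega, h6, h7⟩
        · intro x h5 h6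
          simp only
          split_ifs with hx
          · omega
          · exact h2 x (by omega) h6
        · intro x y h5 h6 h7
          simp only
          split_ifs with hx hy
          · exact le_rfl
          · exact (h2 y (by omega) h7).1
          · omega
          · exact h3 x y (by omega) h6 h7
        · intro x y h5 h6 h7 h8 h9 h10
          simp only at h8 h10
          by_cases hx : x = a
          · subst hx
            rw [if_pos rfl] at h10
            have := h10 (by omega)
            have := h7 rfl
            obtain rfl : y = b := by omega
            simp
          · rw [if_neg hx] at h10
            refine List.mem_cons_of_mem _ (h4 x y (by omega) h6 ?_ ?_ h9 h10)
            · intro hx'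
              have := h8 (by omega)
              rw [if_pos (by omega)] at this
              exact this
            · intro hx'
              have := h8 (by omega)
              rwa [if_neg (by omega)] at this
      · obtain ⟨k1, k2, f, h1, h2, h3, h4⟩ := ih _ _ c d hc rfl hl'
        simp only at k1 k2 h1 h2 h3 h4
        refine ⟨k1, by omega, f, ?_, ?_, h3, ?_⟩
        · intro x h
          rw [hst, h1]
          simp only [Prod.mk.injEq]
          omega
        · intro x h5 h6
          have := h2 x h5 h6
          omega
        · intro x y h5 h6 h7 h8 h9 h10
          by_cases hxy : x = a ∧ y = b
          · rw [hxy.1, hxy.2]; simp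
          · refine List.mem_cons_of_mem _ (h4 x y h5 h6 (by omega) h8 h9 h10)

lemma mem_interior {L : List (ℤ × ℤ)} {p q r : ℤ × ℤ} (hp : p ∈ L) (h1 : L.head? = some q) (h2 : L.getLast? = some r)
    (hq : p ≠ q) (hr : p ≠ r) : p ∈ interiorPts L := by
  cases L with
  | nil => simp at hp
  | cons x t =>
    obtain rfl : x = q := by simpa using h1
    have ht : p ∈ t := by
      rcases List.mem_cons.1 hp with h | h
      · exact absurd h hq
      · exact h
    have hne : t ≠ [] := List.ne_nil_of_mem ht
    show p ∈ t.dropLast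
    rw [← List.dropLast_append_getLast hne] at ht
    rcases List.mem_append.1 ht with h | h
    · exact h
    · exfalso
      rw [List.mem_singleton] at h
      rw [List.getLast?_eq_some_getLast (by simp), List.getLast_cons hne] at h2
      apply hr
      rw [h]; simpa using h2

theorem exists_shape (P : Polyomino) (D : FrameData) (hP : IsFrame P D) :
    ∃ S : Shape, ∀ x y, (x, y) ∈ P.cells ↔ S.cell x y := by
  have hP' : ∀ x y, (x, y) ∈ P.cells ↔ (1 ≤ x ∧ x + 1 ≤ D.m ∧ 1 ≤ y ∧ y + 1 ≤ D.n) ∧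
      ¬ (cellBelowPath D.S1 (x, y) ∧ cellAbovePath D.S2 (x, y)) := by
    intro x y
    rw [← Finset.mem_coe, hP]
    rfl
  have hd2 : D.S2.head? = some (D.a0, D.b0) := by rw [← D.par.headEq, D.head1]
  have lt2 : D.S2.getLast? = some (D.ak, D.bk) := by rw [← D.par.lastEq, D.last1]
  obtain ⟨-, -, f1, e1, bd1, mn1, mem1⟩ := path_fun D.S1 _ _ _ _ D.par.ne1.2 D.head1 D.last1
  obtain ⟨-, -, f2, e2, bd2, mn2, mem2⟩ := path_fun D.S2 _ _ _ _ D.par.ne2.2 hd2 lt2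
  have ha0 := D.ha0
  have hak := D.hak
  have ham := D.ham
  have hb0 := D.hb0
  have hbk := D.hbk
  have hbn := D.hbn
  have ab : ∀ x y y', (x, y) ∈ D.S1 → (x, y') ∈ D.S2 → (x, y) ≠ (D.a0, D.b0) → (x, y) ≠ (D.ak, D.bk) →
      (x, y') ≠ (D.a0, D.b0) → (x, y') ≠ (D.ak, D.bk) → y' < y := by
    intro x y y' h1 h2 h3 h4 h5 h6
    exact D.par.above _ (mem_interior h1 D.head1 D.last1 h3 h4) _ (mem_interior h2 hd2 lt2 h5 h6) rfl
  simp only [ne_eq, Prod.mk.injEq] at ab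
  have hh : ∀ x y, (cellBelowPath D.S1 (x, y) ∧ cellAbovePath D.S2 (x, y)) ↔
      D.a0 ≤ x ∧ x < D.ak ∧ f2 x ≤ y ∧ y < f1 x := by
    intro x y
    simp only [cellBelowPath, cellAbovePath, e1, e2]
    constructor
    · rintro ⟨⟨h, ⟨h1, h2, rfl⟩, h3⟩, ⟨h', ⟨-, -, rfl⟩, h4⟩⟩
      exact ⟨h1, h2, h4, h3⟩
    · rintro ⟨h1, h2, h3, h4⟩
      exact ⟨⟨_, ⟨h1, h2, rfl⟩, h4⟩, ⟨_, ⟨h1, h2, rfl⟩, h3⟩⟩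
  simp only [hh] at hP'
  have mid : ∀ x, D.a0 < x → x < D.ak → f2 x < f1 (x - 1) := by
    intro x h1 h2
    refine ab x _ _ (mem1 x _ (by omega) (by omega) (by omega) (fun _ => le_rfl) (by omega)
      (fun _ => mn1 _ _ (by omega) (by omega) h2)) (mem2 x _ (by omega) (by omega) (by omega)
      (fun _ => mn2 _ _ (by omega) (by omega) h2) (by omega) (fun _ => le_rfl)) (by omega) (by omega) (by omega) (by omega)
  by_cases hdeg : D.ak = D.a0 + 1 ∧ f1 D.a0 ≤ f2 D.a0
  · obtain ⟨d1, d2⟩ := hdeg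
    refine ⟨{ m := D.m, n := D.n, a0 := 0, b0 := 0, ak := 1, bk := 1, G1 := fun _ => 1
              G2 := fun i => if 1 ≤ i then D.n else 0
              mono1 := by intros; exact le_rfl
              mono2 := by intro i j h; split_ifs <;> omega
              h1 := by intros; exact le_rfl
              h2 := by intro i h; exact if_neg (by omega)
              h3 := by intros; simp
              h4 := by intro i h; rw [if_neg (by omega)]; omega
              h5 := by intros; rfl
              h6 := by intro i h; exact if_pos h
              h7 := by intros; omega
              h8 := by intro i h h'; rw [if_neg (by omega)]; omega
              ha := by omega
              hb := by omega
              ham := by omega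
              hbn := by omega
              hnd := Or.inr ⟨rfl, rfl, rfl, rfl⟩ }, ?_⟩
    intro x y
    rw [hP']
    simp only [Shape.cell]
    constructor
    · rintro ⟨h, -⟩
      refine ⟨by omega, by omega, by omega, by omega, ?_⟩
      rw [if_pos (by omega)]; omega
    · rintro ⟨h1, h2, h3, h4, -⟩
      refine ⟨by omega, ?_⟩
      rintro ⟨h5, h6, h7, h8⟩
      obtain rfl : x = D.a0 := by omega
      omega
  · have lt : ∀ x, D.a0 ≤ x → x < D.ak → f2 x < f1 x := by
      intro x h1 h2
      by_cases h3 : D.a0 < x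
      · have := mid x h3 h2
        have := mn1 (x - 1) x (by omega) (by omega) h2
        omega
      · obtain rfl : x = D.a0 := by omega
        by_cases h4 : D.ak = D.a0 + 1
        · by_contra hc; exact hdeg ⟨h4, by omega⟩
        · have h5 := mid (D.a0 + 1) (by omega) (by omega)
          rw [add_sub_cancel_right] at h5
          have := mn2 D.a0 (D.a0 + 1) (by omega) (by omega) (by omega)
          omega
    have hf2 : f2 D.a0 = D.b0 := by
      by_contra hc
      have l1 := lt D.a0 le_rfl hak
      have l2 := bd2 D.a0 le_rfl hak
      have := ab D.a0 (D.b0 + 1) (f2 D.a0) (mem1 _ _ (by omega) (by omega) (by omega) (by omega) (by omega) (by omega))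
        (mem2 _ _ (by omega) (by omega) (by omega) (by omega) (by omega) (by omega)) (by omega) (by omega) (by omega) (by omega)
      omega
    have hf1 : f1 (D.ak - 1) = D.bk := by
      by_contra hc
      have l1 := lt (D.ak - 1) (by omega) (by omega)
      have l2 := bd1 (D.ak - 1) (by omega) (by omega)
      have := ab D.ak (f1 (D.ak - 1)) (D.bk - 1) (mem1 _ _ (by omega) (by omega) (by omega) (by omega) (by omega) (by omega))
        (mem2 _ _ (by omega) (by omega) (by omega) (by omega) (by omega) (by omega)) (by omega) (by omega) (by omega) (by omega)
      omega
    refine ⟨{ m := D.m, n := D.n, a0 := D.a0, b0 := D.b0, ak := D.ak, bk := D.bk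
              G1 := fun i => if i ≤ D.a0 then 1 else f1 (min i D.ak - 1)
              G2 := fun i => if D.ak ≤ i then D.n else f2 (max i D.a0)
              mono1 := ?_, mono2 := ?_, h1 := ?_, h2 := ?_, h3 := ?_, h4 := ?_, h5 := ?_, h6 := ?_, h7 := ?_, h8 := ?_
              ha := hak, hb := hbk, ham := ham, hbn := hbn, hnd := Or.inl ⟨by omega, by omega⟩ }, ?_⟩
    · intro i j h
      split_ifs with h1 h2
      · exact le_rfl
      · have := bd1 (min j D.ak - 1) (by omega) (by omega)
        omega
      · omega
      · exact mn1 _ _ (by omega) (by omega) (by omega)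
    · intro i j h
      split_ifs with h1 h2
      · exact le_rfl
      · omega
      · have := bd2 (max i D.a0) (by omega) (by omega)
        omega
      · exact mn2 _ _ (by omega) (by omega) (by omega)
    · intro i h
      simp [h]
    · intro i h
      rw [if_neg (by omega), max_eq_right h, hf2]
    · intro i h
      rw [if_neg (by omega)]
      have := bd2 (min i D.ak - 1) (by omega) (by omega)
      have := lt (min i D.ak - 1) (by omega) (by omega)
      omega
    · intro i h
      rw [if_neg (by omega)]
      have := bd1 (max i D.a0) (by omega) (by omega)
      have := lt (max i D.a0) (by omega) (by omega)
      omega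
    · intro i h
      rw [if_neg (by omega), min_eq_right h, hf1]
    · intro i h
      simp [h]
    · intro i h h'
      rw [if_neg (by omega), if_neg (by omega), min_eq_left (by omega), max_eq_left (by omega)]
      exact mid i h h'
    · intro i h h'
      rw [if_neg (by omega), if_neg (by omega), min_eq_left (by omega), max_eq_left (by omega), add_sub_cancel_right]
      exact lt i h h'
    · intro x y
      rw [hP']
      simp only [Shape.cell]
      by_cases h1 : D.ak ≤ x
      · rw [if_pos h1]
        omega
      rw [if_neg h1]
      by_cases h2 : x + 1 ≤ D.a0
      · rw [if_pos h2]
        omega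
      rw [if_neg h2, min_eq_left (by omega), max_eq_left (by omega), add_sub_cancel_right]
      omega

end FrameReg

set_option linter.unusedSectionVars false
set_option linter.unusedSimpArgs false
set_option linter.unusedVariables false

namespace FrameReg
open Finset MvPolynomial

lemma mem_vertexSet (P : Polyomino) (S : Shape) (hS : ∀ x y, (x, y) ∈ P.cells ↔ S.cell x y) (x y : ℤ) :
    (x, y) ∈ P.vertexSet ↔ S.V x y := by
  rw [Shape.V_iff, Polyomino.vertexSet, Finset.mem_biUnion]
  constructor
  · rintro ⟨⟨c, d⟩, h1, h2⟩
    refine ⟨c, d, (hS _ _).1 h1, ?_⟩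
    simp [cellVertices] at h2
    omega
  · rintro ⟨c, d, h1, h2, h3⟩
    refine ⟨(c, d), (hS _ _).2 h1, ?_⟩
    simp [cellVertices]
    omega

/-- the presentation of the polyomino ideal -/
noncomputable def thePres (K : Type) [Field K] (P : Polyomino) [LinearOrder (PVertex P)] (S : Shape)
    (hS : ∀ x y, (x, y) ∈ P.cells ↔ S.cell x y) : Pres S (PVertex P) K (innerMinors K P) where
  e := Subtype.val
  inj := fun v w h => Subtype.ext h
  hV := by
    intro x y
    rw [← mem_vertexSet P S hS]
    constructor
    · intro h; exact ⟨⟨_, h⟩, rfl⟩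
    · rintro ⟨v, h⟩; rw [← h]; exact v.2
  gen := by
    rintro g ⟨a, b, c, d, h1, h2, h3, rfl⟩
    refine ⟨a, b, c, d, rfl, ?_, ?_, ?_⟩
    · refine Shape.bad_of_cells ((mem_vertexSet P S hS _ _).1 c.2) ((mem_vertexSet P S hS _ _).1 d.2) ?_ ?_ ?_
      · rw [h2, h3]; exact h1.1
      · rw [h2, h3]; exact h1.2.1
      · intro x y k1 k2 k3 k4
        rw [h2] at k1 k4
        rw [h3] at k2 k3
        simp only at k1 k2 k3 k4
        exact (hS _ _).1 (h1.2.2 (x, y) ⟨k1, by show x + 1 ≤ _; omega, k3, by show y + 1 ≤ _; omega⟩)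
    · rw [h2, h3]
    · rw [h2, h3]
  red := by
    intro a b c d h ha hb
    refine ⟨a, b, c, d, ⟨?_, ?_, ?_⟩, ?_, ?_, rfl⟩
    · rw [ha, hb]; exact h.1
    · rw [ha, hb]; exact h.2.1
    · rintro ⟨x, y⟩ ⟨k1, k2, k3, k4⟩
      rw [ha] at k1 k3
      rw [hb] at k2 k4
      simp only at k1 k2 k3 k4
      exact (hS _ _).2 (Shape.cell_of_bad h k1 (by omega) k3 (by omega))
    · rw [ha, hb]
    · rw [ha, hb]

lemma minor_hz {K : Type} [Field K] {P : Polyomino} [LinearOrder (PVertex P)] {g : PolyRing K P} (hg : g ∈ innerMinors K P) :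
    g ∈ hz (PVertex P) K 2 := by
  obtain ⟨a, b, c, d, -, -, -, rfl⟩ := hg
  exact Submodule.sub_mem _ (hz_mul (X_mem_hz a) (X_mem_hz b)) (hz_mul (X_mem_hz c) (X_mem_hz d))

lemma polyIdeal_hc {K : Type} [Field K] {P : Polyomino} [LinearOrder (PVertex P)] (x : PolyRing K P) (hx : x ∈ polyIdeal K P) (k : ℤ) :
    hc k x ∈ polyIdeal K P := by
  unfold polyIdeal at hx
  refine Submodule.span_induction (p := fun x _ => ∀ k, hc k x ∈ polyIdeal K P) ?_ ?_ ?_ ?_ hx k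
  · intro g hg k
    have : hc k g = g ∨ hc k g = 0 := by
      have := hc_mul (minor_hz hg) k 1
      rw [mul_one] at this
      by_cases hk : k = 2
      · left; rw [hk]; exact hc_eq (minor_hz hg)
      · right
        ext u
        rw [coeff_hc, coeff_zero]
        split_ifs with h
        · by_contra hc
          exact hk (h.symm.trans (minor_hz hg u hc))
        · rfl
    rcases this with h | h
    · rw [h]; exact Ideal.subset_span hg
    · rw [h]; exact Ideal.zero_mem _
  · intro k; rw [map_zero]; exact Ideal.zero_mem _
  · intro x y _ _ h1 h2 k
    rw [map_add]; exact Ideal.add_mem _ (h1 k) (h2 k)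
  · intro a x _ h k
    rw [smul_eq_mul]
    induction a using MvPolynomial.induction_on' with
    | monomial u c =>
      rw [hc_mul (monomial_mem_hz u c rfl)]
      exact Ideal.mul_mem_left _ _ (h _)
    | add p q hp hq =>
      rw [add_mul, map_add]; exact Ideal.add_mem _ hp hq

lemma polyIdeal_zero {K : Type} [Field K] {P : Polyomino} [LinearOrder (PVertex P)] (x : PolyRing K P) (hx : x ∈ polyIdeal K P) :
    coeff 0 x = 0 := by
  unfold polyIdeal at hx
  refine Submodule.span_induction (p := fun x _ => coeff 0 x = 0) ?_ ?_ ?_ ?_ hx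
  · intro g hg
    by_contra hc
    have := minor_hz hg 0 hc
    simp at this
  · simp
  · intro x y _ _ h1 h2
    rw [coeff_add, h1, h2, add_zero]
  · intro a x _ h
    rw [smul_eq_mul, ← constantCoeff_eq, map_mul, constantCoeff_eq, h, mul_zero]

/-- forget finiteness -/
noncomputable def toPre {K : Type} [Field K] {P : Polyomino} [LinearOrder (PVertex P)] {I : Ideal (PolyRing K P)} (R : MinimalGradedFreeResolution K P I) :
    PreRes (PVertex P) K I where
  t := R.t
  tw := R.tw
  mat := R.mat
  t0 := R.t0
  tw0 := R.tw0
  graded := by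
    intro d i j
    rcases R.graded d i j with h | ⟨e, h1, h2⟩
    · rw [h]; exact Submodule.zero_mem _
    · rw [mem_hz]
      intro u hu
      rw [← h1]
      have := h2 hu
      rw [show Finsupp.weight (1 : PVertex P → ℕ) u = u.degree from (DFunLike.congr_fun (Finsupp.degree_eq_weight_one (R := ℕ)) u).symm] at this
      exact_mod_cast this
  minimal := R.minimal
  aug := R.aug
  isexact := R.isexact

/-- add finiteness -/
noncomputable def ofPre {K : Type} [Field K] {P : Polyomino} [LinearOrder (PVertex P)] {I : Ideal (PolyRing K P)} (R : PreRes (PVertex P) K I)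
    (c : ℕ) (hc : ∀ d, c < d → R.t d = 0) : MinimalGradedFreeResolution K P I where
  len := c
  t := R.t
  tw := R.tw
  mat := R.mat
  t0 := R.t0
  tw0 := R.tw0
  finite := hc
  graded := by
    intro d i j
    by_cases h : R.mat d i j = 0
    · exact Or.inl h
    · right
      obtain ⟨u, hu⟩ := MvPolynomial.ne_zero_iff.1 h
      have hg := R.graded d i j
      refine ⟨u.degree, hg u hu, ?_⟩
      intro w hw
      rw [show Finsupp.weight (1 : PVertex P → ℕ) w = w.degree from (DFunLike.congr_fun (Finsupp.degree_eq_weight_one (R := ℕ)) w).symm]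
      have := (hg w hw).trans (hg u hu).symm
      exact_mod_cast this
  minimal := R.minimal
  aug := R.aug
  isexact := R.isexact

lemma conf_iff (P : Polyomino) (S : Shape) (hS : ∀ x y, (x, y) ∈ P.cells ↔ S.cell x y) (R : Finset (ℤ × ℤ)) :
    S.Conf R ↔ IsRookConfig P R := by
  unfold Shape.Conf IsRookConfig Shape.att attacking
  simp only [hS]
  constructor
  · rintro ⟨h1, h2⟩
    exact ⟨fun c hc => (hS c.1 c.2).2 (h1 c hc), fun c hc d hd h => h2 c hc d hd h.1 h.2⟩
  · rintro ⟨h1, h2⟩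
    exact ⟨fun c hc => (hS c.1 c.2).1 (h1 hc), fun c hc d hd h h' => h2 c hc d hd ⟨h, h'⟩⟩

theorem final (K : Type) [Field K] (P : Polyomino) (D : FrameData) (hP : IsFrame P D) :
    Nonempty (MinimalGradedFreeResolution K P (polyIdeal K P)) ∧
    ∀ res : MinimalGradedFreeResolution K P (polyIdeal K P),
      IsGreatest { z : ℤ | ∃ (d : ℕ) (i : Fin (res.t d)), z = res.tw d i - (d : ℤ) }
        (rookNumber P : ℤ) := by
  obtain ⟨S, hS⟩ := exists_shape P D hP
  let _ : LinearOrder (PVertex P) := LinearOrder.lift' (Fintype.equivFin (PVertex P)) (Equiv.injective _)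
  have hbdd : BddAbove { k | ∃ R : Finset (ℤ × ℤ), IsRookConfig P R ∧ R.card = k } := by
    refine ⟨P.cells.card, ?_⟩
    rintro k ⟨R, hR, rfl⟩
    exact Finset.card_le_card (by exact_mod_cast hR.1)
  have hne : { k | ∃ R : Finset (ℤ × ℤ), IsRookConfig P R ∧ R.card = k }.Nonempty :=
    ⟨0, ∅, ⟨by simp, by simp⟩, rfl⟩
  have h1 : ∃ R, S.Conf R ∧ R.card = rookNumber P := by
    obtain ⟨R, hR, hc⟩ := Nat.sSup_mem hne hbdd
    exact ⟨R, (conf_iff P S hS R).2 hR, hc⟩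
  have h2 : ∀ R, S.Conf R → R.card ≤ rookNumber P := fun R hR => le_csSup hbdd ⟨R, (conf_iff P S hS R).1 hR, rfl⟩
  obtain ⟨c, hc⟩ := (thePres K P S hS).core h1 h2
  constructor
  · obtain ⟨R⟩ := exists_preRes (polyIdeal K P) polyIdeal_hc polyIdeal_zero
    exact ⟨ofPre R c (hc R).1⟩
  · intro res
    exact (hc (toPre res)).2

end FrameReg

theorem frame_regularity_eq_rook_number (K : Type) [Field K] (P : Polyomino)
    (D : FrameData) (hP : IsFrame P D) :
    Nonempty (MinimalGradedFreeResolution K P (polyIdeal K P)) ∧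
    ∀ res : MinimalGradedFreeResolution K P (polyIdeal K P),
      IsGreatest { z : ℤ | ∃ (d : ℕ) (i : Fin (res.t d)), z = res.tw d i - (d : ℤ) }
        (rookNumber P : ℤ) := by
  exact FrameReg.final K P D hP
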